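/- Assume GRH. Then for every modulus q ≥ 3 the function E_q(e^y) has a limiting logarithmic distribution: there exists a Borel probability measure μ_q on ℝ such that for every bounded Lipschitz continuous function f : ℝ → ℝ, lim_{Y→∞} (1/Y)·∫₂^Y f(E_q(e^y)) dy = ∫_ℝ f(t) dμ_q(t). -/

import Mathlib

open Filter Topology MeasureTheory

noncomputable section

/-- The L-function of a Dirichlet character mod `q`, as a total function (junk value `0`
when `q = 0`). -/
def LFun (q : ℕ) (χ : DirichletCharacter ℂ q) (s : ℂ) : ℂ :=
  if h : q ≠ 0 then
    haveI : NeZero q := ⟨h⟩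
    DirichletCharacter.LFunction χ s
  else 0

/-- GRH for all Dirichlet L-functions. -/
def GRH : Prop :=
  ∀ (N : ℕ) (χ : DirichletCharacter ℂ N), N ≠ 0 → χ.IsPrimitive →
    ∀ s : ℂ, 0 < s.re → s.re < 1 → LFun N χ s = 0 → s.re = 1 / 2

/-- The set of nonnegative imaginary parts of nontrivial zeros of L-functions of primitive
Dirichlet characters mod `q`. -/
def LISet (q : ℕ) : Set ℝ :=
  {γ : ℝ | 0 ≤ γ ∧ ∃ χ : DirichletCharacter ℂ q, χ.IsPrimitive ∧
    ∃ s : ℂ, 0 < s.re ∧ s.re < 1 ∧ s.im = γ ∧ LFun q χ s = 0}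

/-- The Linear Independence hypothesis for modulus `q`. -/
def LI (q : ℕ) : Prop :=
  LinearIndependent ℚ ((↑) : LISet q → ℝ)

/-- Number of primes `p ≤ x` with `p ≡ a (mod q)`. -/
def primePi (q : ℕ) (a : ZMod q) (x : ℝ) : ℕ :=
  Nat.card {p : ℕ | p.Prime ∧ (p : ℝ) ≤ x ∧ (p : ZMod q) = a}

/-- Number of primes `p ≤ x` whose residue class mod `q` is a square in `(ZMod q)ˣ`. -/
def primePiR (q : ℕ) (x : ℝ) : ℕ :=
  Nat.card {p : ℕ | p.Prime ∧ (p : ℝ) ≤ x ∧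
    ∃ u : (ZMod q)ˣ, ((u : ZMod q)) ^ 2 = (p : ZMod q)}

/-- Number of primes `p ≤ x` coprime to `q` whose residue class mod `q` is not a square
in `(ZMod q)ˣ`. -/
def primePiNR (q : ℕ) (x : ℝ) : ℕ :=
  Nat.card {p : ℕ | p.Prime ∧ (p : ℝ) ≤ x ∧ IsUnit (p : ZMod q) ∧
    ¬ ∃ u : (ZMod q)ˣ, ((u : ZMod q)) ^ 2 = (p : ZMod q)}

/-- `ρ(q)`: the index of the subgroup of squares in `(ZMod q)ˣ`. -/
def rho (q : ℕ) : ℕ :=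
  (MonoidHom.range (powMonoidHom 2 : (ZMod q)ˣ →* (ZMod q)ˣ)).index

/-- Partial logarithmic averages of a set of naturals. -/
def logSum (P : Set ℕ) (N : ℕ) : ℝ :=
  (Real.log N)⁻¹ * ∑ n ∈ Finset.range (N + 1), Set.indicator P (fun n => (n : ℝ)⁻¹) n

/-- `P` has logarithmic density `d`. -/
def HasLogDensity (P : Set ℕ) (d : ℝ) : Prop :=
  Filter.Tendsto (logSum P) Filter.atTop (nhds d)

/-- The set of `n` for which non-residues beat residues:
`π(n;q,NR) > (ρ(q)-1)·π(n;q,R)`. -/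
def raceNR (q : ℕ) : Set ℕ :=
  {n : ℕ | ((rho q : ℝ) - 1) * primePiR q n < primePiNR q n}

open Classical in
/-- The multiplicity (analytic order) of `s` as a zero of `f`. -/
def zeroMult (f : ℂ → ℂ) (s : ℂ) : ℕ :=
  if h : ∃ n : ℕ, ∃ g : ℂ → ℂ, AnalyticAt ℂ g s ∧ g s ≠ 0 ∧
      (∀ᶠ z in nhds s, f z = (z - s) ^ n * g z)
  then h.choose else 0

/-- The product of the L-functions of the nontrivial real (quadratic) characters mod `q`. -/
def Zfun (q : ℕ) (s : ℂ) : ℂ :=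
  ∏ᶠ χ ∈ {χ : DirichletCharacter ℂ q | χ ^ 2 = 1 ∧ χ ≠ 1}, LFun q χ s

/-- `∑_γ m(γ)/(1/4+γ²)`, the sum over the zeros `1/2+iγ` of `L(s,χ)`, with multiplicity. -/
def zeroSumInv (q : ℕ) (χ : DirichletCharacter ℂ q) : ℝ :=
  ∑' γ : ℝ, (zeroMult (LFun q χ) (1 / 2 + γ * Complex.I) : ℝ) / (1 / 4 + γ ^ 2)

/-- `ω(q)`: number of distinct prime factors. -/
def omega (q : ℕ) : ℕ := q.primeFactors.card

/-- The radical `q' = ∏_{p ∣ q} p`. -/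
def radical (q : ℕ) : ℕ := ∏ p ∈ q.primeFactors, p

/-- The race set for a general linear combination of prime counting functions. -/
def raceSet (q : ℕ) {k : ℕ} (a : Fin k → (ZMod q)ˣ) (α : Fin k → ℝ) : Set ℕ :=
  {n : ℕ | 0 < ∑ i, α i * primePi q ((a i : ZMod q)) n}

/-- `E_q(x) = (π(x;q,NR) − (ρ(q)−1)π(x;q,R))·log x/√x`. -/
def Efun (q : ℕ) (x : ℝ) : ℝ :=
  ((primePiNR q x : ℝ) - ((rho q : ℝ) - 1) * primePiR q x) * Real.log x / Real.sqrt x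

/-- `μ` is the limiting logarithmic distribution of `E_q(e^y)`. -/
def IsLimitingDistribution (q : ℕ) (μ : Measure ℝ) : Prop :=
  IsProbabilityMeasure μ ∧
    ∀ f : ℝ → ℝ, (∃ C : ℝ, ∀ x, |f x| ≤ C) → (∃ K : NNReal, LipschitzWith K f) →
      Tendsto (fun Y : ℝ => (1 / Y) * ∫ y in (2:ℝ)..Y, f (Efun q (Real.exp y)))
        atTop (nhds (∫ t, f t ∂μ))

/-- `S(q)`: sum over the nontrivial real characters mod `q` of `∑_γ m(γ)/(1/4+γ²)`. -/
def Sq (q : ℕ) : ℝ :=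
  ∑ᶠ χ ∈ {χ : DirichletCharacter ℂ q | χ ^ 2 = 1 ∧ χ ≠ 1}, zeroSumInv q χ

/-- The standard normal distribution function `Φ`. -/
def normalCDF (x : ℝ) : ℝ :=
  (Real.sqrt (2 * Real.pi))⁻¹ * ∫ t in Set.Iic x, Real.exp (-t ^ 2 / 2)

end

open scoped Classical
open Asymptotics

/-! ### Trigonometric polynomials and mean almost periodicity -/

/-- Trigonometric polynomials `∑ c_γ e^{iγu}` with real frequencies. -/
noncomputable def trigPoly : Submodule ℂ (ℝ → ℂ) :=
  Submodule.span ℂ (Set.range fun γ : ℝ => fun u : ℝ => Complex.exp (Complex.I * γ * u))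

/-- `F` is a limit of trigonometric polynomials in mean. -/
def MeanAP (F : ℝ → ℂ) : Prop :=
  (∀ a b, IntervalIntegrable F volume a b) ∧
    ∀ ε > 0, ∃ P ∈ trigPoly, ∀ᶠ Y : ℝ in atTop, ∫ u in (2 : ℝ)..Y, ‖F u - P u‖ ≤ ε * Y

theorem exp_mem_trigPoly (γ : ℝ) :
    (fun u : ℝ => Complex.exp (Complex.I * γ * u)) ∈ trigPoly :=
  Submodule.subset_span ⟨γ, rfl⟩

theorem const_mem_trigPoly (c : ℂ) : (fun _ : ℝ => c) ∈ trigPoly := by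
  have := trigPoly.smul_mem c (exp_mem_trigPoly 0)
  convert this using 1
  ext u
  simp

theorem trigPoly_mul {P Q : ℝ → ℂ} (hP : P ∈ trigPoly) (hQ : Q ∈ trigPoly) : P * Q ∈ trigPoly := by
  have h := Submodule.mul_mem_mul hP hQ
  rw [trigPoly, Submodule.span_mul_span] at h
  refine Submodule.span_mono ?_ h
  rintro _ ⟨_, ⟨a, rfl⟩, _, ⟨b, rfl⟩, rfl⟩
  refine ⟨a + b, ?_⟩
  ext u
  simp only [Pi.mul_apply, ← Complex.exp_add]
  push_cast
  ring_nf

theorem trigPoly_conj {P : ℝ → ℂ} (hP : P ∈ trigPoly) :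
    (fun u => (starRingEnd ℂ) (P u)) ∈ trigPoly := by
  induction hP using Submodule.span_induction with
  | mem x h =>
    obtain ⟨γ, rfl⟩ := h
    convert exp_mem_trigPoly (-γ) using 1
    ext u
    rw [← Complex.exp_conj]
    simp
  | zero => simpa using const_mem_trigPoly 0
  | add x y _ _ hx hy =>
    simp only [Pi.add_apply, map_add]
    exact trigPoly.add_mem hx hy
  | smul a x _ hx =>
    simp only [Pi.smul_apply, smul_eq_mul, map_mul]
    exact trigPoly.smul_mem ((starRingEnd ℂ) a) hx

theorem trigPoly_re {P : ℝ → ℂ} (hP : P ∈ trigPoly) : (fun u => ((P u).re : ℂ)) ∈ trigPoly := by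
  have := trigPoly.smul_mem (1 / 2 : ℂ) (trigPoly.add_mem hP (trigPoly_conj hP))
  convert this using 1
  ext u
  simp only [Pi.smul_apply, Pi.add_apply, smul_eq_mul, Complex.add_conj]
  push_cast
  ring

theorem trigPoly_eval {P : ℝ → ℂ} (hP : P ∈ trigPoly) (p : Polynomial ℂ) :
    (fun u => p.eval (P u)) ∈ trigPoly := by
  induction p using Polynomial.induction_on' with
  | add p q hp hq =>
    simp only [Polynomial.eval_add]
    exact trigPoly.add_mem hp hq
  | monomial n a =>
    simp only [Polynomial.eval_monomial]
    refine trigPoly.smul_mem a (?_ : (fun u => P u ^ n) ∈ trigPoly)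
    induction n with
    | zero => simpa using const_mem_trigPoly 1
    | succ n ih => simp only [pow_succ]; exact trigPoly_mul ih hP

theorem trigPoly_continuous {P : ℝ → ℂ} (hP : P ∈ trigPoly) : Continuous P := by
  induction hP using Submodule.span_induction with
  | mem x h => obtain ⟨γ, rfl⟩ := h; fun_prop
  | zero => exact continuous_const
  | add x y _ _ hx hy => exact hx.add hy
  | smul a x _ hx => exact hx.const_smul a

theorem trigPoly_bounded {P : ℝ → ℂ} (hP : P ∈ trigPoly) : ∃ C, 0 ≤ C ∧ ∀ u, ‖P u‖ ≤ C := by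
  induction hP using Submodule.span_induction with
  | mem x h =>
    obtain ⟨γ, rfl⟩ := h
    refine ⟨1, zero_le_one, fun u => ?_⟩
    simp [Complex.norm_exp]
  | zero => exact ⟨0, le_rfl, by simp⟩
  | add x y _ _ hx hy =>
    obtain ⟨C, hC, h1⟩ := hx
    obtain ⟨D, hD, h2⟩ := hy
    exact ⟨C + D, by positivity, fun u => (norm_add_le _ _).trans (add_le_add (h1 u) (h2 u))⟩
  | smul a x _ hx =>
    obtain ⟨C, hC, h1⟩ := hx
    refine ⟨‖a‖ * C, by positivity, fun u => ?_⟩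
    simp only [Pi.smul_apply, norm_smul]
    gcongr
    exact h1 u

theorem trigPoly_tendsto_mean {P : ℝ → ℂ} (hP : P ∈ trigPoly) :
    ∃ m : ℂ, Tendsto (fun Y : ℝ => (1 / Y : ℂ) * ∫ u in (2 : ℝ)..Y, P u) atTop (𝓝 m) := by
  induction hP using Submodule.span_induction with
  | mem x h =>
    obtain ⟨γ, rfl⟩ := h
    by_cases hγ : γ = 0
    · subst hγ
      refine ⟨1, ?_⟩
      have h1 : Tendsto (fun Y : ℝ => 1 - 2 * Y⁻¹) atTop (𝓝 (1 - 2 * 0)) :=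
        (tendsto_inv_atTop_zero.const_mul 2).const_sub 1
      have h2 := (Complex.continuous_ofReal.tendsto _).comp h1
      simp only [mul_zero, sub_zero, Complex.ofReal_one] at h2
      refine h2.congr' ?_
      filter_upwards [eventually_gt_atTop 0] with Y hY
      have hY' : (Y : ℂ) ≠ 0 := by exact_mod_cast hY.ne'
      simp
      field_simp
    · refine ⟨0, ?_⟩
      have hc : Complex.I * γ ≠ 0 := by simp [hγ]
      refine squeeze_zero_norm' (a := fun Y : ℝ => Y⁻¹ * (2 / |γ|)) ?_ ?_
      · filter_upwards [eventually_gt_atTop 0] with Y hY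
        rw [integral_exp_mul_complex hc, norm_mul, norm_div _ (Complex.I * (γ : ℂ))]
        have e1 : ‖(1 / Y : ℂ)‖ = Y⁻¹ := by simp [abs_of_pos hY]
        have e2 : ‖Complex.I * (γ : ℂ)‖ = |γ| := by simp
        rw [e1, e2]
        gcongr
        refine (norm_sub_le _ _).trans ?_
        simp [Complex.norm_exp]
        norm_num
      · simpa using tendsto_inv_atTop_zero.mul_const (2 / |γ|)
  | zero => exact ⟨0, by simp⟩
  | add x y hx' hy' hx hy =>
    obtain ⟨m, hm⟩ := hx
    obtain ⟨n, hn⟩ := hy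
    refine ⟨m + n, (hm.add hn).congr fun Y => ?_⟩
    simp only [Pi.add_apply]
    rw [intervalIntegral.integral_add, mul_add]
    · exact (trigPoly_continuous hx').intervalIntegrable _ _
    · exact (trigPoly_continuous hy').intervalIntegrable _ _
  | smul a x _ hx =>
    obtain ⟨m, hm⟩ := hx
    refine ⟨a * m, (hm.const_mul a).congr fun Y => ?_⟩
    simp only [Pi.smul_apply, smul_eq_mul]
    rw [intervalIntegral.integral_const_mul]
    ring

theorem exists_tendsto_of_approx {A : ℝ → ℝ}
    (h : ∀ ε > 0, ∃ B : ℝ → ℝ, (∃ m, Tendsto B atTop (𝓝 m)) ∧ ∀ᶠ Y in atTop, |A Y - B Y| ≤ ε) :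
    ∃ m, Tendsto A atTop (𝓝 m) := by
  refine cauchy_map_iff_exists_tendsto.1 (Metric.cauchy_iff.2 ⟨inferInstance, fun ε hε => ?_⟩)
  obtain ⟨B, ⟨m, hm⟩, hB⟩ := h (ε / 8) (by positivity)
  have h1 : ∀ᶠ Y in atTop, |A Y - m| < ε / 2 := by
    filter_upwards [hB, (Metric.tendsto_nhds.1 hm) (ε / 8) (by positivity)] with Y h1 h2
    rw [Real.dist_eq] at h2
    have := abs_add_le (A Y - B Y) (B Y - m)
    rw [sub_add_sub_cancel] at this
    linarith
  refine ⟨A '' {Y | |A Y - m| < ε / 2}, image_mem_map h1, ?_⟩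
  rintro _ ⟨x, hx, rfl⟩ _ ⟨y, hy, rfl⟩
  rw [Set.mem_ofPred_eq] at hx hy
  rw [Real.dist_eq]
  rw [abs_lt] at *
  constructor <;> linarith [hx.1, hx.2, hy.1, hy.2]

theorem trigPoly_comp_tendsto_mean {P : ℝ → ℂ} (hP : P ∈ trigPoly) {f : ℝ → ℝ}
    (hf : Continuous f) :
    ∃ m : ℝ, Tendsto (fun Y : ℝ => (1 / Y) * ∫ u in (2 : ℝ)..Y, f (P u).re) atTop (𝓝 m) := by
  obtain ⟨C, hC, hPC⟩ := trigPoly_bounded hP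
  refine exists_tendsto_of_approx fun ε hε => ?_
  obtain ⟨p, hp⟩ := exists_polynomial_near_of_continuousOn (-C) C f hf.continuousOn ε hε
  have hPcont := trigPoly_continuous hP
  have hre : Continuous fun u => (P u).re := Complex.continuous_re.comp hPcont
  refine ⟨fun Y => (1 / Y) * ∫ u in (2 : ℝ)..Y, p.eval (P u).re, ?_, ?_⟩
  · have hQ := trigPoly_eval (trigPoly_re hP) (p.map (algebraMap ℝ ℂ))
    obtain ⟨m, hm⟩ := trigPoly_tendsto_mean hQ
    refine ⟨m.re, ((Complex.continuous_re.tendsto _).comp hm).congr fun Y => ?_⟩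
    have e : ∀ u, (p.map (algebraMap ℝ ℂ)).eval ((P u).re : ℂ) = ((p.eval (P u).re : ℝ) : ℂ) := by
      intro u
      rw [Polynomial.eval_map]
      exact Polynomial.eval₂_at_apply (algebraMap ℝ ℂ) _
    simp only [Function.comp, e]
    rw [intervalIntegral.integral_ofReal]
    norm_cast
  · filter_upwards [eventually_ge_atTop 2] with Y hY
    rw [← mul_sub, ← intervalIntegral.integral_sub, abs_mul]
    · have h1 : |∫ u in (2 : ℝ)..Y, (f (P u).re - p.eval (P u).re)| ≤ ε * |Y - 2| := by
        rw [← Real.norm_eq_abs]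
        rw [← Real.norm_eq_abs]
        refine intervalIntegral.norm_integral_le_of_norm_le_const fun u _ => ?_
        have := (hp (P u).re (by
          have := (Complex.abs_re_le_norm (P u)).trans (hPC u)
          exact abs_le.1 this)).le
        rw [Real.norm_eq_abs, abs_sub_comm]
        exact this
      have hY0 : 0 < Y := by linarith
      rw [abs_of_nonneg (by linarith : 0 ≤ Y - 2)] at h1
      rw [abs_of_nonneg (by positivity : 0 ≤ 1 / Y)]
      calc 1 / Y * _ ≤ 1 / Y * (ε * (Y - 2)) := by gcongr
        _ ≤ 1 / Y * (ε * Y) := by gcongr; linarith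
        _ = ε := by field_simp
    · exact (hf.comp hre).intervalIntegrable _ _
    · exact (p.continuous.comp hre).intervalIntegrable _ _


theorem MeanAP.comp_tendsto_mean {E : ℝ → ℝ} (hE : MeanAP fun u => (E u : ℂ)) (hm : Measurable E)
    {f : ℝ → ℝ} {C : ℝ} (hC : ∀ x, |f x| ≤ C) {K : NNReal} (hf : LipschitzWith K f) :
    ∃ m : ℝ, Tendsto (fun Y : ℝ => (1 / Y) * ∫ u in (2 : ℝ)..Y, f (E u)) atTop (𝓝 m) := by
  refine exists_tendsto_of_approx fun ε hε => ?_
  obtain ⟨P, hP, hev⟩ := hE.2 (ε / (K + 1)) (by positivity)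
  refine ⟨_, trigPoly_comp_tendsto_mean hP hf.continuous, ?_⟩
  have hPcont := trigPoly_continuous hP
  have hre : Continuous fun u => (P u).re := Complex.continuous_re.comp hPcont
  filter_upwards [hev, eventually_ge_atTop 2] with Y h1 hY
  have hY0 : 0 < Y := by linarith
  have i1 : IntervalIntegrable (fun u => f (E u)) volume 2 Y := by
    refine (intervalIntegrable_const (c := C)).mono_fun
      (hf.continuous.measurable.comp hm).aestronglyMeasurable (ae_of_all _ fun u => ?_)
    exact (hC _).trans (le_abs_self C)
  have i2 : IntervalIntegrable (fun u => f (P u).re) volume 2 Y :=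
    (hf.continuous.comp hre).intervalIntegrable _ _
  have i3 : IntervalIntegrable (fun u => ‖(E u : ℂ) - P u‖) volume 2 Y :=
    ((hE.1 2 Y).sub (hPcont.intervalIntegrable _ _)).norm
  rw [← mul_sub, ← intervalIntegral.integral_sub i1 i2, abs_mul, abs_of_nonneg (by positivity)]
  have h2 : |∫ u in (2 : ℝ)..Y, (f (E u) - f (P u).re)| ≤
      ∫ u in (2 : ℝ)..Y, K * ‖(E u : ℂ) - P u‖ := by
    refine (intervalIntegral.abs_integral_le_integral_abs hY).trans ?_
    refine intervalIntegral.integral_mono_on hY (i1.sub i2).abs (i3.const_mul _) fun u _ => ?_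
    refine (hf.dist_le_mul _ _).trans ?_
    gcongr
    rw [Real.dist_eq]
    have := Complex.abs_re_le_norm ((E u : ℂ) - P u)
    simpa using this
  rw [intervalIntegral.integral_const_mul] at h2
  calc 1 / Y * _ ≤ 1 / Y * (K * (ε / (K + 1) * Y)) := by gcongr; exact h2.trans (by gcongr)
    _ = ε * (K / (K + 1)) := by field_simp
    _ ≤ ε * 1 := by
      gcongr
      rw [div_le_one (by positivity)]
      linarith
    _ = ε := mul_one ε

theorem MeanAP.mean_norm_bounded {F : ℝ → ℂ} (hF : MeanAP F) :
    ∃ C, 0 ≤ C ∧ ∀ᶠ Y : ℝ in atTop, ∫ u in (2 : ℝ)..Y, ‖F u‖ ≤ C * Y := by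
  obtain ⟨P, hP, hev⟩ := hF.2 1 one_pos
  obtain ⟨C, hC, hPC⟩ := trigPoly_bounded hP
  have hPcont := trigPoly_continuous hP
  refine ⟨1 + C, by positivity, ?_⟩
  filter_upwards [hev, eventually_ge_atTop 2] with Y h1 hY
  have i2 := (hPcont.intervalIntegrable (μ := volume) 2 Y)
  have i3 := ((hF.1 2 Y).sub i2).norm
  calc ∫ u in (2 : ℝ)..Y, ‖F u‖ ≤ ∫ u in (2 : ℝ)..Y, (‖F u - P u‖ + C) := by
        refine intervalIntegral.integral_mono_on hY (hF.1 2 Y).norm (i3.add (by simp)) fun u _ => ?_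
        have := norm_add_le (F u - P u) (P u)
        rw [sub_add_cancel] at this
        linarith [hPC u]
    _ = (∫ u in (2 : ℝ)..Y, ‖F u - P u‖) + C * (Y - 2) := by
        rw [intervalIntegral.integral_add i3 (by simp)]
        simp [mul_comm]
    _ ≤ 1 * Y + C * Y := by gcongr; linarith
    _ = _ := by ring

theorem MeanAP.exists_limiting_measure {E : ℝ → ℝ} (hE : MeanAP fun u => (E u : ℂ))
    (hm : Measurable E) :
    ∃ μ : Measure ℝ, IsProbabilityMeasure μ ∧
    ∀ f : ℝ → ℝ, (∃ C : ℝ, ∀ x, |f x| ≤ C) → (∃ K : NNReal, LipschitzWith K f) →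
      Tendsto (fun Y : ℝ => (1 / Y) * ∫ y in (2 : ℝ)..Y, f (E y)) atTop (𝓝 (∫ t, f t ∂μ)) := by
  let κ : ℕ → Measure ℝ := fun n => (ENNReal.ofReal (n + 1))⁻¹ • volume.restrict (Set.Ioc 2 (n + 3 : ℝ))
  have hκ : ∀ n, IsProbabilityMeasure (κ n) := by
    intro n
    constructor
    simp only [κ, Measure.smul_apply, Measure.restrict_apply MeasurableSet.univ, Set.univ_inter,
      Real.volume_Ioc, smul_eq_mul]
    rw [show (n + 3 - 2 : ℝ) = n + 1 by ring]
    refine ENNReal.inv_mul_cancel ?_ ENNReal.ofReal_ne_top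
    simp only [ne_eq, ENNReal.ofReal_eq_zero, not_le]
    positivity
  have hint : ∀ n (g : ℝ → ℝ), ∫ u, g u ∂(κ n) = (n + 1 : ℝ)⁻¹ * ∫ u in (2 : ℝ)..(n + 3), g u := by
    intro n g
    have h3 : (2 : ℝ) ≤ n + 3 := by have := n.cast_nonneg (α := ℝ); linarith
    simp only [κ]
    rw [integral_smul_measure, intervalIntegral.integral_of_le h3, ENNReal.toReal_inv,
      ENNReal.toReal_ofReal (by positivity), smul_eq_mul]
  let ν : ℕ → ProbabilityMeasure ℝ := fun n =>
    ⟨(κ n).map E, Measure.isProbabilityMeasure_map hm.aemeasurable⟩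
  have hν : ∀ n (g : ℝ → ℝ), Measurable g →
      ∫ t, g t ∂(ν n : Measure ℝ) = (n + 1 : ℝ)⁻¹ * ∫ u in (2 : ℝ)..(n + 3), g (E u) := by
    intro n g hg
    rw [← hint]
    exact integral_map hm.aemeasurable hg.aestronglyMeasurable
  obtain ⟨C, hC, hCev⟩ := hE.mean_norm_bounded
  have htop : Tendsto (fun n : ℕ => (n + 3 : ℝ)) atTop atTop :=
    tendsto_atTop_add_const_right _ _ tendsto_natCast_atTop_atTop
  obtain ⟨N, hN⟩ := eventually_atTop.1 (htop.eventually hCev)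
  have htail : ∀ n ≥ N, ∀ R > 0, (ν n : Measure ℝ).real {x | R ≤ |x|} ≤ 3 * C / R := by
    intro n hn R hR
    have e1 : (ν n : Measure ℝ).real {x | R ≤ |x|} = (κ n).real {u | R ≤ |E u|} := by
      simp only [Measure.real]
      congr 1
      exact Measure.map_apply hm (measurableSet_le measurable_const measurable_abs)
    have hi : Integrable (fun u => |E u|) (κ n) := by
      refine Integrable.smul_measure ?_ ?_
      · have := (hE.1 2 (n + 3)).norm
        simp only [Complex.norm_real, Real.norm_eq_abs] at this
        rw [intervalIntegrable_iff_integrableOn_Ioc_of_le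
          (by have := n.cast_nonneg (α := ℝ); linarith)] at this
        exact this
      · simp only [ne_eq, ENNReal.inv_eq_top, ENNReal.ofReal_eq_zero, not_le]
        positivity
    have h2 := mul_meas_ge_le_integral_of_nonneg (ae_of_all _ fun u => abs_nonneg (E u)) hi R
    rw [hint] at h2
    have h3 := hN n hn
    simp only [Complex.norm_real, Real.norm_eq_abs] at h3
    rw [e1, le_div_iff₀ hR, mul_comm]
    refine h2.trans ?_
    have hn1 : (0 : ℝ) < n + 1 := by positivity
    calc _ ≤ (n + 1 : ℝ)⁻¹ * (C * (n + 3)) := by gcongr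
      _ = C * ((n + 3) / (n + 1)) := by field_simp
      _ ≤ C * 3 := by
        gcongr
        rw [div_le_iff₀ hn1]
        linarith
      _ = 3 * C := by ring
  have htight : IsTightMeasureSet {x | ∃ μ ∈ (ν '' Set.Ici N), (μ : Measure ℝ) = x} := by
    rw [isTightMeasureSet_iff_exists_isCompact_measure_compl_le]
    intro ε hε
    rcases eq_or_ne ε ⊤ with rfl | hε'
    · exact ⟨∅, isCompact_empty, fun _ _ => le_top⟩
    have hε0 : 0 < ε.toReal := ENNReal.toReal_pos hε.ne' hε'
    set R := 3 * C / ε.toReal + 1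
    have hR : 0 < R := by positivity
    refine ⟨Set.Icc (-R) R, isCompact_Icc, ?_⟩
    rintro _ ⟨_, ⟨n, hn, rfl⟩, rfl⟩
    have h1 := htail n hn R hR
    have h2 : (ν n : Measure ℝ) (Set.Icc (-R) R)ᶜ ≤ (ν n : Measure ℝ) {x | R ≤ |x|} := by
      refine measure_mono fun x hx => ?_
      simp only [Set.mem_compl_iff, Set.mem_Icc, ← abs_le, not_le] at hx
      exact hx.le
    refine h2.trans ?_
    rw [← ENNReal.ofReal_toReal hε', ← ENNReal.ofReal_toReal (measure_ne_top _ {x | R ≤ |x|})]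
    refine ENNReal.ofReal_le_ofReal (h1.trans ?_)
    rw [div_le_iff₀ hR]
    have : ε.toReal * R = 3 * C + ε.toReal := by simp only [R]; field_simp
    linarith
  obtain ⟨μ, -, hμ⟩ := (isCompact_closure_of_isTightMeasureSet htight).exists_mapClusterPt
    (f := atTop) (u := ν) (by
      refine le_principal_iff.2 ?_
      filter_upwards [image_mem_map (Ici_mem_atTop N)] with x hx using subset_closure hx)
  refine ⟨μ, inferInstance, ?_⟩
  rintro f ⟨B, hB⟩ ⟨K, hK⟩
  obtain ⟨m, hm'⟩ := hE.comp_tendsto_mean hm hB hK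
  suffices m = ∫ t, f t ∂(μ : Measure ℝ) by rwa [← this]
  let φ : BoundedContinuousFunction ℝ ℝ := BoundedContinuousFunction.ofNormedAddCommGroup f
    hK.continuous B hB
  have h1 : Tendsto (fun n => ∫ t, f t ∂(ν n : Measure ℝ)) atTop (𝓝 m) := by
    have h2 := hm'.comp htop
    have h3 : Tendsto (fun n : ℕ => ((n + 3 : ℝ) / (n + 1))) atTop (𝓝 1) := by
      have : Tendsto (fun n : ℕ => 1 + 2 * (1 / ((n : ℝ) + 1))) atTop (𝓝 (1 + 2 * 0)) :=
        (tendsto_one_div_add_atTop_nhds_zero_nat.const_mul 2).const_add 1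
      rw [mul_zero, add_zero] at this
      refine this.congr fun n => ?_
      have hn1 : (0 : ℝ) < n + 1 := by positivity
      field_simp
      ring
    have h4 := h3.mul h2
    rw [one_mul] at h4
    refine h4.congr fun n => ?_
    rw [hν n f hK.continuous.measurable]
    have hn1 : (0 : ℝ) < n + 1 := by positivity
    have hn3 : (0 : ℝ) < n + 3 := by positivity
    simp only [Function.comp]
    field_simp
  have h5 := hμ.tendsto_comp (ProbabilityMeasure.continuous_integral_boundedContinuousFunction φ).continuousAt
  have h6 : MapClusterPt (∫ t, f t ∂(μ : Measure ℝ)) atTop (fun n => ∫ t, f t ∂(ν n : Measure ℝ)) := h5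
  exact (eq_of_nhds_neBot (ClusterPt.mono h6 h1)).symm

/-! ### A Plancherel inequality after a contour shift -/

theorem integral_vertical_line_eq {f : ℂ → ℂ} {a b : ℝ} (hab : a ≤ b)
    (hf : ∀ s : ℂ, a ≤ s.re → s.re ≤ b → DifferentiableAt ℂ f s)
    (ha : Integrable fun t : ℝ => f (a + t * Complex.I))
    (hb : Integrable fun t : ℝ => f (b + t * Complex.I))
    {g : ℝ → ℝ} (hg : Tendsto g atTop (𝓝 0))
    (hd : ∀ σ t : ℝ, a ≤ σ → σ ≤ b → ‖f (σ + t * Complex.I)‖ ≤ g |t|) :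
    ∫ t : ℝ, f (a + t * Complex.I) = ∫ t : ℝ, f (b + t * Complex.I) := by
  have key : ∀ T : ℝ, 0 ≤ T → ‖(∫ t in (-T)..T, f (b + t * Complex.I)) -
      ∫ t in (-T)..T, f (a + t * Complex.I)‖ ≤ 2 * (g T * |b - a|) := by
    intro T hT
    have h := Complex.integral_boundary_rect_eq_zero_of_differentiableOn f (a - T * Complex.I)
      (b + T * Complex.I) (by
        intro s hs
        have hs1 := hs.1
        simp only [Set.mem_preimage, Complex.sub_re, Complex.ofReal_re, Complex.mul_re, Complex.I_re,
          mul_zero, Complex.ofReal_im, Complex.I_im, sub_self, sub_zero, Complex.add_re,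
          add_zero, zero_mul, Set.uIcc_of_le hab, Set.mem_Icc] at hs1
        exact (hf s hs1.1 hs1.2).differentiableWithinAt)
    simp only [Complex.sub_re, Complex.ofReal_re, Complex.mul_re, Complex.I_re, mul_zero,
      Complex.ofReal_im, Complex.I_im, sub_self, sub_zero, Complex.add_re, add_zero,
      Complex.sub_im, Complex.mul_im, mul_one, zero_sub, Complex.add_im, zero_add] at h
    have h1 : ‖∫ x in a..b, f (x + ((-T : ℝ) : ℂ) * Complex.I)‖ ≤ g T * |b - a| := by
      refine intervalIntegral.norm_integral_le_of_norm_le_const fun x hx => ?_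
      rw [Set.uIoc_of_le hab] at hx
      simpa [abs_of_nonneg hT] using hd x (-T) hx.1.le hx.2
    have h2 : ‖∫ x in a..b, f (x + (T : ℂ) * Complex.I)‖ ≤ g T * |b - a| := by
      refine intervalIntegral.norm_integral_le_of_norm_le_const fun x hx => ?_
      rw [Set.uIoc_of_le hab] at hx
      simpa [abs_of_nonneg hT] using hd x T hx.1.le hx.2
    have h3 : Complex.I • ((∫ t in (-T)..T, f (b + t * Complex.I)) -
        ∫ t in (-T)..T, f (a + t * Complex.I)) =
        (∫ x in a..b, f (x + (T : ℂ) * Complex.I)) -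
        ∫ x in a..b, f (x + ((-T : ℝ) : ℂ) * Complex.I) := by
      rw [smul_sub]
      linear_combination h
    have h4 := congrArg norm h3
    rw [norm_smul, Complex.norm_I, one_mul] at h4
    rw [h4]
    refine (norm_sub_le _ _).trans ?_
    linarith
  have l1 := (intervalIntegral_tendsto_integral hb tendsto_neg_atTop_atBot tendsto_id).sub
    (intervalIntegral_tendsto_integral ha tendsto_neg_atTop_atBot tendsto_id)
  have l2 : Tendsto (fun T : ℝ => (∫ t in (-T)..T, f (b + t * Complex.I)) -
      ∫ t in (-T)..T, f (a + t * Complex.I)) atTop (𝓝 0) := by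
    refine squeeze_zero_norm' (a := fun T => 2 * (g T * |b - a|)) ?_ ?_
    · filter_upwards [eventually_ge_atTop 0] with T hT using key T hT
    · simpa using (hg.mul_const |b - a|).const_mul 2
  exact (sub_eq_zero.1 (tendsto_nhds_unique l1 l2)).symm

theorem differentiable_laplace_of_compactSupport {g : ℝ → ℝ} (hg : Continuous g)
    (hc : HasCompactSupport g) :
    Differentiable ℂ fun s : ℂ => ∫ u : ℝ, (g u : ℂ) * Complex.exp (s * u) := by
  intro s
  have hgc : Continuous fun u => (g u : ℂ) := Complex.continuous_ofReal.comp hg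
  have hcc : HasCompactSupport fun u => (g u : ℂ) := hc.comp_left Complex.ofReal_zero
  refine (hasDerivAt_integral_of_dominated_loc_of_deriv_le (s := Metric.ball s 1)
    (F' := fun z u => (g u : ℂ) * (u * Complex.exp (z * u)))
    (bound := fun u => |g u| * (|u| * Real.exp ((|s.re| + 1) * |u|)))
    (Metric.ball_mem_nhds s one_pos) ?_ ?_ ?_ ?_ ?_ ?_).2.differentiableAt
  · exact Eventually.of_forall fun z => Continuous.aestronglyMeasurable (by fun_prop)
  · exact (by fun_prop : Continuous fun u : ℝ => (g u : ℂ) * Complex.exp (s * u)).integrable_of_hasCompactSupport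
      hcc.mul_right
  · exact Continuous.aestronglyMeasurable (by fun_prop)
  · refine ae_of_all _ fun u z hz => ?_
    rw [norm_mul, norm_mul, Complex.norm_exp, Complex.norm_real, Complex.norm_real,
      Real.norm_eq_abs, Real.norm_eq_abs]
    gcongr
    have h1 : |z.re| ≤ |s.re| + 1 := by
      have := (Complex.abs_re_le_norm (z - s)).trans (mem_ball_iff_norm.1 hz).le
      rw [Complex.sub_re] at this
      have h2 := abs_add_le (z.re - s.re) s.re
      rw [sub_add_cancel] at h2
      linarith
    calc (z * u).re ≤ |(z * u).re| := le_abs_self _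
      _ = |z.re| * |u| := by simp [abs_mul]
      _ ≤ _ := by gcongr
  · refine Continuous.integrable_of_hasCompactSupport (by fun_prop) ?_
    exact (hc.comp_left abs_zero).mul_right
  · refine ae_of_all _ fun u z _ => ?_
    have h1 : HasDerivAt (fun z : ℂ => z * u) u z := by simpa using (hasDerivAt_id z).mul_const (u : ℂ)
    have := (h1.cexp).const_mul (g u : ℂ)
    refine this.congr_deriv ?_
    ring

section
open FourierTransform

theorem compactSupport_mul_exp_schwartz {g : ℝ → ℝ} (hg : ContDiff ℝ ((⊤ : ℕ∞) : WithTop ℕ∞) g)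
    (hc : HasCompactSupport g) (b : ℝ) :
    ∃ φ : SchwartzMap ℝ ℂ, ∀ u, φ u = (g u : ℂ) * Complex.exp (b * u) := by
  have hcc : HasCompactSupport fun u => (g u : ℂ) * Complex.exp (b * u) :=
    (hc.comp_left (g := fun x : ℝ => (x : ℂ)) Complex.ofReal_zero).mul_right
  have h1 : ContDiff ℝ ((⊤ : ℕ∞) : WithTop ℕ∞) fun u => (g u : ℂ) := Complex.ofRealCLM.contDiff.comp hg
  have h2 : ContDiff ℝ ((⊤ : ℕ∞) : WithTop ℕ∞) fun u : ℝ => Complex.exp (b * u) := by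
    have : ContDiff ℝ ((⊤ : ℕ∞) : WithTop ℕ∞) fun u : ℝ => (u : ℂ) := Complex.ofRealCLM.contDiff
    exact (contDiff_const.mul this).cexp
  exact ⟨hcc.toSchwartzMap (h1.mul h2), fun u => rfl⟩

theorem fourierInv_mul_exp {g : ℝ → ℝ} {b : ℝ} {φ : SchwartzMap ℝ ℂ}
    (hφ : ∀ u, φ u = (g u : ℂ) * Complex.exp (b * u)) (ξ : ℝ) :
    (𝓕⁻ φ) ξ = ∫ u : ℝ, (g u : ℂ) * Complex.exp ((b + (2 * Real.pi * ξ : ℝ) * Complex.I) * u) := by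
  rw [SchwartzMap.fourierInv_coe, Real.fourierInv_eq']
  refine integral_congr_ae (ae_of_all _ fun u => ?_)
  simp only [hφ, smul_eq_mul]
  rw [mul_comm, mul_assoc, ← Complex.exp_add]
  congr 2
  simp
  ring


theorem integrable_schwartz_mul_of_bounded {ψ : SchwartzMap ℝ ℂ} {h : ℝ → ℂ}
    (hc : Continuous h) {C : ℝ} (hC : ∀ x, ‖h x‖ ≤ C) :
    Integrable fun x => ψ x * h x := by
  exact (ψ.integrable (μ := volume)).mul_bdd hc.aestronglyMeasurable (ae_of_all _ hC)

theorem integral_fourierInv_mul_fourier {φ : SchwartzMap ℝ ℂ} {w : ℝ → ℂ} (hw : Integrable w) :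
    ∫ ξ, (𝓕⁻ φ) ξ * 𝓕 w ξ = ∫ u, φ u * w u := by
  have h := VectorFourier.integral_fourierIntegral_smul_eq_flip (μ := volume) (ν := volume) (L := innerₗ ℝ)
    (e := Real.fourierChar) (f := w) (g := fun ξ => (𝓕⁻ φ) ξ) Real.continuous_fourierChar
    (by exact continuous_inner) hw (SchwartzMap.integrable _)
  have e1 : ∀ u, VectorFourier.fourierIntegral Real.fourierChar volume (innerₗ ℝ).flip (fun ξ => (𝓕⁻ φ) ξ) u = φ u := by
    intro u
    have : 𝓕 (𝓕⁻ φ) = φ := by simp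
    conv_rhs => rw [← this]
    rw [SchwartzMap.fourier_coe]
    simp
    rfl
  simp only [smul_eq_mul] at h
  simp_rw [e1] at h
  calc _ = ∫ ξ, 𝓕 w ξ * (𝓕⁻ φ) ξ := by simp_rw [mul_comm]
    _ = ∫ u, w u * φ u := h
    _ = _ := by simp_rw [mul_comm]


theorem norm_sq_L2_eq (f : Lp ℂ 2 (volume : Measure ℝ)) : ‖f‖ ^ 2 = ∫ x, ‖f x‖ ^ 2 := by
  have h : (inner ℂ f f : ℂ) = ((‖f‖ ^ 2 : ℝ) : ℂ) := by
    rw [inner_self_eq_norm_sq_to_K]; simp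
  rw [L2.inner_def] at h
  have h2 : ∀ x, (inner ℂ (f x) (f x) : ℂ) = ((‖f x‖ ^ 2 : ℝ) : ℂ) := by
    intro x
    rw [inner_self_eq_norm_sq_to_K]; simp
  simp_rw [h2] at h
  rw [integral_complex_ofReal] at h
  exact_mod_cast h.symm

theorem norm_laplace_le {g : ℝ → ℝ} (hg : Continuous g) (hc : HasCompactSupport g) :
    ∃ C, 0 ≤ C ∧ ∀ s : ℂ, |s.re| ≤ 1 → ‖∫ u : ℝ, (g u : ℂ) * Complex.exp (s * u)‖ ≤ C := by
  refine ⟨∫ u, |g u| * Real.exp |u|, integral_nonneg fun u => by positivity, fun s hs => ?_⟩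
  refine norm_integral_le_of_norm_le ?_ (ae_of_all _ fun u => ?_)
  · exact Continuous.integrable_of_hasCompactSupport (by fun_prop)
      (hc.comp_left abs_zero).mul_right
  · rw [norm_mul, Complex.norm_exp, Complex.norm_real, Real.norm_eq_abs]
    gcongr
    calc (s * u).re ≤ |(s * u).re| := le_abs_self _
      _ = |s.re| * |u| := by simp [abs_mul]
      _ ≤ 1 * |u| := by gcongr
      _ = |u| := one_mul _

theorem plancherel_shift {W : ℝ → ℂ} {H : ℂ → ℂ} {a C : ℝ} (ha : 0 < a) (ha1 : a < 1)
    (hW : Integrable fun u => W u * Complex.exp (-u))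
    (hH : ∀ s : ℂ, 0 < s.re → DifferentiableAt ℂ H s)
    (hH1 : ∀ t : ℝ, H (1 + t * Complex.I) = ∫ u, W u * Complex.exp (-(1 + t * Complex.I) * u))
    (hb : ∀ σ t : ℝ, a ≤ σ → σ ≤ 1 → ‖H (σ + t * Complex.I)‖ ≤ C * (1 + |t|) ^ (-(3 / 4) : ℝ)) :
    Integrable (fun u => ‖W u‖ ^ 2 * Real.exp (-(2 * a * u))) ∧
      ∫ u, ‖W u‖ ^ 2 * Real.exp (-(2 * a * u)) =
        (2 * Real.pi)⁻¹ * ∫ t : ℝ, ‖H (a + t * Complex.I)‖ ^ 2 := by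
  have hpi : (0 : ℝ) < 2 * Real.pi := by positivity
  have hC : 0 ≤ C := by
    have := (norm_nonneg _).trans (hb 1 0 ha1.le le_rfl)
    simpa using this
  have hbC : ∀ σ t : ℝ, a ≤ σ → σ ≤ 1 → ‖H (σ + t * Complex.I)‖ ≤ C := fun σ t h1 h2 => by
    refine (hb σ t h1 h2).trans (mul_le_of_le_one_right hC ?_)
    exact Real.rpow_le_one_of_one_le_of_nonpos (by linarith [abs_nonneg t]) (by norm_num)
  have hcont : ∀ σ : ℝ, a ≤ σ → Continuous fun t : ℝ => H (σ + t * Complex.I) := by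
    intro σ hσ
    refine continuous_iff_continuousAt.2 fun t => ?_
    refine ContinuousAt.comp (f := fun t : ℝ => (σ + t * Complex.I : ℂ)) (hH _ ?_).continuousAt (by fun_prop)
    simpa using ha.trans_le hσ
  have hscale : Continuous fun ξ : ℝ => 2 * Real.pi * ξ := by fun_prop
  set h : ℝ → ℂ := fun ξ => H (a + (2 * Real.pi * ξ : ℝ) * Complex.I) with hh
  have hhc : Continuous h := (hcont a le_rfl).comp hscale
  have hhL : MemLp h 2 volume := by
    rw [memLp_two_iff_integrable_sq_norm hhc.aestronglyMeasurable]
    have i1 : Integrable fun t : ℝ => ‖H (a + t * Complex.I)‖ ^ 2 := by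
      have := (integrable_one_add_norm (E := ℝ) (μ := volume) (r := 3 / 2) (by norm_num)).const_mul (C ^ 2)
      refine this.mono' ((hcont a le_rfl).norm.pow 2).aestronglyMeasurable (ae_of_all _ fun t => ?_)
      rw [Real.norm_of_nonneg (by positivity)]
      calc ‖H (a + t * Complex.I)‖ ^ 2 ≤ (C * (1 + |t|) ^ (-(3 / 4) : ℝ)) ^ 2 := by
            gcongr; exact hb a t le_rfl ha1.le
        _ = C ^ 2 * (1 + ‖t‖) ^ (-(3 / 2) : ℝ) := by
            rw [mul_pow, ← Real.rpow_natCast ((1 + |t|) ^ (-(3 / 4) : ℝ)), ← Real.rpow_mul (by positivity)]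
            norm_num
    exact (integrable_comp_mul_left_iff (fun t : ℝ => ‖H (a + t * Complex.I)‖ ^ 2) hpi.ne').2 i1
  set hL : Lp ℂ 2 (volume : Measure ℝ) := hhL.toLp h
  set f : Lp ℂ 2 (volume : Measure ℝ) := 𝓕⁻ hL with hf
  have hFf : 𝓕 f = hL := FourierTransform.fourier_fourierInv_eq hL
  have hw1 : Integrable fun u => W u * Complex.exp (-u) := hW
  have hkey : ∀ᵐ u, f u = W u * Complex.exp (-a * u) := by
    refine ae_eq_of_integral_contDiff_smul_eq ((Lp.memLp f).locallyIntegrable (by norm_num)) ?_ ?_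
    · have e : (fun u : ℝ => W u * Complex.exp (-a * u)) =
          fun u : ℝ => Complex.exp ((1 - a) * u) * (W u * Complex.exp (-u)) := by
        funext u
        rw [mul_left_comm, ← Complex.exp_add]
        congr 2; ring
      rw [e]
      exact hW.locallyIntegrable.continuous_smul (g := fun u : ℝ => Complex.exp ((1 - a) * u))
        (by fun_prop)
    · intro g hg hgc
      obtain ⟨φ, hφ⟩ := compactSupport_mul_exp_schwartz hg hgc 0
      obtain ⟨φ1, hφ1⟩ := compactSupport_mul_exp_schwartz hg hgc (1 - a)
      obtain ⟨CΦ, hCΦ, hΦ⟩ := norm_laplace_le hg.continuous hgc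
      have hΦd := differentiable_laplace_of_compactSupport hg.continuous hgc
      set Φ : ℂ → ℂ := fun s => ∫ u : ℝ, (g u : ℂ) * Complex.exp (s * u) with hΦdef
      have eφ : ∀ ξ, (𝓕⁻ φ) ξ = Φ ((2 * Real.pi * ξ : ℝ) * Complex.I) := by
        intro ξ
        rw [fourierInv_mul_exp hφ]
        simp [hΦdef]
      have eφ1 : ∀ ξ, (𝓕⁻ φ1) ξ = Φ (1 - a + (2 * Real.pi * ξ : ℝ) * Complex.I) := by
        intro ξ
        rw [fourierInv_mul_exp hφ1]
        simp [hΦdef]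
      have step1 : ∫ u, g u • f u = ∫ ξ, (𝓕⁻ φ) ξ * h ξ := by
        have q1 : inner ℂ (φ.toLp 2) f = ∫ u, g u • f u := by
          rw [L2.inner_def]
          refine integral_congr_ae ?_
          filter_upwards [SchwartzMap.coeFn_toLp φ 2] with u hu
          rw [hu, hφ]
          simp [mul_comm]
        rw [← q1, ← Lp.inner_fourier_eq, hFf, SchwartzMap.toLp_fourier_eq, L2.inner_def]
        refine integral_congr_ae ?_
        filter_upwards [SchwartzMap.coeFn_toLp (𝓕 φ) 2, hhL.coeFn_toLp] with ξ h1 h2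
        rw [h1, h2]
        have q2 : starRingEnd ℂ ((𝓕 φ) ξ) = (𝓕⁻ φ) ξ := by
          rw [SchwartzMap.fourier_coe, SchwartzMap.fourierInv_coe, Real.fourierInv_eq', Real.fourier_real_eq_integral_exp_smul, ← integral_conj]
          refine integral_congr_ae (ae_of_all _ fun u => ?_)
          simp only [hφ, smul_eq_mul, map_mul, Complex.conj_ofReal, ← Complex.exp_conj]
          simp
          left
          congr 1; ring
        rw [← q2]
        simp [mul_comm]
      have F1 : ∀ t : ℝ, Φ ((a + t * Complex.I) - a) = Φ (t * Complex.I) := fun t => by congr 1; ring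
      have step2 : ∫ ξ, (𝓕⁻ φ) ξ * h ξ = ∫ ξ, (𝓕⁻ φ1) ξ * H (1 + (2 * Real.pi * ξ : ℝ) * Complex.I) := by
        have c1 := Measure.integral_comp_mul_left (fun t : ℝ => Φ ((a + t * Complex.I) - a) * H (a + t * Complex.I)) (2 * Real.pi)
        have c2 := Measure.integral_comp_mul_left (fun t : ℝ => Φ (((1 : ℝ) + t * Complex.I) - a) * H ((1 : ℝ) + t * Complex.I)) (2 * Real.pi)
        have e1 : ∀ ξ : ℝ, (𝓕⁻ φ) ξ * h ξ = Φ ((a + (2 * Real.pi * ξ : ℝ) * Complex.I) - a) * H (a + (2 * Real.pi * ξ : ℝ) * Complex.I) := by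
          intro ξ
          rw [eφ, F1]
        have e2 : ∀ ξ : ℝ, (𝓕⁻ φ1) ξ * H (1 + (2 * Real.pi * ξ : ℝ) * Complex.I) =
            Φ (((1 : ℝ) + (2 * Real.pi * ξ : ℝ) * Complex.I) - a) * H ((1 : ℝ) + (2 * Real.pi * ξ : ℝ) * Complex.I) := by
          intro ξ
          rw [eφ1]
          congr 2
          push_cast; ring
        simp_rw [e1, e2, c1, c2]
        congr 1
        refine integral_vertical_line_eq (f := fun s => Φ (s - a) * H s) ha1.le (fun s hs _ => ?_) ?_ ?_
          (g := fun t => CΦ * (C * (1 + t) ^ (-(3 / 4) : ℝ))) ?_ ?_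
        · exact (hΦd.differentiableAt.comp s (f := fun s => s - (a : ℂ)) (by fun_prop)).mul (hH s (ha.trans_le hs))
        · rw [← integrable_comp_mul_left_iff _ hpi.ne']
          simp_rw [← e1]
          exact integrable_schwartz_mul_of_bounded hhc (fun ξ => hbC _ _ le_rfl ha1.le)
        · rw [← integrable_comp_mul_left_iff _ hpi.ne']
          simp_rw [← e2]
          refine integrable_schwartz_mul_of_bounded (C := C) ?_ (fun ξ => ?_)
          · have := (hcont 1 ha1.le).comp hscale
            simpa [Function.comp_def] using this
          · simpa using hbC 1 (2 * Real.pi * ξ) ha1.le le_rfl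
        · have : Tendsto (fun t : ℝ => (1 + t) ^ (-(3 / 4) : ℝ)) atTop (𝓝 0) :=
            (tendsto_rpow_neg_atTop (by norm_num)).comp (tendsto_atTop_add_const_left _ _ tendsto_id)
          simpa using (this.const_mul C).const_mul CΦ
        · intro σ t h1 h2
          rw [norm_mul]
          refine mul_le_mul (hΦ _ ?_) (hb σ t h1 h2) (norm_nonneg _) hCΦ
          simp
          rw [abs_le]; constructor <;> linarith
      have step3 : ∫ ξ, (𝓕⁻ φ1) ξ * H (1 + (2 * Real.pi * ξ : ℝ) * Complex.I) =
          ∫ u, φ1 u * (W u * Complex.exp (-u)) := by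
        rw [← integral_fourierInv_mul_fourier hW]
        refine integral_congr_ae (ae_of_all _ fun ξ => ?_)
        simp only
        rw [hH1, Real.fourier_real_eq_integral_exp_smul]
        congr 1
        refine integral_congr_ae (ae_of_all _ fun u => ?_)
        simp only [smul_eq_mul]
        rw [mul_left_comm, ← Complex.exp_add]
        congr 2
        push_cast; ring
      rw [step1, step2, step3]
      refine integral_congr_ae (ae_of_all _ fun u => ?_)
      simp only [hφ1, Complex.real_smul]
      rw [mul_assoc, mul_left_comm (Complex.exp _), ← Complex.exp_add]
      congr 3
      push_cast; ring
  have hsq : ∀ u : ℝ, ‖W u * Complex.exp (-a * u)‖ ^ 2 = ‖W u‖ ^ 2 * Real.exp (-(2 * a * u)) := by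
    intro u
    rw [norm_mul, Complex.norm_exp, mul_pow, ← Real.exp_nat_mul]
    congr 2
    simp; ring
  have hae : (fun u => ‖f u‖ ^ 2) =ᵐ[volume] fun u => ‖W u‖ ^ 2 * Real.exp (-(2 * a * u)) := by
    filter_upwards [hkey] with u hu
    rw [hu, hsq]
  refine ⟨?_, ?_⟩
  · exact ((memLp_two_iff_integrable_sq_norm (Lp.memLp f).1).1 (Lp.memLp f)).congr hae
  · rw [← integral_congr_ae hae, ← norm_sq_L2_eq, ← Lp.norm_fourier_eq, hFf, norm_sq_L2_eq]
    have : ∫ x, ‖hL x‖ ^ 2 = ∫ ξ, ‖h ξ‖ ^ 2 := by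
      refine integral_congr_ae ?_
      filter_upwards [hhL.coeFn_toLp] with ξ h2
      rw [h2]
    rw [this]
    have := Measure.integral_comp_mul_left (fun t : ℝ => ‖H (a + t * Complex.I)‖ ^ 2) (2 * Real.pi)
    rw [abs_of_pos (by positivity), smul_eq_mul] at this
    exact this

end

/-! ### Local bounds for logarithmic derivatives -/

theorem norm_logDeriv_le_of_ne_zero {h : ℂ → ℂ} {c : ℂ} {r₁ r₂ K : ℝ} (hr₂ : 0 < r₂) (hr : r₂ < r₁)
    (hK : 0 < K) (hd : DifferentiableOn ℂ h (Metric.ball c r₁)) (h0 : ∀ z ∈ Metric.ball c r₁, h z ≠ 0)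
    (hb : ∀ z ∈ Metric.ball c r₁, ‖h z‖ ≤ Real.exp K * ‖h c‖) {s : ℂ} (hs : s ∈ Metric.closedBall c r₂) :
    ‖logDeriv h s‖ ≤ 8 * r₁ / (r₁ - r₂) ^ 2 * K := by
  have hr₁ : 0 < r₁ := hr₂.trans hr
  have hcm : c ∈ Metric.ball c r₁ := Metric.mem_ball_self hr₁
  have hld : DifferentiableOn ℂ (logDeriv h) (Metric.ball c r₁) := by
    intro z hz
    have := hd.deriv Metric.isOpen_ball
    exact ((this z hz).div (hd z hz) (h0 z hz))
  obtain ⟨φ, hφc, hφ⟩ := hld.isExactOn_ball.with_val_at c 0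
  have hφd : DifferentiableOn ℂ φ (Metric.ball c r₁) := fun z hz =>
    (hφ z hz).differentiableAt.differentiableWithinAt
  have hconst : ∀ z ∈ Metric.ball c r₁, h z = h c * Complex.exp (φ z) := by
    intro z hz
    have e := Metric.isOpen_ball.is_const_of_deriv_eq_zero (f := fun z => h z * Complex.exp (-φ z))
      (s := Metric.ball c r₁) Metric.isPreconnected_ball (hd.mul hφd.neg.cexp) (fun w hw => by
        have d1 : HasDerivAt h (deriv h w) w := (hd.differentiableAt (Metric.isOpen_ball.mem_nhds hw)).hasDerivAt
        have := (d1.mul (hφ w hw).neg.cexp).deriv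
        refine Eq.trans this ?_
        simp only [Pi.neg_apply, logDeriv_apply, Pi.zero_apply]
        field_simp [h0 w hw]
        ring) hz hcm
    simp only [hφc, neg_zero, Complex.exp_zero, mul_one] at e
    rw [← e, mul_assoc, ← Complex.exp_add]
    simp
  have hre : ∀ z ∈ Metric.ball c r₁, (φ z).re ≤ K := by
    intro z hz
    have h1 := hb z hz
    rw [hconst z hz, norm_mul, Complex.norm_exp, mul_comm] at h1
    exact Real.exp_le_exp.1 (le_of_mul_le_mul_right h1 (norm_pos_iff.2 (h0 c hcm)))
  have hbc : ∀ z, ‖z - c‖ < r₁ → ‖φ z‖ ≤ 2 * K * ‖z - c‖ / (r₁ - ‖z - c‖) := by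
    intro z hz
    have mt : Set.MapsTo (fun w => c + w) (Metric.ball 0 r₁) (Metric.ball c r₁) := by
      intro w hw
      simpa [mem_ball_iff_norm] using hw
    have := Complex.borelCaratheodory_zero (f := fun w => φ (c + w)) (z := z - c) hK
      (hφd.comp (by fun_prop) mt) (fun w hw => hre _ (mt hw)) hr₁ (by simpa using hz) (by simpa using hφc)
    simpa using this
  have hs' : ‖s - c‖ ≤ r₂ := mem_closedBall_iff_norm.1 hs
  set δ := (r₁ - r₂) / 2 with hδ
  have hδ0 : 0 < δ := by rw [hδ]; linarith
  have hsb : s ∈ Metric.ball c r₁ := by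
    rw [mem_ball_iff_norm]; linarith
  have hsub : Metric.closedBall s δ ⊆ Metric.ball c r₁ := by
    intro z hz
    rw [mem_closedBall_iff_norm] at hz
    rw [mem_ball_iff_norm]
    have := norm_add_le (z - s) (s - c)
    rw [sub_add_sub_cancel] at this
    linarith
  have hfin := Complex.norm_deriv_le_of_forall_mem_sphere_norm_le (f := φ) (c := s) (C := 2 * K * r₁ / δ) hδ0
    (DifferentiableOn.diffContOnCl ((hφd.mono hsub).mono (Metric.closure_ball_subset_closedBall)))
    (fun z hz => by
      have hz' : ‖z - s‖ = δ := by simpa [mem_sphere_iff_norm] using hz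
      have := norm_add_le (z - s) (s - c)
      rw [sub_add_sub_cancel] at this
      have h3 : ‖z - c‖ ≤ r₁ - δ := by linarith
      refine (hbc z (by linarith)).trans ?_
      have : δ ≤ r₁ - ‖z - c‖ := by linarith
      gcongr
      linarith)
  rw [(hφ s hsb).deriv] at hfin
  refine hfin.trans (le_of_eq ?_)
  rw [hδ]
  have : r₁ - r₂ ≠ 0 := by linarith
  field_simp
  ring

theorem norm_blaschke_on_sphere {R : ℝ} {w z : ℂ} (hz : ‖z‖ = R) :
    ‖(R : ℂ) ^ 2 - starRingEnd ℂ w * z‖ = R * ‖z - w‖ := by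
  have : (R : ℂ) ^ 2 - starRingEnd ℂ w * z = z * starRingEnd ℂ (z - w) := by
    rw [map_sub, mul_sub, Complex.mul_conj, Complex.normSq_eq_norm_sq, hz]
    push_cast; ring
  rw [this, norm_mul, hz, RCLike.norm_conj]

theorem norm_blaschke_ge {R r₁ r : ℝ} (h0 : 0 ≤ r₁) {w z : ℂ} (hw : ‖w‖ ≤ r₁) (hz : ‖z‖ ≤ r) :
    R ^ 2 - r₁ * r ≤ ‖(R : ℂ) ^ 2 - starRingEnd ℂ w * z‖ := by
  have h1 := norm_sub_norm_le ((R : ℂ) ^ 2) (starRingEnd ℂ w * z)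
  rw [norm_mul, RCLike.norm_conj, norm_pow, Complex.norm_real, Real.norm_eq_abs, sq_abs] at h1
  have : ‖w‖ * ‖z‖ ≤ r₁ * r := mul_le_mul hw hz (norm_nonneg _) h0
  linarith

theorem zeros_and_logDeriv_bound {f g : ℂ → ℂ} {c : ℂ} {r₂ r₁ R K : ℝ} (hr₂ : 0 < r₂) (hr : r₂ < r₁)
    (hR : r₁ < R) (hK : 0 < K) {Z : Finset ℂ} {m : ℂ → ℕ} (hZ : ∀ ρ ∈ Z, ‖ρ - c‖ ≤ r₁)
    (hg : AnalyticOnNhd ℂ g (Metric.closedBall c R)) (hg0 : ∀ z ∈ Metric.closedBall c r₁, g z ≠ 0)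
    (hfg : ∀ z ∈ Metric.closedBall c R, f z = (∏ ρ ∈ Z, (z - ρ) ^ m ρ) * g z)
    (hb : ∀ z ∈ Metric.sphere c R, ‖f z‖ ≤ Real.exp K * ‖f c‖) :
    (∑ ρ ∈ Z, (m ρ : ℝ)) * Real.log (R / r₁) ≤ K ∧ ∀ s ∈ Metric.closedBall c r₂,
      ‖logDeriv g s‖ ≤ (8 * r₁ / (r₁ - r₂) ^ 2 + r₁ / (R ^ 2 - r₁ * r₁) / Real.log (R / r₁)) * K := by
  have hr₁ : 0 < r₁ := hr₂.trans hr
  have hR0 : 0 < R := hr₁.trans hR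
  have hRr : 0 < R ^ 2 - r₁ * r₁ := by nlinarith
  have hRr' : 0 < R ^ 2 - r₁ * R := by nlinarith
  have hlog : 0 < Real.log (R / r₁) := Real.log_pos (by rwa [one_lt_div hr₁])
  set b : ℂ → ℂ → ℂ := fun ρ z => ((R : ℂ) ^ 2 - starRingEnd ℂ (ρ - c) * (z - c)) / R with hbdef
  set B : ℂ → ℂ := fun z => ∏ ρ ∈ Z, b ρ z ^ m ρ with hB
  have hbd : ∀ ρ, Differentiable ℂ (b ρ) := fun ρ => by simp only [hbdef]; fun_prop
  have hBd : Differentiable ℂ B := by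
    refine Differentiable.fun_finsetProd fun ρ _ => (hbd ρ).pow _
  have hb0 : ∀ ρ ∈ Z, ∀ z ∈ Metric.closedBall c R, b ρ z ≠ 0 := by
    intro ρ hρ z hz
    have h1 := norm_blaschke_ge (R := R) hr₁.le (hZ ρ hρ) (mem_closedBall_iff_norm.1 hz)
    simp only [hbdef]
    refine div_ne_zero ?_ (by exact_mod_cast hR0.ne')
    exact norm_pos_iff.1 (hRr'.trans_le h1)
  have hB0 : ∀ z ∈ Metric.closedBall c R, B z ≠ 0 := fun z hz =>
    Finset.prod_ne_zero_iff.2 fun ρ hρ => pow_ne_zero _ (hb0 ρ hρ z hz)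
  have hcc : c ∈ Metric.closedBall c R := Metric.mem_closedBall_self hR0.le
  set h : ℂ → ℂ := fun z => g z * B z with hh
  have hgd : DifferentiableOn ℂ g (Metric.closedBall c R) := hg.differentiableOn
  have hhd : DifferentiableOn ℂ h (Metric.closedBall c R) := hgd.mul hBd.differentiableOn
  have hsphere : ∀ z ∈ Metric.sphere c R, ‖h z‖ ≤ Real.exp K * ‖f c‖ := by
    intro z hz
    have hzR : ‖z - c‖ = R := mem_sphere_iff_norm.1 hz
    refine le_trans (le_of_eq ?_) (hb z hz)
    rw [hfg z (Metric.sphere_subset_closedBall hz), norm_mul, norm_mul, mul_comm, hB, norm_prod, norm_prod]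
    congr 1
    refine Finset.prod_congr rfl fun ρ _ => ?_
    rw [norm_pow, norm_pow, hbdef]
    simp only
    rw [norm_div, norm_blaschke_on_sphere hzR, Complex.norm_real, Real.norm_of_nonneg hR0.le, sub_sub_sub_cancel_right]
    field_simp
  have hmax : ∀ z ∈ Metric.closedBall c R, ‖h z‖ ≤ Real.exp K * ‖f c‖ := by
    intro z hz
    refine Complex.norm_le_of_forall_mem_frontier_norm_le (U := Metric.ball c R) Metric.isBounded_ball
      (hhd.mono Metric.closure_ball_subset_closedBall).diffContOnCl ?_ (by rwa [closure_ball c hR0.ne'])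
    rw [frontier_ball c hR0.ne']
    exact hsphere
  set N : ℕ := ∑ ρ ∈ Z, m ρ with hN
  have hBc : B c = (R : ℂ) ^ N := by
    simp only [hB, hbdef, sub_self, mul_zero, sub_zero]
    rw [Finset.prod_pow_eq_pow_sum]
    congr 1
    field_simp
  have hfc1 : ‖f c‖ ≤ r₁ ^ N * ‖g c‖ := by
    rw [hfg c hcc, norm_mul, norm_prod, hN, ← Finset.prod_pow_eq_pow_sum]
    gcongr with ρ hρ
    rw [norm_pow]
    gcongr
    rw [norm_sub_rev]
    exact hZ ρ hρ
  have hhc : ‖h c‖ = R ^ N * ‖g c‖ := by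
    rw [hh]; simp only
    rw [hBc, norm_mul, norm_pow, Complex.norm_real, Real.norm_of_nonneg hR0.le, mul_comm]
  have hgc : 0 < ‖g c‖ := norm_pos_iff.2 (hg0 c (Metric.mem_closedBall_self hr₁.le))
  have hcount : (∑ ρ ∈ Z, (m ρ : ℝ)) * Real.log (R / r₁) ≤ K := by
    have h1 : R ^ N * ‖g c‖ ≤ Real.exp K * (r₁ ^ N * ‖g c‖) := by
      rw [← hhc]
      exact (hmax c hcc).trans (by gcongr)
    have h2 : (R / r₁) ^ N ≤ Real.exp K := by
      rw [div_pow, div_le_iff₀ (by positivity)]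
      rw [← mul_assoc] at h1
      exact le_of_mul_le_mul_right h1 hgc
    have h3 := Real.log_le_log (by positivity) h2
    rw [Real.log_pow, Real.log_exp, hN] at h3
    simpa using h3
  refine ⟨hcount, fun s hs => ?_⟩
  have hsub : Metric.ball c r₁ ⊆ Metric.closedBall c R :=
    Metric.ball_subset_closedBall.trans (Metric.closedBall_subset_closedBall hR.le)
  have hfh : ‖f c‖ ≤ ‖h c‖ := by
    rw [hhc]
    exact hfc1.trans (by gcongr)
  have main := norm_logDeriv_le_of_ne_zero hr₂ hr hK (hhd.mono hsub)
    (fun z hz => mul_ne_zero (hg0 z (Metric.ball_subset_closedBall hz)) (hB0 z (hsub hz)))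
    (fun z hz => (hmax z (hsub hz)).trans (by gcongr)) hs
  have hs1 : s ∈ Metric.closedBall c r₁ := Metric.closedBall_subset_closedBall hr.le hs
  have hsR : s ∈ Metric.closedBall c R := Metric.closedBall_subset_closedBall hR.le hs1
  have hlogh : logDeriv h s = logDeriv g s + logDeriv B s :=
    logDeriv_mul s (hg0 s hs1) (hB0 s hsR) (hg s hsR).differentiableAt hBd.differentiableAt
  have hlogB : ‖logDeriv B s‖ ≤ (∑ ρ ∈ Z, (m ρ : ℝ)) * (r₁ / (R ^ 2 - r₁ * r₁)) := by
    rw [hB, logDeriv_prod (f := fun ρ z => b ρ z ^ m ρ) (fun ρ hρ => pow_ne_zero _ (hb0 ρ hρ s hsR)) (fun ρ _ => ((hbd ρ).pow _).differentiableAt),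
      Finset.sum_mul]
    refine norm_sum_le_of_le _ fun ρ hρ => ?_
    rw [logDeriv_fun_pow (hbd ρ).differentiableAt, norm_mul, Complex.norm_natCast]
    gcongr
    have hd : deriv (b ρ) s = -starRingEnd ℂ (ρ - c) / R := by
      simp only [hbdef]
      have : HasDerivAt (fun z : ℂ => ((R : ℂ) ^ 2 - starRingEnd ℂ (ρ - c) * (z - c)) / R)
          ((0 - starRingEnd ℂ (ρ - c) * 1) / R) s :=
        ((hasDerivAt_const _ _).sub (((hasDerivAt_id s).sub_const c).const_mul _)).div_const _
      rw [this.deriv]; ring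
    rw [logDeriv_apply, hd, hbdef]
    simp only
    rw [div_div_div_cancel_right₀ (by exact_mod_cast hR0.ne'), norm_div, norm_neg, RCLike.norm_conj]
    have := norm_blaschke_ge (R := R) hr₁.le (hZ ρ hρ) (mem_closedBall_iff_norm.1 hs1)
    have := hZ ρ hρ
    gcongr
  have e : logDeriv g s = logDeriv h s - logDeriv B s := by rw [hlogh]; ring
  rw [e]
  refine (norm_sub_le _ _).trans ?_
  rw [add_mul]
  refine add_le_add main (hlogB.trans ?_)
  rw [div_mul_eq_mul_div, le_div_iff₀ hlog]
  calc _ = r₁ / (R ^ 2 - r₁ * r₁) * ((∑ ρ ∈ Z, (m ρ : ℝ)) * Real.log (R / r₁)) := by ring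
    _ ≤ _ := by gcongr

theorem exists_extract_zeros {f : ℂ → ℂ} {U : Set ℂ} (hU : IsOpen U) (hf : AnalyticOnNhd ℂ f U)
    (Z : Finset ℂ) (hZ : ∀ ρ ∈ Z, ρ ∈ U) (ho : ∀ ρ ∈ U, analyticOrderAt f ρ ≠ ⊤) :
    ∃ g : ℂ → ℂ, AnalyticOnNhd ℂ g U ∧
      (∀ z ∈ U, f z = (∏ ρ ∈ Z, (z - ρ) ^ analyticOrderNatAt f ρ) * g z) ∧
      ∀ z ∈ U, z ∈ Z ∨ f z ≠ 0 → g z ≠ 0 := by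
  induction Z using Finset.induction_on with
  | empty => exact ⟨f, hf, by simp, by simp⟩
  | insert ρ Z hρ ih =>
    obtain ⟨g, hg, hfg, hg0⟩ := ih fun w hw => hZ w (Finset.mem_insert_of_mem hw)
    have hρU : ρ ∈ U := hZ ρ (Finset.mem_insert_self _ _)
    set n := analyticOrderNatAt f ρ with hn
    have hPan : AnalyticAt ℂ (fun z => ∏ w ∈ Z, (z - w) ^ analyticOrderNatAt f w) ρ :=
      Finset.analyticAt_fun_prod _ fun w _ => by fun_prop
    have hP0 : (fun z => ∏ w ∈ Z, (z - w) ^ analyticOrderNatAt f w) ρ ≠ 0 :=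
      Finset.prod_ne_zero_iff.2 fun w hw => pow_ne_zero _ (sub_ne_zero.2 fun h => hρ (h ▸ hw))
    have hord : analyticOrderAt f ρ = analyticOrderAt g ρ := by
      have e : f =ᶠ[𝓝 ρ] (fun z => ∏ w ∈ Z, (z - w) ^ analyticOrderNatAt f w) * g := by
        filter_upwards [hU.mem_nhds hρU] with z hz using hfg z hz
      rw [analyticOrderAt_congr e, analyticOrderAt_mul hPan (hg ρ hρU),
        hPan.analyticOrderAt_eq_zero.2 hP0, zero_add]
    have hgn : analyticOrderAt g ρ = (n : ℕ∞) := by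
      rw [← hord, hn, Nat.cast_analyticOrderNatAt (ho ρ hρU)]
    obtain ⟨k, hk, hk0, hgk⟩ := (hg ρ hρU).analyticOrderAt_eq_natCast.1 hgn
    refine ⟨fun z => if z = ρ then k ρ else g z / (z - ρ) ^ n, fun z hz => ?_, fun z hz => ?_, fun z hz h => ?_⟩
    · by_cases h : z = ρ
      · subst h
        refine hk.congr ?_
        filter_upwards [hgk] with w hw
        split_ifs with h1
        · rw [h1]
        · rw [hw, smul_eq_mul, mul_div_cancel_left₀ _ (pow_ne_zero _ (sub_ne_zero.2 h1))]
      · have : AnalyticAt ℂ (fun z => g z / (z - ρ) ^ n) z :=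
          (hg z hz).div (by fun_prop) (pow_ne_zero _ (sub_ne_zero.2 h))
        refine this.congr ?_
        filter_upwards [isOpen_ne.mem_nhds h] with w hw
        rw [if_neg hw]
    · rw [Finset.prod_insert hρ, hfg z hz]
      beta_reduce
      split_ifs with h1
      · subst h1
        have := hgk.self_of_nhds
        rw [this, smul_eq_mul]; ring
      · have : (z - ρ) ^ n ≠ 0 := pow_ne_zero _ (sub_ne_zero.2 h1)
        field_simp
        rw [hn]
    · beta_reduce
      split_ifs with h1
      · exact hk0
      · refine div_ne_zero (hg0 z hz ?_) (pow_ne_zero _ (sub_ne_zero.2 h1))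
        rcases h with h | h
        · exact Or.inl (Finset.mem_of_mem_insert_of_ne h h1)
        · exact Or.inr h

theorem finite_zeros_of_isCompact {f : ℂ → ℂ} {U K : Set ℂ} (hUc : IsPreconnected U)
    (hf : AnalyticOnNhd ℂ f U) {z₀ : ℂ} (hz₀ : z₀ ∈ U) (h0 : f z₀ ≠ 0) (hK : IsCompact K) (hKU : K ⊆ U) :
    {z ∈ K | f z = 0}.Finite := by
  by_contra hinf
  obtain ⟨x, hx, hacc⟩ := Set.Infinite.exists_accPt_of_subset_isCompact hinf hK fun z hz => hz.1
  have := hf.eqOn_zero_of_preconnected_of_frequently_eq_zero hUc (hKU hx)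
    ((accPt_iff_frequently_nhdsNE.1 hacc).mono fun z hz => hz.2)
  exact h0 (this hz₀)

theorem isPreconnected_re_pos : IsPreconnected {s : ℂ | 0 < s.re} :=
  (convex_halfSpace_re_gt 0).isPreconnected

theorem isOpen_re_pos : IsOpen {s : ℂ | 0 < s.re} :=
  isOpen_lt continuous_const Complex.continuous_re

theorem analyticOrderAt_ne_top_of_re_pos {L : ℂ → ℂ} (hL : AnalyticOnNhd ℂ L {s : ℂ | 0 < s.re})
    {z₀ : ℂ} (hz₀ : 0 < z₀.re) (h0 : L z₀ ≠ 0) {ρ : ℂ} (hρ : 0 < ρ.re) : analyticOrderAt L ρ ≠ ⊤ := by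
  refine hL.analyticOrderAt_ne_top_of_isPreconnected isPreconnected_re_pos (x := z₀) hz₀ hρ ?_
  rw [(hL z₀ hz₀).analyticOrderAt_eq_zero.2 h0]
  simp

theorem local_logDeriv_bound : ∃ C : ℝ, 0 < C ∧ ∀ (L : ℂ → ℂ), AnalyticOnNhd ℂ L {s : ℂ | 0 < s.re} →
    ∀ (c : ℂ) (K : ℝ), c.re = 2 → 0 < K → L c ≠ 0 →
    (∀ z, ‖z - c‖ = 19 / 10 → ‖L z‖ ≤ Real.exp K * ‖L c‖) →
    ∃ Z : Finset ℂ, (∀ ρ, ρ ∈ Z ↔ ‖ρ - c‖ ≤ 17 / 10 ∧ L ρ = 0) ∧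
      (∑ ρ ∈ Z, (analyticOrderNatAt L ρ : ℝ)) ≤ C * K ∧
      ∀ s, ‖s - c‖ ≤ 16 / 10 → L s ≠ 0 →
        ‖logDeriv L s - ∑ ρ ∈ Z, (analyticOrderNatAt L ρ : ℝ) / (s - ρ)‖ ≤ C * K := by
  have hlog : 0 < Real.log ((19 / 10) / (17 / 10)) := Real.log_pos (by norm_num)
  set C₁ : ℝ := 8 * (17 / 10) / ((17 / 10) - (16 / 10)) ^ 2 +
    (17 / 10) / ((19 / 10) ^ 2 - (17 / 10) * (17 / 10)) / Real.log ((19 / 10) / (17 / 10)) with hC₁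
  have hC₁0 : 0 < C₁ := by rw [hC₁]; norm_num; positivity
  refine ⟨max (1 / Real.log ((19 / 10) / (17 / 10))) C₁, lt_max_of_lt_right hC₁0, ?_⟩
  intro L hL c K hc hK hLc hb
  have hre : ∀ z, ‖z - c‖ ≤ 19 / 10 → 0 < z.re := by
    intro z hz
    have := (abs_le.1 ((Complex.abs_re_le_norm (z - c)).trans hz)).1
    rw [Complex.sub_re, hc] at this
    linarith
  have hcU : 0 < c.re := by rw [hc]; norm_num
  have hfin := finite_zeros_of_isCompact isPreconnected_re_pos hL hcU hLc
    (isCompact_closedBall c (17 / 10)) (fun z hz => hre z (by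
      rw [mem_closedBall_iff_norm] at hz; linarith))
  have hmem : ∀ ρ, ρ ∈ hfin.toFinset ↔ ‖ρ - c‖ ≤ 17 / 10 ∧ L ρ = 0 := by
    intro ρ; simp [dist_eq_norm]
  obtain ⟨g, hg, hfg, hg0⟩ := exists_extract_zeros isOpen_re_pos hL hfin.toFinset
    (fun ρ hρ => hre ρ (by linarith [((hmem ρ).1 hρ).1]))
    (fun ρ hρ => analyticOrderAt_ne_top_of_re_pos hL hcU hLc hρ)
  have hsub : ∀ z ∈ Metric.closedBall c (19 / 10), z ∈ {s : ℂ | 0 < s.re} := fun z hz =>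
    hre z (mem_closedBall_iff_norm.1 hz)
  obtain ⟨h1, h2⟩ := zeros_and_logDeriv_bound (f := L) (g := g) (c := c) (r₂ := 16 / 10) (r₁ := 17 / 10)
    (R := 19 / 10) (K := K) (m := analyticOrderNatAt L) (by norm_num) (by norm_num) (by norm_num) hK
    (fun ρ hρ => ((hmem ρ).1 hρ).1) (fun z hz => hg z (hsub z hz))
    (fun z hz => by
      have hz' := mem_closedBall_iff_norm.1 hz
      refine hg0 z (hre z (by linarith)) ?_
      by_cases h : L z = 0
      · exact Or.inl ((hmem z).2 ⟨hz', h⟩)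
      · exact Or.inr h)
    (fun z hz => hfg z (hsub z hz)) (fun z hz => hb z (mem_sphere_iff_norm.1 hz))
  refine ⟨hfin.toFinset, hmem, ?_, fun s hs hLs => ?_⟩
  · rw [← le_div_iff₀ hlog] at h1
    refine h1.trans ?_
    rw [div_eq_mul_one_div, mul_comm]
    gcongr
    exact le_max_left _ _
  · have hsU : 0 < s.re := hre s (by linarith)
    have hgs : g s ≠ 0 := hg0 s hsU (Or.inr hLs)
    have hne : ∀ ρ ∈ hfin.toFinset, s - ρ ≠ 0 := fun ρ hρ h => hLs (by
      rw [sub_eq_zero.1 h]; exact ((hmem ρ).1 hρ).2)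
    have e : logDeriv L s = logDeriv (fun z => (∏ ρ ∈ hfin.toFinset, (z - ρ) ^ analyticOrderNatAt L ρ) * g z) s := by
      have e0 : L =ᶠ[𝓝 s] fun z => (∏ ρ ∈ hfin.toFinset, (z - ρ) ^ analyticOrderNatAt L ρ) * g z := by
        filter_upwards [isOpen_re_pos.mem_nhds hsU] with z hz using hfg z hz
      rw [logDeriv_apply, logDeriv_apply, e0.deriv_eq, e0.self_of_nhds]
    have e2 : logDeriv L s - ∑ ρ ∈ hfin.toFinset, (analyticOrderNatAt L ρ : ℝ) / (s - ρ) = logDeriv g s := by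
      rw [e, logDeriv_mul s (Finset.prod_ne_zero_iff.2 fun ρ hρ => pow_ne_zero _ (hne ρ hρ)) hgs
        (by fun_prop) (hg s hsU).differentiableAt,
        logDeriv_prod (f := fun ρ z => (z - ρ) ^ analyticOrderNatAt L ρ)
          (fun ρ hρ => pow_ne_zero _ (hne ρ hρ)) (fun ρ _ => by fun_prop)]
      rw [add_comm, add_sub_assoc, ← Finset.sum_sub_distrib, Finset.sum_eq_zero, add_zero]
      intro ρ hρ
      rw [logDeriv_fun_pow (by fun_prop), logDeriv_apply]
      simp [div_eq_mul_inv]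
    rw [e2]
    refine (h2 s (mem_closedBall_iff_norm.2 hs)).trans ?_
    gcongr
    exact le_max_right _ _

/-! ### Mean square approximation from an `L`-function -/

structure GoodL (L : ℂ → ℂ) : Prop where
  analytic : AnalyticOnNhd ℂ L {s : ℂ | 0 < s.re}
  growth : ∃ (C : ℝ) (k : ℕ), ∀ s : ℂ, 1 / 10 ≤ s.re → s.re ≤ 4 → ‖L s‖ ≤ C * (1 + |s.im|) ^ k
  lower : ∃ c : ℝ, 0 < c ∧ ∀ s : ℂ, s.re = 2 → c ≤ ‖L s‖
  zeros : ∀ s : ℂ, 0 < s.re → L s = 0 → s.re = 1 / 2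

noncomputable def ell (n : ℤ) : ℝ := Real.log (|(n : ℝ)| + 3)

theorem one_le_ell (n : ℤ) : 1 ≤ ell n := by
  have h3 : (1 : ℝ) ≤ Real.log 3 := by
    rw [Real.le_log_iff_exp_le (by norm_num)]
    linarith [Real.exp_one_lt_d9]
  refine h3.trans (Real.log_le_log (by norm_num) ?_)
  linarith [abs_nonneg (n : ℝ)]

theorem abs_re_le_and_im {z c : ℂ} {r : ℝ} (h : ‖z - c‖ ≤ r) : |z.re - c.re| ≤ r ∧ |z.im - c.im| ≤ r :=
  ⟨by simpa using (Complex.abs_re_le_norm (z - c)).trans h, by simpa using (Complex.abs_im_le_norm (z - c)).trans h⟩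

theorem norm_le_iff_sq {z : ℂ} {r : ℝ} (hr : 0 ≤ r) : ‖z‖ ≤ r ↔ z.re ^ 2 + z.im ^ 2 ≤ r ^ 2 := by
  rw [← abs_of_nonneg hr, ← sq_le_sq₀ (norm_nonneg _) (abs_nonneg _), ← Complex.normSq_eq_norm_sq, Complex.normSq_apply,
    sq_abs, ← sq, ← sq]

theorem GoodL.window {L : ℂ → ℂ} (hL : GoodL L) : ∃ D : ℝ, 0 < D ∧ ∀ n : ℤ, ∃ Z : Finset ℂ,
    (∀ ρ, ρ ∈ Z ↔ 0 < ρ.re ∧ L ρ = 0 ∧ |ρ.im - n| ≤ 4 / 5) ∧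
    (∑ ρ ∈ Z, (analyticOrderNatAt L ρ : ℝ)) ≤ D * ell n ∧
    ∀ w : ℂ, 1 / 2 < w.re → w.re ≤ 3 / 2 → |w.im - n| ≤ 1 / 2 →
      ‖logDeriv L w - ∑ ρ ∈ Z, (analyticOrderNatAt L ρ : ℝ) / (w - ρ)‖ ≤ D * ell n := by
  obtain ⟨C, hC, h⟩ := local_logDeriv_bound
  obtain ⟨B, k, hB⟩ := hL.growth
  obtain ⟨c₀, hc₀, hlow⟩ := hL.lower
  set q : ℝ := (|B| + 1) / c₀ with hq
  have hq0 : 0 < q := by positivity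
  refine ⟨C * (|Real.log q| + k + 1), by positivity, fun n => ?_⟩
  have hl := one_le_ell n
  set c : ℂ := 2 + n * Complex.I with hc
  have hcre : c.re = 2 := by simp [hc]
  have hcim : c.im = n := by simp [hc]
  have hlc := hlow c hcre
  obtain ⟨Z, hZ, hs, hb⟩ := h L hL.analytic c ((|Real.log q| + k + 1) * ell n) hcre (by positivity)
    (norm_pos_iff.1 (hc₀.trans_le hlc)) (by
      intro z hz
      obtain ⟨h1, h2⟩ := abs_re_le_and_im hz.le
      rw [hcre] at h1
      rw [hcim] at h2
      rw [abs_le] at h1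
      have h3 : |z.im| ≤ |(n : ℝ)| + 19 / 10 := by
        have := abs_add_le (z.im - n) n
        rw [sub_add_cancel] at this
        linarith
      have hn3 : (0 : ℝ) < |(n : ℝ)| + 3 := by positivity
      calc ‖L z‖ ≤ B * (1 + |z.im|) ^ k := hB z (by linarith) (by linarith)
        _ ≤ (|B| + 1) * (|(n : ℝ)| + 3) ^ k := by
            have h4 : 1 + |z.im| ≤ |(n : ℝ)| + 3 := by linarith
            exact mul_le_mul (by linarith [le_abs_self B]) (pow_le_pow_left₀ (by positivity) h4 k) (by positivity)
              (by positivity)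
        _ = q * (|(n : ℝ)| + 3) ^ k * c₀ := by rw [hq]; field_simp
        _ ≤ Real.exp ((|Real.log q| + k + 1) * ell n) * ‖L c‖ := by
            gcongr
            have e : q * (|(n : ℝ)| + 3) ^ k = Real.exp (Real.log q + k * ell n) := by
              rw [Real.exp_add, Real.exp_log hq0, ell, ← Real.log_pow, Real.exp_log (by positivity)]
            rw [e]
            gcongr
            have : Real.log q ≤ |Real.log q| * ell n :=
              (le_abs_self _).trans (le_mul_of_one_le_right (abs_nonneg _) hl)
            nlinarith)
  refine ⟨Z, fun ρ => ?_, by rw [mul_assoc]; exact hs, fun w h1 h2 h3 => ?_⟩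
  · rw [hZ, norm_le_iff_sq (by norm_num), Complex.sub_re, Complex.sub_im, hcre, hcim]
    constructor
    · rintro ⟨h1, h2⟩
      have hpos : 0 < ρ.re := by nlinarith [sq_nonneg (ρ.im - n)]
      have := hL.zeros ρ hpos h2
      refine ⟨hpos, h2, abs_le_of_sq_le_sq ?_ (by norm_num)⟩
      rw [this] at h1
      linarith
    · rintro ⟨h1, h2, h3⟩
      refine ⟨?_, h2⟩
      rw [hL.zeros ρ h1 h2]
      have := sq_le_sq' (abs_le.1 h3).1 (abs_le.1 h3).2
      linarith
  · rw [mul_assoc]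
    refine hb w ?_ fun h0 => ?_
    · rw [norm_le_iff_sq (by norm_num), Complex.sub_re, Complex.sub_im, hcre, hcim]
      have := sq_le_sq' (abs_le.1 h3).1 (abs_le.1 h3).2
      nlinarith
    · have := hL.zeros w (by linarith) h0
      linarith

theorem norm_ge_of_im_window {w : ℂ} {x r : ℝ} (h1 : 1 / 2 ≤ w.re) (h2 : |w.im - x| ≤ r) (hr : r ≤ 4 / 5) :
    (1 + |x|) / 5 ≤ ‖w‖ := by
  have hre : 1 / 2 ≤ ‖w‖ := h1.trans ((le_abs_self _).trans (Complex.abs_re_le_norm w))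
  have him := Complex.abs_im_le_norm w
  have h3 : |x| ≤ |w.im| + r := by
    have := abs_sub_abs_le_abs_sub x w.im
    rw [abs_sub_comm] at this
    linarith
  rcases le_or_gt |x| (3 / 2) with h | h <;> linarith

theorem GoodL.approx {L : ℂ → ℂ} (hL : GoodL L) : ∃ (D : ℝ) (Z : ℤ → Finset ℂ), 0 < D ∧
    (∀ n, ∀ ρ ∈ Z n, ρ.re = 1 / 2) ∧ (∀ n, (∑ ρ ∈ Z n, (analyticOrderNatAt L ρ : ℝ)) ≤ D * ell n) ∧
    ∀ N : ℕ, ∃ (S : Finset ℂ) (c : ℂ → ℂ) (K : ℝ), 0 < K ∧ (∀ ρ ∈ S, ρ.re = 1 / 2) ∧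
      ∀ (n : ℤ) (w : ℂ), 1 / 2 < w.re → w.re ≤ 3 / 2 → |w.im - n| ≤ 1 / 2 →
        ‖-logDeriv L w / w - ∑ ρ ∈ S, c ρ / (w - ρ)‖ ≤
          (if |n| ≤ N then 0 else 5 / (1 + |(n : ℝ)|) * ∑ ρ ∈ Z n, (analyticOrderNatAt L ρ : ℝ) / ‖w - ρ‖) +
            K * (ell n / (1 + |(n : ℝ)|)) := by
  obtain ⟨D, hD, h⟩ := hL.window
  choose Z hZ hm hb using h
  have hre : ∀ n, ∀ ρ ∈ Z n, ρ.re = 1 / 2 := fun n ρ hρ =>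
    hL.zeros ρ ((hZ n ρ).1 hρ).1 ((hZ n ρ).1 hρ).2.1
  refine ⟨D, Z, hD, hre, hm, fun N => ?_⟩
  set m : ℂ → ℝ := fun ρ => (analyticOrderNatAt L ρ : ℝ) with hmdef
  have hm0 : ∀ ρ, 0 ≤ m ρ := fun ρ => Nat.cast_nonneg _
  set S : Finset ℂ := (Finset.Icc (-(N : ℤ)) N).biUnion Z with hS
  set M : ℝ := ∑ ρ ∈ S, m ρ with hM
  have hM0 : 0 ≤ M := Finset.sum_nonneg fun ρ _ => hm0 ρ
  set q : ℝ := 1 + (N + 5 / 2) / (3 / 10) with hq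
  have hSre : ∀ ρ ∈ S, ρ.re = 1 / 2 := by
    intro ρ hρ
    obtain ⟨n, -, hn⟩ := Finset.mem_biUnion.1 hρ
    exact hre n ρ hn
  have hSim : ∀ ρ ∈ S, |ρ.im| ≤ N + 1 := by
    intro ρ hρ
    obtain ⟨n, hn, hn'⟩ := Finset.mem_biUnion.1 hρ
    have h1 := ((hZ n ρ).1 hn').2.2
    have h2 : |(n : ℝ)| ≤ N := by
      rw [Finset.mem_Icc] at hn
      rw [abs_le]
      exact_mod_cast hn
    have := abs_sub_abs_le_abs_sub ρ.im n
    linarith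
  have hhalf : ∀ ρ : ℂ, ρ.re = 1 / 2 → 1 / 2 ≤ ‖ρ‖ := fun ρ h =>
    h.symm.le.trans ((le_abs_self _).trans (Complex.abs_re_le_norm ρ))
  refine ⟨S, fun ρ => -(m ρ : ℂ) / ρ, 5 * D + 10 * D + 2 * M * q, by positivity, hSre, fun n w h1 h2 h3 => ?_⟩
  have hn1 : 0 < 1 + |(n : ℝ)| := by positivity
  have hl := one_le_ell n
  have hw := norm_ge_of_im_window h1.le h3 (by norm_num)
  have hw0 : w ≠ 0 := norm_pos_iff.1 (lt_of_lt_of_le (by positivity) hw)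
  have hwi : ‖w‖⁻¹ ≤ 5 / (1 + |(n : ℝ)|) := by
    rw [← inv_div]
    exact inv_anti₀ (by positivity) hw
  have hwρ : ∀ ρ : ℂ, ρ.re = 1 / 2 → w - ρ ≠ 0 := by
    intro ρ h h0
    have := congrArg Complex.re h0
    simp only [Complex.sub_re, Complex.zero_re] at this
    linarith
  have hρ0 : ∀ ρ : ℂ, ρ.re = 1 / 2 → ρ ≠ 0 := by
    rintro ρ h rfl
    norm_num at h
  set R := logDeriv L w - ∑ ρ ∈ Z n, (m ρ : ℂ) / (w - ρ) with hR
  have hRb : ‖R‖ ≤ D * ell n := by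
    have := hb n w h1 h2 h3
    rw [hR]
    simpa [hmdef] using this
  have key : -logDeriv L w / w - ∑ ρ ∈ S, (-(m ρ : ℂ) / ρ) / (w - ρ) =
      -R / w + ∑ ρ ∈ Z n \ S, -(m ρ : ℂ) / (w * (w - ρ)) + ∑ ρ ∈ Z n ∩ S, (m ρ : ℂ) / (ρ * w)
        + ∑ ρ ∈ S \ Z n, ((m ρ : ℂ) / ρ) / (w - ρ) := by
    have e1 : logDeriv L w = R + ∑ ρ ∈ Z n, (m ρ : ℂ) / (w - ρ) := by rw [hR]; ring
    have e2 : -logDeriv L w / w = -R / w + ∑ ρ ∈ Z n, -(m ρ : ℂ) / (w * (w - ρ)) := by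
      rw [e1, neg_add, add_div, ← Finset.sum_neg_distrib, Finset.sum_div]
      congr 1
      refine Finset.sum_congr rfl fun ρ hρ => ?_
      have := hwρ ρ (hre n ρ hρ)
      field_simp
    rw [e2, ← Finset.sum_inter_add_sum_sdiff (Z n) S, ← Finset.sum_inter_add_sum_sdiff S (Z n), Finset.inter_comm S (Z n)]
    have e3 : ∑ ρ ∈ Z n ∩ S, -(m ρ : ℂ) / (w * (w - ρ)) =
        ∑ ρ ∈ Z n ∩ S, (-(m ρ : ℂ) / ρ) / (w - ρ) + ∑ ρ ∈ Z n ∩ S, (m ρ : ℂ) / (ρ * w) := by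
      rw [← Finset.sum_add_distrib]
      refine Finset.sum_congr rfl fun ρ hρ => ?_
      have h := hre n ρ (Finset.mem_inter.1 hρ).1
      have h' := hwρ ρ h
      have h'' := hρ0 ρ h
      field_simp
      ring
    have e4 : ∑ ρ ∈ S \ Z n, ((m ρ : ℂ) / ρ) / (w - ρ) = - ∑ ρ ∈ S \ Z n, (-(m ρ : ℂ) / ρ) / (w - ρ) := by
      rw [← Finset.sum_neg_distrib]
      refine Finset.sum_congr rfl fun ρ _ => by ring
    rw [e3, e4]
    ring
  rw [key]
  have b1 : ‖-R / w‖ ≤ 5 * D * (ell n / (1 + |(n : ℝ)|)) := by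
    rw [norm_div, norm_neg, div_eq_mul_inv]
    calc ‖R‖ * ‖w‖⁻¹ ≤ D * ell n * (5 / (1 + |(n : ℝ)|)) := by gcongr
      _ = _ := by ring
  have b2 : ‖∑ ρ ∈ Z n \ S, -(m ρ : ℂ) / (w * (w - ρ))‖ ≤
      (if |n| ≤ N then 0 else 5 / (1 + |(n : ℝ)|) * ∑ ρ ∈ Z n, m ρ / ‖w - ρ‖) := by
    split_ifs with hnN
    · have : Z n \ S = ∅ := by
        rw [Finset.sdiff_eq_empty_iff_subset]
        exact Finset.subset_biUnion_of_mem Z (Finset.mem_Icc.2 (abs_le.1 hnN))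
      simp [this]
    · refine (norm_sum_le _ _).trans ?_
      rw [Finset.mul_sum]
      refine (Finset.sum_le_sum_of_subset_of_nonneg Finset.sdiff_subset fun _ _ _ => norm_nonneg _).trans ?_
      refine Finset.sum_le_sum fun ρ _ => ?_
      rw [norm_div, norm_neg, norm_mul, Complex.norm_real, Real.norm_of_nonneg (hm0 ρ)]
      calc m ρ / (‖w‖ * ‖w - ρ‖) = ‖w‖⁻¹ * (m ρ / ‖w - ρ‖) := by
            rw [div_mul_eq_div_div_swap, div_eq_mul_inv _ ‖w‖, mul_comm]
        _ ≤ _ := mul_le_mul_of_nonneg_right hwi (div_nonneg (hm0 ρ) (norm_nonneg _))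
  have b3 : ‖∑ ρ ∈ Z n ∩ S, (m ρ : ℂ) / (ρ * w)‖ ≤ 10 * D * (ell n / (1 + |(n : ℝ)|)) := by
    calc ‖∑ ρ ∈ Z n ∩ S, (m ρ : ℂ) / (ρ * w)‖ ≤ ∑ ρ ∈ Z n ∩ S, ‖(m ρ : ℂ) / (ρ * w)‖ := norm_sum_le _ _
      _ ≤ ∑ ρ ∈ Z n ∩ S, m ρ * (10 / (1 + |(n : ℝ)|)) := by
          refine Finset.sum_le_sum fun ρ hρ => ?_
          have hρ2 := hhalf ρ (hre n ρ (Finset.mem_inter.1 hρ).1)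
          rw [norm_div, norm_mul, Complex.norm_real, Real.norm_of_nonneg (hm0 ρ), div_eq_mul_inv]
          refine mul_le_mul_of_nonneg_left ?_ (hm0 ρ)
          rw [mul_inv]
          have : ‖ρ‖⁻¹ ≤ 2 := by
            rw [inv_le_comm₀ (by linarith) (by norm_num)]
            linarith
          calc ‖ρ‖⁻¹ * ‖w‖⁻¹ ≤ 2 * (5 / (1 + |(n : ℝ)|)) := by gcongr
            _ = _ := by ring
      _ ≤ ∑ ρ ∈ Z n, m ρ * (10 / (1 + |(n : ℝ)|)) :=
          Finset.sum_le_sum_of_subset_of_nonneg Finset.inter_subset_left fun ρ _ _ =>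
            mul_nonneg (hm0 ρ) (by positivity)
      _ = (∑ ρ ∈ Z n, m ρ) * (10 / (1 + |(n : ℝ)|)) := by rw [Finset.sum_mul]
      _ ≤ D * ell n * (10 / (1 + |(n : ℝ)|)) := mul_le_mul_of_nonneg_right (hm n) (by positivity)
      _ = _ := by ring
  have b4 : ‖∑ ρ ∈ S \ Z n, ((m ρ : ℂ) / ρ) / (w - ρ)‖ ≤ 2 * M * q * (ell n / (1 + |(n : ℝ)|)) := by
    calc ‖∑ ρ ∈ S \ Z n, ((m ρ : ℂ) / ρ) / (w - ρ)‖ ≤ ∑ ρ ∈ S \ Z n, ‖((m ρ : ℂ) / ρ) / (w - ρ)‖ := norm_sum_le _ _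
      _ ≤ ∑ ρ ∈ S \ Z n, m ρ * (2 * (q / (1 + |(n : ℝ)|))) := by
          refine Finset.sum_le_sum fun ρ hρ => ?_
          obtain ⟨hρS, hρZ⟩ := Finset.mem_sdiff.1 hρ
          have hr := hSre ρ hρS
          have hρ2 := hhalf ρ hr
          have hi := hSim ρ hρS
          have hfar : 4 / 5 < |ρ.im - n| := by
            by_contra! hcon
            have hz : L ρ = 0 := by
              obtain ⟨k, -, hk⟩ := Finset.mem_biUnion.1 hρS
              exact ((hZ k ρ).1 hk).2.1
            exact hρZ ((hZ n ρ).2 ⟨by rw [hr]; norm_num, hz, hcon⟩)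
          have hd : 3 / 10 ≤ |w.im - ρ.im| := by
            have := abs_sub_le ρ.im w.im n
            rw [abs_sub_comm ρ.im w.im] at this
            linarith
          have hd2 : 1 + |(n : ℝ)| ≤ q * |w.im - ρ.im| := by
            have t1 := abs_sub_abs_le_abs_sub (n : ℝ) w.im
            rw [abs_sub_comm] at t1
            have t2 := abs_sub_abs_le_abs_sub w.im ρ.im
            have t3 : (N : ℝ) + 5 / 2 ≤ (N + 5 / 2) / (3 / 10) * |w.im - ρ.im| := by
              rw [div_mul_eq_mul_div, le_div_iff₀ (by norm_num)]
              exact mul_le_mul_of_nonneg_left hd (by positivity)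
            rw [hq, add_mul, one_mul]
            linarith
          have hd3 : |w.im - ρ.im| ≤ ‖w - ρ‖ := by simpa using Complex.abs_im_le_norm (w - ρ)
          have hq0 : 0 < q := by positivity
          have hpos : 0 < ‖w - ρ‖ := by linarith
          rw [norm_div, norm_div, Complex.norm_real, Real.norm_of_nonneg (hm0 ρ), div_div, div_eq_mul_inv]
          refine mul_le_mul_of_nonneg_left ?_ (hm0 ρ)
          rw [mul_inv]
          have i1 : ‖ρ‖⁻¹ ≤ 2 := by
            rw [inv_le_comm₀ (by linarith) (by norm_num)]
            linarith
          have i2 : ‖w - ρ‖⁻¹ ≤ q / (1 + |(n : ℝ)|) := by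
            rw [inv_le_iff_one_le_mul₀ hpos, div_mul_eq_mul_div, le_div_iff₀ hn1, one_mul]
            exact hd2.trans (mul_le_mul_of_nonneg_left hd3 hq0.le)
          gcongr
      _ ≤ ∑ ρ ∈ S, m ρ * (2 * (q / (1 + |(n : ℝ)|))) :=
          Finset.sum_le_sum_of_subset_of_nonneg Finset.sdiff_subset fun ρ _ _ =>
            mul_nonneg (hm0 ρ) (by positivity)
      _ = 2 * M * q * (1 / (1 + |(n : ℝ)|)) := by rw [← Finset.sum_mul, ← hM]; ring
      _ ≤ _ := by gcongr
  calc _ ≤ ‖-R / w‖ + ‖∑ ρ ∈ Z n \ S, -(m ρ : ℂ) / (w * (w - ρ))‖ + ‖∑ ρ ∈ Z n ∩ S, (m ρ : ℂ) / (ρ * w)‖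
        + ‖∑ ρ ∈ S \ Z n, ((m ρ : ℂ) / ρ) / (w - ρ)‖ := norm_add₄_le
    _ ≤ _ := by linarith

theorem ell_le_rpow (n : ℤ) : ell n / (1 + |(n : ℝ)|) ≤ 12 * (1 + |(n : ℝ)|) ^ (-(3 / 4) : ℝ) := by
  have hn : 0 < 1 + |(n : ℝ)| := by positivity
  have h1 : ell n ≤ (|(n : ℝ)| + 3) ^ (1 / 4 : ℝ) / (1 / 4) := Real.log_le_rpow_div (by positivity) (by norm_num)
  have h2 : (|(n : ℝ)| + 3) ^ (1 / 4 : ℝ) ≤ 3 * (1 + |(n : ℝ)|) ^ (1 / 4 : ℝ) := by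
    calc (|(n : ℝ)| + 3) ^ (1 / 4 : ℝ) ≤ (3 * (1 + |(n : ℝ)|)) ^ (1 / 4 : ℝ) :=
          Real.rpow_le_rpow (by positivity) (by linarith [abs_nonneg (n : ℝ)]) (by norm_num)
      _ = 3 ^ (1 / 4 : ℝ) * (1 + |(n : ℝ)|) ^ (1 / 4 : ℝ) := Real.mul_rpow (by norm_num) hn.le
      _ ≤ 3 * (1 + |(n : ℝ)|) ^ (1 / 4 : ℝ) := by
          refine mul_le_mul_of_nonneg_right ?_ (by positivity)
          calc (3 : ℝ) ^ (1 / 4 : ℝ) ≤ 3 ^ (1 : ℝ) := Real.rpow_le_rpow_of_exponent_le (by norm_num) (by norm_num)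
            _ = 3 := Real.rpow_one 3
  rw [div_le_iff₀ hn]
  have h3 : (1 + |(n : ℝ)|) ^ (-(3 / 4) : ℝ) * (1 + |(n : ℝ)|) = (1 + |(n : ℝ)|) ^ (1 / 4 : ℝ) := by
    nth_rewrite 2 [← Real.rpow_one (1 + |(n : ℝ)|)]
    rw [← Real.rpow_add hn]
    norm_num
  rw [mul_assoc, h3]
  linarith

noncomputable def windowWeight (n : ℤ) : ℝ := (ell n / (1 + |(n : ℝ)|)) ^ 2

theorem windowWeight_nonneg (n : ℤ) : 0 ≤ windowWeight n := sq_nonneg _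

theorem summable_windowWeight : Summable windowWeight := by
  have h : Summable fun n : ℤ => 144 * |(n : ℝ)| ^ (-(3 / 2) : ℝ) :=
    (Real.summable_abs_int_rpow (by norm_num)).mul_left _
  refine h.of_norm_bounded_eventually ?_
  have : ∀ᶠ n : ℤ in cofinite, n ≠ 0 := by
    simpa using (Set.finite_singleton (0 : ℤ)).compl_mem_cofinite
  filter_upwards [this] with n hn
  have hn0 : 0 < |(n : ℝ)| := abs_pos.2 (by exact_mod_cast hn)
  have hl := one_le_ell n
  rw [Real.norm_of_nonneg (windowWeight_nonneg n), windowWeight]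
  calc (ell n / (1 + |(n : ℝ)|)) ^ 2 ≤ (12 * (1 + |(n : ℝ)|) ^ (-(3 / 4) : ℝ)) ^ 2 :=
        pow_le_pow_left₀ (by positivity) (ell_le_rpow n) 2
    _ = 144 * (1 + |(n : ℝ)|) ^ (-(3 / 2) : ℝ) := by
        rw [mul_pow, ← Real.rpow_natCast ((1 + |(n : ℝ)|) ^ (-(3 / 4) : ℝ)) 2, ← Real.rpow_mul (by positivity)]
        norm_num
    _ ≤ 144 * |(n : ℝ)| ^ (-(3 / 2) : ℝ) := by
        refine mul_le_mul_of_nonneg_left ?_ (by norm_num)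
        exact Real.rpow_le_rpow_of_nonpos hn0 (by linarith) (by norm_num)

theorem integrable_cauchy {a : ℝ} (ha : 0 < a) (γ : ℝ) : Integrable (fun t : ℝ => (a ^ 2 + (t - γ) ^ 2)⁻¹) ∧
    ∫ t : ℝ, (a ^ 2 + (t - γ) ^ 2)⁻¹ = Real.pi / a := by
  have e : (fun t : ℝ => (a ^ 2 + t ^ 2)⁻¹) = fun t => (a ^ 2)⁻¹ * (1 + (a⁻¹ * t) ^ 2)⁻¹ := by
    funext t
    rw [← mul_inv]
    congr 1
    field_simp
  have hi : Integrable (fun t : ℝ => (a ^ 2 + t ^ 2)⁻¹) := by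
    rw [e]
    exact ((integrable_comp_mul_left_iff _ (inv_ne_zero ha.ne')).2 integrable_inv_one_add_sq).const_mul _
  refine ⟨hi.comp_sub_right γ, ?_⟩
  rw [integral_sub_right_eq_self (fun t : ℝ => (a ^ 2 + t ^ 2)⁻¹) γ, e, integral_const_mul,
    Measure.integral_comp_mul_left (fun t : ℝ => (1 + t ^ 2)⁻¹), integral_univ_inv_one_add_sq, inv_inv, abs_of_pos ha,
    smul_eq_mul]
  field_simp

theorem vertical_mean_square_le {H : ℝ → ℂ} {Z : ℤ → Finset ℂ} {m : ℂ → ℝ} {D K a : ℝ} {N : ℕ} (ha : 0 < a)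
    (hD : 0 < D) (hm : ∀ ρ, 0 ≤ m ρ) (hZ : ∀ n, ∀ ρ ∈ Z n, ρ.re = 1 / 2) (hs : ∀ n, ∑ ρ ∈ Z n, m ρ ≤ D * ell n)
    (hH : ∀ (n : ℤ) (t : ℝ), |t - n| ≤ 1 / 2 → ‖H t‖ ≤ (if |n| ≤ N then 0 else
      5 / (1 + |(n : ℝ)|) * ∑ ρ ∈ Z n, m ρ / ‖(1 / 2 + a + t * Complex.I) - ρ‖) + K * (ell n / (1 + |(n : ℝ)|))) :
    a * ∫ t, ‖H t‖ ^ 2 ≤ 50 * Real.pi * D ^ 2 * ∑' n : ℤ, (if |n| ≤ N then 0 else windowWeight n)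
      + a * (2 * K ^ 2 * ∑' n, windowWeight n) := by
  set v : ℤ → ℝ := fun n => if |n| ≤ N then 0 else windowWeight n with hv
  have hv0 : ∀ n, 0 ≤ v n := by
    intro n
    simp only [hv]
    split_ifs
    · exact le_rfl
    · exact windowWeight_nonneg n
  have hvs : Summable v := summable_windowWeight.of_nonneg_of_le hv0 (by
    intro n
    simp only [hv]
    split_ifs
    · exact windowWeight_nonneg n
    · exact le_rfl)
  set b : ℤ → ℝ := fun n => 50 * Real.pi * D ^ 2 / a * v n + 2 * K ^ 2 * windowWeight n with hb
  have hb0 : ∀ n, 0 ≤ b n := fun n => add_nonneg (mul_nonneg (by positivity) (hv0 n))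
    (mul_nonneg (by positivity) (windowWeight_nonneg n))
  have hbs : Summable b := (hvs.mul_left _).add (summable_windowWeight.mul_left _)
  have hwin : ∀ n : ℤ, ∫⁻ t in Set.Icc ((n : ℝ) - 1 / 2) (n + 1 / 2), ENNReal.ofReal (‖‖H t‖ ^ 2‖) ≤ ENNReal.ofReal (b n) := by
    intro n
    have hl := one_le_ell n
    set κ : ℝ := if |n| ≤ N then 0 else 50 / (1 + |(n : ℝ)|) ^ 2 * (D * ell n) with hκ
    have hκ0 : 0 ≤ κ := by
      rw [hκ]
      split_ifs <;> positivity
    set g : ℝ → ℝ := fun t => κ * ∑ ρ ∈ Z n, m ρ * (a ^ 2 + (t - ρ.im) ^ 2)⁻¹ with hg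
    have hg0 : ∀ t, 0 ≤ g t := fun t => mul_nonneg hκ0 (Finset.sum_nonneg fun ρ _ => mul_nonneg (hm ρ) (by positivity))
    have hgi : Integrable g := (integrable_finsetSum _ fun ρ _ => (integrable_cauchy ha ρ.im).1.const_mul (m ρ)).const_mul _
    have hgv : ∫ t, g t = κ * ((∑ ρ ∈ Z n, m ρ) * (Real.pi / a)) := by
      rw [hg, integral_const_mul, integral_finsetSum _ fun ρ _ => (integrable_cauchy ha ρ.im).1.const_mul (m ρ), Finset.sum_mul]
      congr 1
      refine Finset.sum_congr rfl fun ρ _ => ?_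
      rw [integral_const_mul, (integrable_cauchy ha ρ.im).2]
    have hpt : ∀ t ∈ Set.Icc ((n : ℝ) - 1 / 2) (n + 1 / 2), ‖‖H t‖ ^ 2‖ ≤ g t + 2 * K ^ 2 * windowWeight n := by
      intro t ht
      have ht' : |t - n| ≤ 1 / 2 := by rw [abs_le]; constructor <;> linarith [ht.1, ht.2]
      have h1 := hH n t ht'
      set X : ℝ := if |n| ≤ N then 0 else
        5 / (1 + |(n : ℝ)|) * ∑ ρ ∈ Z n, m ρ / ‖(1 / 2 + a + t * Complex.I) - ρ‖ with hX
      have hX2 : 2 * X ^ 2 ≤ g t := by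
        rw [hX, hg]
        simp only [hκ]
        split_ifs
        · simp
        · have hcs : (∑ ρ ∈ Z n, m ρ / ‖(1 / 2 + a + t * Complex.I) - ρ‖) ^ 2 ≤
              (∑ ρ ∈ Z n, m ρ) * ∑ ρ ∈ Z n, m ρ * (a ^ 2 + (t - ρ.im) ^ 2)⁻¹ := by
            refine Finset.sum_sq_le_sum_mul_sum_of_sq_le_mul _ (fun ρ _ => hm ρ)
              (fun ρ _ => mul_nonneg (hm ρ) (by positivity)) fun ρ hρ => ?_
            rw [div_pow, ← Complex.normSq_eq_norm_sq, Complex.normSq_apply]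
            refine le_of_eq ?_
            simp only [Complex.sub_re, Complex.sub_im, Complex.add_re, Complex.add_im, Complex.mul_re, Complex.mul_im,
              Complex.ofReal_re, Complex.ofReal_im, Complex.I_re, Complex.I_im, hZ n ρ hρ]
            norm_num
            ring
          have hS0 : 0 ≤ ∑ ρ ∈ Z n, m ρ * (a ^ 2 + (t - ρ.im) ^ 2)⁻¹ :=
            Finset.sum_nonneg fun ρ _ => mul_nonneg (hm ρ) (by positivity)
          calc 2 * (5 / (1 + |(n : ℝ)|) * ∑ ρ ∈ Z n, m ρ / ‖(1 / 2 + a + t * Complex.I) - ρ‖) ^ 2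
              = 50 / (1 + |(n : ℝ)|) ^ 2 * (∑ ρ ∈ Z n, m ρ / ‖(1 / 2 + a + t * Complex.I) - ρ‖) ^ 2 := by
                rw [mul_pow, div_pow]; ring
            _ ≤ 50 / (1 + |(n : ℝ)|) ^ 2 * ((D * ell n) * ∑ ρ ∈ Z n, m ρ * (a ^ 2 + (t - ρ.im) ^ 2)⁻¹) := by
                refine mul_le_mul_of_nonneg_left (hcs.trans ?_) (by positivity)
                exact mul_le_mul_of_nonneg_right (hs n) hS0
            _ = _ := by ring
      rw [Real.norm_of_nonneg (by positivity)]
      calc ‖H t‖ ^ 2 ≤ (X + K * (ell n / (1 + |(n : ℝ)|))) ^ 2 := pow_le_pow_left₀ (norm_nonneg _) h1 2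
        _ ≤ 2 * X ^ 2 + 2 * (K * (ell n / (1 + |(n : ℝ)|))) ^ 2 := by
            nlinarith [sq_nonneg (X - K * (ell n / (1 + |(n : ℝ)|)))]
        _ ≤ _ := by rw [windowWeight]; linarith [mul_pow K (ell n / (1 + |(n : ℝ)|)) 2]
    have hgb : ∫ t, g t ≤ 50 * Real.pi * D ^ 2 / a * v n := by
      rw [hgv]
      calc κ * ((∑ ρ ∈ Z n, m ρ) * (Real.pi / a)) ≤ κ * ((D * ell n) * (Real.pi / a)) := by
            have := hs n
            have := Real.pi_pos
            gcongr
        _ = _ := by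
            simp only [hκ, hv]
            split_ifs
            · simp
            · rw [windowWeight]
              field_simp
    have hw2 : 0 ≤ 2 * K ^ 2 * windowWeight n := mul_nonneg (by positivity) (windowWeight_nonneg n)
    calc ∫⁻ t in Set.Icc ((n : ℝ) - 1 / 2) (n + 1 / 2), ENNReal.ofReal (‖‖H t‖ ^ 2‖)
        ≤ ∫⁻ t in Set.Icc ((n : ℝ) - 1 / 2) (n + 1 / 2), (ENNReal.ofReal (2 * K ^ 2 * windowWeight n) + ENNReal.ofReal (g t)) := by
          refine setLIntegral_mono' measurableSet_Icc fun t ht => ?_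
          rw [← ENNReal.ofReal_add hw2 (hg0 t), add_comm]
          exact ENNReal.ofReal_le_ofReal (hpt t ht)
      _ = ENNReal.ofReal (2 * K ^ 2 * windowWeight n) * volume (Set.Icc ((n : ℝ) - 1 / 2) (n + 1 / 2)) +
            ∫⁻ t in Set.Icc ((n : ℝ) - 1 / 2) (n + 1 / 2), ENNReal.ofReal (g t) := by
          rw [lintegral_add_left measurable_const, setLIntegral_const]
      _ ≤ ENNReal.ofReal (2 * K ^ 2 * windowWeight n) + ENNReal.ofReal (50 * Real.pi * D ^ 2 / a * v n) := by
          refine add_le_add (le_of_eq ?_) ?_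
          · rw [Real.volume_Icc]
            norm_num
          · refine (setLIntegral_le_lintegral _ _).trans ?_
            rw [← ofReal_integral_eq_lintegral_ofReal hgi (Eventually.of_forall hg0)]
            exact ENNReal.ofReal_le_ofReal hgb
      _ = ENNReal.ofReal (b n) := by
          rw [← ENNReal.ofReal_add hw2 (mul_nonneg (by positivity) (hv0 n)), hb, add_comm]
  have htot : ∫⁻ t, ENNReal.ofReal (‖‖H t‖ ^ 2‖) ≤ ENNReal.ofReal (∑' n, b n) := by
    have hU : (⋃ n : ℤ, Set.Icc ((n : ℝ) - 1 / 2) (n + 1 / 2)) = Set.univ := by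
      refine Set.eq_univ_of_forall fun t => Set.mem_iUnion.2 ⟨round t, ?_⟩
      have := abs_le.1 (abs_sub_round t)
      constructor <;> linarith [this.1, this.2]
    rw [← setLIntegral_univ, ← hU, ENNReal.ofReal_tsum_of_nonneg hb0 hbs]
    exact (lintegral_iUnion_le _ _).trans (ENNReal.tsum_le_tsum hwin)
  have hfin : ∫ t, ‖H t‖ ^ 2 ≤ ∑' n, b n := by
    refine (Real.le_norm_self _).trans ((norm_integral_le_lintegral_norm _).trans ?_)
    exact ENNReal.toReal_le_of_le_ofReal (tsum_nonneg hb0) htot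
  calc a * ∫ t, ‖H t‖ ^ 2 ≤ a * ∑' n, b n := mul_le_mul_of_nonneg_left hfin ha.le
    _ = _ := by
        rw [hb, Summable.tsum_add (hvs.mul_left _) (summable_windowWeight.mul_left _), tsum_mul_left, tsum_mul_left]
        field_simp

theorem tendsto_tail_windowWeight :
    Tendsto (fun N : ℕ => ∑' n : ℤ, (if |n| ≤ N then 0 else windowWeight n)) atTop (𝓝 0) := by
  have h := tendsto_tsum_of_dominated_convergence (𝓕 := atTop) (f := fun (N : ℕ) (n : ℤ) => if |n| ≤ N then 0 else windowWeight n)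
    (g := fun _ => (0 : ℝ)) summable_windowWeight (fun n => ?_) (Eventually.of_forall fun N n => ?_)
  · simpa using h
  · refine tendsto_const_nhds.congr' ?_
    filter_upwards [eventually_ge_atTop n.natAbs] with N hN
    rw [if_pos]
    rw [Int.abs_eq_natAbs]
    exact_mod_cast hN
  · split_ifs
    · simpa using windowWeight_nonneg n
    · exact (Real.norm_of_nonneg (windowWeight_nonneg n)).le

theorem ell_round_le (t : ℝ) : ell (round t) / (1 + |((round t : ℤ) : ℝ)|) ≤ 24 * (1 + |t|) ^ (-(3 / 4) : ℝ) := by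
  refine (ell_le_rpow _).trans ?_
  have hr := abs_sub_round t
  have h1 : |t| ≤ |((round t : ℤ) : ℝ)| + 1 / 2 := by
    have := abs_sub_abs_le_abs_sub t (round t)
    linarith
  have h2 : (2 * (1 + |((round t : ℤ) : ℝ)|)) ^ (-(3 / 4) : ℝ) ≤ (1 + |t|) ^ (-(3 / 4) : ℝ) :=
    Real.rpow_le_rpow_of_nonpos (by positivity) (by linarith [abs_nonneg ((round t : ℤ) : ℝ)]) (by norm_num)
  rw [Real.mul_rpow (by norm_num) (by positivity)] at h2
  have h3 : (1 / 2 : ℝ) ≤ 2 ^ (-(3 / 4) : ℝ) := by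
    calc (1 / 2 : ℝ) = 2 ^ (-1 : ℝ) := by rw [Real.rpow_neg_one]; norm_num
      _ ≤ 2 ^ (-(3 / 4) : ℝ) := Real.rpow_le_rpow_of_exponent_le (by norm_num) (by norm_num)
  have h4 : (0 : ℝ) ≤ (1 + |((round t : ℤ) : ℝ)|) ^ (-(3 / 4) : ℝ) := by positivity
  nlinarith [mul_le_mul_of_nonneg_right h3 h4]

theorem GoodL.mean_square_approx {L : ℂ → ℂ} (hL : GoodL L) {A : ℝ → ℂ} (hAm : Measurable A)
    (hAC : ∃ C : ℝ, ∀ u : ℝ, 0 < u → ‖A u‖ ≤ C * Real.exp u)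
    (hA : ∀ s : ℂ, s.re = 3 / 2 → ∫ u in Set.Ioi (0 : ℝ), A u * Complex.exp (-(s * u)) = -logDeriv L s / s)
    {ε : ℝ} (hε : 0 < ε) : ∃ P ∈ trigPoly, ∀ᶠ Y : ℝ in atTop,
      ∫ u in (0 : ℝ)..Y, ‖A u * (Real.exp (-(u / 2)) : ℝ) - P u‖ ^ 2 ≤ ε * Y := by
  obtain ⟨D, Z, hD, hZ, hs, happ⟩ := hL.approx
  obtain ⟨CA, hCA⟩ := hAC
  have htail : ∃ N : ℕ, 50 * Real.pi * D ^ 2 * ∑' n : ℤ, (if |n| ≤ N then 0 else windowWeight n) ≤ ε / 4 := by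
    have h := tendsto_tail_windowWeight.const_mul (50 * Real.pi * D ^ 2)
    rw [mul_zero] at h
    exact (h.eventually_le_const (by positivity)).exists
  obtain ⟨N, hN⟩ := htail
  obtain ⟨S, c, K, hK, hS, hb⟩ := happ N
  set m : ℂ → ℝ := fun ρ => (analyticOrderNatAt L ρ : ℝ) with hmdef
  have hm0 : ∀ ρ, 0 ≤ m ρ := fun ρ => Nat.cast_nonneg _
  set P : ℝ → ℂ := fun u => ∑ ρ ∈ S, c ρ * Complex.exp (Complex.I * ρ.im * u) with hP
  have hPt : P ∈ trigPoly := by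
    have : P = ∑ ρ ∈ S, c ρ • fun u : ℝ => Complex.exp (Complex.I * ρ.im * u) := by
      funext u
      simp [hP]
    rw [this]
    exact Submodule.sum_mem _ fun ρ _ => Submodule.smul_mem _ _ (exp_mem_trigPoly _)
  refine ⟨P, hPt, ?_⟩
  set F : ℝ → ℂ := fun u => A u * (Real.exp (-(u / 2)) : ℝ) with hF
  have hFm : Measurable F := hAm.mul (by fun_prop)
  set W : ℝ → ℂ := (Set.Ioi (0 : ℝ)).indicator fun u => F u - P u with hW
  set H : ℂ → ℂ := fun s => -logDeriv L (s + 1 / 2) / (s + 1 / 2) - ∑ ρ ∈ S, c ρ / (s + 1 / 2 - ρ) with hH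
  have hAi : ∀ t : ℝ, IntegrableOn (fun u : ℝ => F u * Complex.exp (-((1 + t * Complex.I) * u))) (Set.Ioi 0) := by
    intro t
    have h1 : IntegrableOn (fun u : ℝ => CA * Real.exp (-(1 / 2) * u)) (Set.Ioi 0) :=
      (integrableOn_exp_mul_Ioi (by norm_num) 0).const_mul _
    refine h1.mono' (hFm.mul (by fun_prop)).aestronglyMeasurable ?_
    refine (ae_restrict_mem measurableSet_Ioi).mono fun u hu => ?_
    rw [norm_mul, Complex.norm_exp, hF, norm_mul, Complex.norm_real, Real.norm_of_nonneg (Real.exp_pos _).le]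
    have : (-((1 + t * Complex.I) * u)).re = -u := by simp
    rw [this]
    calc ‖A u‖ * Real.exp (-(u / 2)) * Real.exp (-u) ≤ CA * Real.exp u * Real.exp (-(u / 2)) * Real.exp (-u) := by
          have := hCA u hu
          gcongr
      _ = CA * Real.exp (-(1 / 2) * u) := by
          rw [mul_assoc, mul_assoc, ← Real.exp_add, ← Real.exp_add]
          congr 2
          ring
  have hre : ∀ (t γ : ℝ), (-(1 + t * Complex.I) + Complex.I * γ : ℂ).re < 0 := by
    intro t γ
    simp
  have hPe : ∀ (t u : ℝ), P u * Complex.exp (-((1 + t * Complex.I) * u)) =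
      ∑ ρ ∈ S, c ρ * Complex.exp ((-(1 + t * Complex.I) + Complex.I * ρ.im) * u) := by
    intro t u
    rw [hP, Finset.sum_mul]
    refine Finset.sum_congr rfl fun ρ _ => ?_
    rw [mul_assoc, ← Complex.exp_add]
    congr 2
    ring
  have hPi : ∀ t : ℝ, IntegrableOn (fun u : ℝ => P u * Complex.exp (-((1 + t * Complex.I) * u))) (Set.Ioi 0) := by
    intro t
    simp_rw [hPe]
    exact integrable_finsetSum _ fun ρ _ => (integrableOn_exp_mul_complex_Ioi (hre t ρ.im) 0).const_mul _
  have hWe : ∀ t : ℝ, (fun u : ℝ => W u * Complex.exp (-((1 + t * Complex.I) * u))) =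
      (Set.Ioi (0 : ℝ)).indicator fun u => F u * Complex.exp (-((1 + t * Complex.I) * u))
        - P u * Complex.exp (-((1 + t * Complex.I) * u)) := by
    intro t
    funext u
    rw [hW]
    by_cases hu : u ∈ Set.Ioi (0 : ℝ)
    · simp only [Set.indicator_of_mem hu, sub_mul]
    · simp only [Set.indicator_of_notMem hu, zero_mul]
  have hWi : Integrable fun u : ℝ => W u * Complex.exp (-u) := by
    have := hWe 0
    simp only [Complex.ofReal_zero, zero_mul, add_zero, one_mul] at this
    rw [this, integrable_indicator_iff measurableSet_Ioi]
    have i1 := hAi 0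
    have i2 := hPi 0
    simp only [Complex.ofReal_zero, zero_mul, add_zero, one_mul] at i1 i2
    exact i1.sub i2
  have hH1 : ∀ t : ℝ, H (1 + t * Complex.I) = ∫ u, W u * Complex.exp (-(1 + t * Complex.I) * u) := by
    intro t
    simp_rw [neg_mul]
    rw [hWe t, integral_indicator measurableSet_Ioi, integral_sub (hAi t) (hPi t)]
    simp only [hH]
    refine congrArg₂ _ ?_ ?_
    · have h32 : (1 + t * Complex.I + 1 / 2 : ℂ).re = 3 / 2 := by simp; norm_num
      rw [← hA _ h32]
      refine setIntegral_congr_fun measurableSet_Ioi fun u _ => ?_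
      simp only [hF]
      rw [Complex.ofReal_exp, mul_assoc, ← Complex.exp_add]
      congr 2
      push_cast
      ring
    · simp_rw [hPe]
      rw [integral_finsetSum _ fun ρ _ => (integrableOn_exp_mul_complex_Ioi (hre t ρ.im) 0).const_mul _]
      refine Finset.sum_congr rfl fun ρ hρ => ?_
      rw [integral_const_mul, integral_exp_mul_complex_Ioi (hre t ρ.im)]
      have e : (1 + t * Complex.I + 1 / 2 - ρ : ℂ) = -(-(1 + t * Complex.I) + Complex.I * ρ.im) := by
        apply Complex.ext
        · simp [hS ρ hρ]
        · simp [sub_eq_add_neg, add_comm]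
      rw [e]
      simp only [Complex.ofReal_zero, mul_zero, Complex.exp_zero]
      rw [div_neg, mul_div_assoc', mul_neg, mul_one, neg_div]
  have hLne : ∀ s : ℂ, 0 < s.re → L (s + 1 / 2) ≠ 0 := by
    intro s hs h0
    have h1 : (s + 1 / 2).re = s.re + 1 / 2 := by simp
    have := hL.zeros (s + 1 / 2) (by rw [h1]; linarith) h0
    rw [h1] at this
    linarith
  have hHd : ∀ s : ℂ, 0 < s.re → DifferentiableAt ℂ H s := by
    intro s hs
    have h1 : (s + 1 / 2).re = s.re + 1 / 2 := by simp
    have hpos : 0 < (s + 1 / 2).re := by rw [h1]; linarith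
    have han := hL.analytic (s + 1 / 2) hpos
    have d1 : DifferentiableAt ℂ (logDeriv L) (s + 1 / 2) := by
      have : logDeriv L = fun z => deriv L z / L z := by funext z; rw [logDeriv_apply]
      rw [this]
      exact han.deriv.differentiableAt.div han.differentiableAt (hLne s hs)
    have d2 : DifferentiableAt ℂ (fun s : ℂ => s + 1 / 2) s := by fun_prop
    have d3 : DifferentiableAt ℂ (fun s : ℂ => logDeriv L (s + 1 / 2)) s := DifferentiableAt.comp s (g := logDeriv L) d1 d2
    refine (d3.neg.div d2 fun h0 => ?_).sub (DifferentiableAt.fun_sum fun ρ hρ => ?_)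
    · rw [h0] at hpos
      simp at hpos
    · refine (differentiableAt_const _).div (d2.sub_const _) fun h0 => ?_
      have := congrArg Complex.re h0
      rw [Complex.sub_re, h1, hS ρ hρ, Complex.zero_re] at this
      linarith
  set B : ℝ := 2 * K ^ 2 * ∑' n, windowWeight n with hB
  have hwrite : ∀ σ t : ℝ, ((σ : ℂ) + t * Complex.I + 1 / 2) = 1 / 2 + σ + t * Complex.I := fun σ t => by ring
  have hwre : ∀ σ t : ℝ, ((1 : ℂ) / 2 + σ + t * Complex.I).re = 1 / 2 + σ := fun σ t => by simp
  have hwim : ∀ σ t : ℝ, ((1 : ℂ) / 2 + σ + t * Complex.I).im = t := fun σ t => by simp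
  have hHb : ∀ σ t : ℝ, 0 < σ → σ ≤ 1 → ∀ n : ℤ, |t - n| ≤ 1 / 2 → ‖H (σ + t * Complex.I)‖ ≤ (if |n| ≤ N then 0 else
      5 / (1 + |(n : ℝ)|) * ∑ ρ ∈ Z n, m ρ / ‖(1 / 2 + σ + t * Complex.I) - ρ‖) + K * (ell n / (1 + |(n : ℝ)|)) := by
    intro σ t h1 h2 n hn
    simp only [hH]
    rw [hwrite]
    exact hb n _ (by rw [hwre]; linarith) (by rw [hwre]; linarith) (by rw [hwim]; exact hn)
  have main : ∀ Y : ℝ, 1 < Y → ∫ u in (0 : ℝ)..Y, ‖F u - P u‖ ^ 2 ≤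
      Real.exp 2 * ((2 * Real.pi)⁻¹ * (Y * (ε / 4) + B)) := by
    intro Y hY
    have hY0 : 0 < Y := by linarith
    set a : ℝ := 1 / Y with ha
    have ha0 : 0 < a := by positivity
    have ha1 : a < 1 := by rw [ha, div_lt_one hY0]; exact hY
    obtain ⟨hi, he⟩ := plancherel_shift (C := (5 * D / a + K) * 24) ha0 ha1 hWi hHd hH1 (by
      intro σ t h1 h2
      have hσ : 0 < σ := by linarith
      refine (hHb σ t hσ h2 (round t) (abs_sub_round t)).trans ?_
      have hl := one_le_ell (round t)
      set n := round t
      have hsum : ∑ ρ ∈ Z n, m ρ / ‖(1 / 2 + σ + t * Complex.I) - ρ‖ ≤ D * ell n / a := by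
        calc _ ≤ ∑ ρ ∈ Z n, m ρ / a := by
              refine Finset.sum_le_sum fun ρ hρ => div_le_div_of_nonneg_left (hm0 ρ) ha0 ?_
              have := (le_abs_self _).trans (Complex.abs_re_le_norm ((1 / 2 + σ + t * Complex.I) - ρ))
              rw [Complex.sub_re, hwre, hZ n ρ hρ] at this
              linarith
          _ = (∑ ρ ∈ Z n, m ρ) / a := by rw [Finset.sum_div]
          _ ≤ _ := by
              have := hs n
              gcongr
      have hif : (if |n| ≤ N then 0 else
          5 / (1 + |(n : ℝ)|) * ∑ ρ ∈ Z n, m ρ / ‖(1 / 2 + σ + t * Complex.I) - ρ‖) ≤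
          5 / (1 + |(n : ℝ)|) * (D * ell n / a) := by
        split_ifs
        · positivity
        · gcongr
      calc _ ≤ 5 / (1 + |(n : ℝ)|) * (D * ell n / a) + K * (ell n / (1 + |(n : ℝ)|)) := by gcongr
        _ = (5 * D / a + K) * (ell n / (1 + |(n : ℝ)|)) := by ring
        _ ≤ (5 * D / a + K) * (24 * (1 + |t|) ^ (-(3 / 4) : ℝ)) := by
            have := ell_round_le t
            gcongr
        _ = _ := by ring)
    have hv := vertical_mean_square_le (H := fun t => H (a + t * Complex.I)) (Z := Z) (m := m) (K := K) (N := N) ha0 hD hm0 hZ hs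
      (fun n t hn => hHb a t ha0 ha1.le n hn)
    have hv2 : ∫ t : ℝ, ‖H (a + t * Complex.I)‖ ^ 2 ≤ Y * (ε / 4) + B := by
      have e : ∫ t : ℝ, ‖H (a + t * Complex.I)‖ ^ 2 = Y * (a * ∫ t : ℝ, ‖H (a + t * Complex.I)‖ ^ 2) := by
        rw [← mul_assoc, ha, mul_one_div_cancel hY0.ne', one_mul]
      rw [e]
      calc Y * (a * ∫ t : ℝ, ‖H (a + t * Complex.I)‖ ^ 2) ≤ Y * (ε / 4 + a * B) := by gcongr; linarith
        _ = _ := by rw [ha]; field_simp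
    rw [intervalIntegral.integral_of_le hY0.le]
    calc ∫ u in Set.Ioc 0 Y, ‖F u - P u‖ ^ 2
        ≤ ∫ u in Set.Ioc 0 Y, Real.exp 2 * (‖W u‖ ^ 2 * Real.exp (-(2 * a * u))) := by
          refine integral_mono_of_nonneg (Eventually.of_forall fun u => by positivity) (hi.const_mul _).integrableOn ?_
          refine (ae_restrict_mem measurableSet_Ioc).mono fun u hu => ?_
          have hWu : W u = F u - P u := by rw [hW, Set.indicator_of_mem (Set.mem_Ioi.2 hu.1)]
          simp only
          rw [hWu]
          have h1 : 1 ≤ Real.exp 2 * Real.exp (-(2 * a * u)) := by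
            rw [← Real.exp_add]
            apply Real.one_le_exp
            have : a * u ≤ 1 := by
              rw [ha, div_mul_eq_mul_div, one_mul, div_le_one hY0]
              exact hu.2
            linarith
          calc ‖F u - P u‖ ^ 2 = 1 * ‖F u - P u‖ ^ 2 := (one_mul _).symm
            _ ≤ (Real.exp 2 * Real.exp (-(2 * a * u))) * ‖F u - P u‖ ^ 2 := by gcongr
            _ = _ := by ring
      _ ≤ ∫ u, Real.exp 2 * (‖W u‖ ^ 2 * Real.exp (-(2 * a * u))) :=
          setIntegral_le_integral (hi.const_mul _) (Eventually.of_forall fun u => by positivity)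
      _ = Real.exp 2 * ((2 * Real.pi)⁻¹ * ∫ t : ℝ, ‖H (a + t * Complex.I)‖ ^ 2) := by rw [integral_const_mul, he]
      _ ≤ _ := by gcongr
  filter_upwards [eventually_gt_atTop 1, eventually_ge_atTop (4 * B / ε)] with Y hY1 hYB
  refine (main Y hY1).trans ?_
  have hB2 : B ≤ Y * (ε / 4) := by
    rw [div_le_iff₀ hε] at hYB
    linarith
  have he2 : Real.exp 2 * (2 * Real.pi)⁻¹ ≤ 2 := by
    rw [mul_inv_le_iff₀ (by positivity)]
    have h1 : Real.exp 2 = Real.exp 1 * Real.exp 1 := by rw [← Real.exp_add]; norm_num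
    have h2 := Real.exp_one_lt_d9
    have h3 := Real.pi_gt_three
    have h4 := Real.exp_pos 1
    nlinarith
  have hnn : 0 ≤ Y * (ε / 4) := by positivity
  calc Real.exp 2 * ((2 * Real.pi)⁻¹ * (Y * (ε / 4) + B)) ≤ Real.exp 2 * ((2 * Real.pi)⁻¹ * (Y * (ε / 4) + Y * (ε / 4))) := by
        gcongr
    _ = (Real.exp 2 * (2 * Real.pi)⁻¹) * (Y * (ε / 2)) := by ring
    _ ≤ 2 * (Y * (ε / 2)) := by gcongr
    _ = ε * Y := by ring

/-! ### Growth of Dirichlet `L`-functions -/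

noncomputable def summatoryRem (f : ℕ → ℂ) (κ : ℂ) (t : ℝ) : ℂ := ∑ k ∈ Finset.Icc 1 ⌊t⌋₊, f k - κ * t

theorem measurable_summatory (f : ℕ → ℂ) : Measurable fun t : ℝ => ∑ k ∈ Finset.Icc 1 ⌊t⌋₊, f k :=
  (measurable_from_top (f := fun n : ℕ => ∑ k ∈ Finset.Icc 1 n, f k)).comp Nat.measurable_floor

theorem measurable_summatoryRem (f : ℕ → ℂ) (κ : ℂ) : Measurable (summatoryRem f κ) :=
  (measurable_summatory f).sub (by fun_prop)

noncomputable def remTransform (f : ℕ → ℂ) (κ : ℂ) (s : ℂ) : ℂ :=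
  ∫ t : ℝ in Set.Ioi 1, summatoryRem f κ t * (t : ℂ) ^ (-(s + 1))

theorem norm_rem_mul_cpow_le {f : ℕ → ℂ} {κ : ℂ} {C : ℝ} (hC : ∀ t : ℝ, 1 ≤ t → ‖summatoryRem f κ t‖ ≤ C) (s : ℂ)
    {t : ℝ} (ht : 1 < t) : ‖summatoryRem f κ t * (t : ℂ) ^ (-(s + 1))‖ ≤ C * t ^ (-s.re - 1) := by
  rw [norm_mul, Complex.norm_cpow_eq_rpow_re_of_pos (by linarith)]
  have e : (-(s + 1)).re = -s.re - 1 := by simp; ring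
  rw [e]
  exact mul_le_mul_of_nonneg_right (hC t ht.le) (by positivity)

theorem integrableOn_rem_mul_cpow {f : ℕ → ℂ} {κ : ℂ} {C : ℝ} (hC : ∀ t : ℝ, 1 ≤ t → ‖summatoryRem f κ t‖ ≤ C)
    {s : ℂ} (hs : 0 < s.re) : IntegrableOn (fun t : ℝ => summatoryRem f κ t * (t : ℂ) ^ (-(s + 1))) (Set.Ioi 1) := by
  refine ((integrableOn_Ioi_rpow_of_lt (a := -s.re - 1) (by linarith) one_pos).const_mul C).mono' ?_ ?_
  · exact ((measurable_summatoryRem f κ).mul (by fun_prop)).aestronglyMeasurable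
  · exact (ae_restrict_mem measurableSet_Ioi).mono fun t ht => norm_rem_mul_cpow_le hC s ht

theorem norm_remTransform_le {f : ℕ → ℂ} {κ : ℂ} {C : ℝ} (hC : ∀ t : ℝ, 1 ≤ t → ‖summatoryRem f κ t‖ ≤ C)
    {s : ℂ} (hs : 0 < s.re) : ‖remTransform f κ s‖ ≤ C / s.re := by
  refine (norm_integral_le_of_norm_le ((integrableOn_Ioi_rpow_of_lt (a := -s.re - 1) (by linarith) one_pos).const_mul C)
    ((ae_restrict_mem measurableSet_Ioi).mono fun t ht => norm_rem_mul_cpow_le hC s ht)).trans (le_of_eq ?_)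
  rw [integral_const_mul, integral_Ioi_rpow_of_lt (by linarith) one_pos, Real.one_rpow]
  have : -s.re - 1 + 1 = -s.re := by ring
  rw [this, neg_div_neg_eq, mul_one_div]

theorem differentiableAt_remTransform {f : ℕ → ℂ} {κ : ℂ} {C : ℝ} (hC : ∀ t : ℝ, 1 ≤ t → ‖summatoryRem f κ t‖ ≤ C)
    {s : ℂ} (hs : 0 < s.re) : DifferentiableAt ℂ (remTransform f κ) s := by
  set g : ℝ → ℂ := (Set.Ioi (1 : ℝ)).indicator (summatoryRem f κ) with hg
  have hgb : ∀ t, ‖g t‖ ≤ |C| := by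
    intro t
    rw [hg]
    by_cases ht : t ∈ Set.Ioi (1 : ℝ)
    · rw [Set.indicator_of_mem ht]
      exact (hC t (le_of_lt ht)).trans (le_abs_self C)
    · rw [Set.indicator_of_notMem ht]
      simp
  have hgm : Measurable g := (measurable_summatoryRem f κ).indicator measurableSet_Ioi
  have e : remTransform f κ = fun s => mellin g (-s) := by
    funext s
    rw [mellin, remTransform]
    have h1 : ∀ t : ℝ, (t : ℂ) ^ (-s - 1) • g t = (Set.Ioi (1 : ℝ)).indicator
        (fun t : ℝ => summatoryRem f κ t * (t : ℂ) ^ (-(s + 1))) t := by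
      intro t
      rw [hg]
      by_cases ht : t ∈ Set.Ioi (1 : ℝ)
      · rw [Set.indicator_of_mem ht, Set.indicator_of_mem ht, smul_eq_mul, mul_comm]
        congr 2
        ring
      · rw [Set.indicator_of_notMem ht, Set.indicator_of_notMem ht, smul_zero]
    simp_rw [h1]
    rw [setIntegral_indicator measurableSet_Ioi]
    congr 2
    ext t
    simp only [Set.mem_inter_iff, Set.mem_Ioi]
    constructor
    · intro h
      exact ⟨by linarith, h⟩
    · exact fun h => h.2
  rw [e]
  refine DifferentiableAt.comp s (g := mellin g) ?_ (differentiableAt_id.neg)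
  refine mellin_differentiableAt_of_isBigO_rpow (a := 0) (b := -s.re - 1) ?_ ?_ (by simpa using hs) ?_ (by simp)
  · refine LocallyIntegrable.locallyIntegrableOn ?_ _
    refine (locallyIntegrable_const |C|).mono hgm.aestronglyMeasurable (Eventually.of_forall fun t => ?_)
    simpa using hgb t
  · refine IsBigO.of_bound |C| (Eventually.of_forall fun t => ?_)
    simpa using hgb t
  · refine IsBigO.of_bound 0 ?_
    filter_upwards [nhdsWithin_le_nhds (Iio_mem_nhds (zero_lt_one' ℝ))] with t ht
    rw [hg, Set.indicator_of_notMem (by simpa using le_of_lt ht)]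
    simp

theorem LSeries_eq_remTransform {f : ℕ → ℂ} {κ : ℂ} {C : ℝ} (hC : ∀ t : ℝ, 1 ≤ t → ‖summatoryRem f κ t‖ ≤ C)
    {s : ℂ} (hs : 1 < s.re) (hsum : LSeriesSummable f s) :
    LSeries f s = s * (κ / (s - 1) + remTransform f κ s) := by
  have hO : (fun n : ℕ => ∑ k ∈ Finset.Icc 1 n, f k) =O[atTop] fun n : ℕ => (n : ℝ) ^ (1 : ℝ) := by
    refine IsBigO.of_bound (C + ‖κ‖) ?_
    filter_upwards [eventually_ge_atTop 1] with n hn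
    have hn' : (1 : ℝ) ≤ n := by exact_mod_cast hn
    have h := hC n hn'
    rw [summatoryRem, Nat.floor_natCast] at h
    have hC0 : 0 ≤ C := (norm_nonneg _).trans h
    rw [Real.rpow_one, Real.norm_of_nonneg (by positivity)]
    have h2 : ‖κ * ((n : ℝ) : ℂ)‖ = ‖κ‖ * n := by simp
    calc ‖∑ k ∈ Finset.Icc 1 n, f k‖ ≤ C + ‖κ‖ * n := by
          rw [← h2]
          exact (norm_le_norm_sub_add _ (κ * ((n : ℝ) : ℂ))).trans (by linarith)
      _ ≤ (C + ‖κ‖) * n := by nlinarith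
  rw [LSeries_eq_mul_integral f zero_le_one hs hsum hO]
  congr 1
  have hre : (-s).re < -1 := by simpa using hs
  have hi1 : IntegrableOn (fun t : ℝ => κ * (t : ℂ) ^ (-s)) (Set.Ioi 1) :=
    (integrableOn_Ioi_cpow_of_lt hre one_pos).const_mul κ
  have hs1 : s - 1 ≠ 0 := by
    intro h
    rw [sub_eq_zero] at h
    rw [h] at hs
    simp at hs
  have hv : ∫ t : ℝ in Set.Ioi 1, κ * (t : ℂ) ^ (-s) = κ / (s - 1) := by
    rw [integral_const_mul, integral_Ioi_cpow_of_lt hre one_pos]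
    simp only [Complex.ofReal_one, Complex.one_cpow]
    have : -s + 1 = -(s - 1) := by ring
    rw [this, neg_div_neg_eq, mul_one_div]
  rw [← hv, remTransform, ← integral_add hi1 (integrableOn_rem_mul_cpow hC (by linarith))]
  refine setIntegral_congr_fun measurableSet_Ioi fun t ht => ?_
  have ht0 : (t : ℂ) ≠ 0 := by
    rw [Complex.ofReal_ne_zero]
    exact (zero_lt_one.trans ht).ne'
  have : (t : ℂ) ^ (-s) = t * (t : ℂ) ^ (-(s + 1)) := by
    have e : -s = 1 + -(s + 1) := by ring
    nth_rewrite 1 [e]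
    rw [Complex.cpow_add _ _ ht0, Complex.cpow_one]
  simp only [summatoryRem]
  rw [this]
  ring

theorem sum_Icc_character_bounded {N : ℕ} [NeZero N] {χ : DirichletCharacter ℂ N} (hχ : χ ≠ 1) :
    ∃ C : ℝ, ∀ n : ℕ, ‖∑ k ∈ Finset.Icc 1 n, χ (k : ZMod N)‖ ≤ C := by
  set S : ℕ → ℂ := fun n => ∑ k ∈ Finset.range n, χ (k : ZMod N) with hS
  have hN : 0 < N := Nat.pos_of_ne_zero (NeZero.ne N)
  have h0 : ∑ k ∈ Finset.range N, χ (k : ZMod N) = 0 := by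
    rw [← MulChar.sum_eq_zero_of_ne_one hχ]
    refine Finset.sum_nbij' (fun k => (k : ZMod N)) ZMod.val (by simp) (fun a _ => by simp [ZMod.val_lt])
      (fun k hk => ZMod.val_cast_of_lt (Finset.mem_range.1 hk)) (fun a _ => ZMod.natCast_zmod_val a) (fun _ _ => rfl)
  have hper : ∀ n, S (n + N) = S n := by
    intro n
    induction n with
    | zero => simp only [hS, zero_add, h0, Finset.range_zero, Finset.sum_empty]
    | succ n ih =>
      have e : n + 1 + N = (n + N) + 1 := by ring
      simp only [hS] at ih ⊢
      rw [e, Finset.sum_range_succ, ih, Finset.sum_range_succ]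
      simp
  have hSb : ∀ n, ‖S n‖ ≤ N := by
    intro n
    have hp : Function.Periodic S N := hper
    rw [← hp.map_mod_nat n]
    refine (norm_sum_le _ _).trans ?_
    calc ∑ k ∈ Finset.range (n % N), ‖χ (k : ZMod N)‖ ≤ ∑ k ∈ Finset.range (n % N), (1 : ℝ) :=
          Finset.sum_le_sum fun k _ => DirichletCharacter.norm_le_one χ _
      _ = ((n % N : ℕ) : ℝ) := by simp
      _ ≤ N := by exact_mod_cast (Nat.mod_lt n hN).le
  refine ⟨N + 1, fun n => ?_⟩
  have e : ∑ k ∈ Finset.Icc 1 n, χ (k : ZMod N) = S (n + 1) - χ ((0 : ℕ) : ZMod N) := by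
    simp only [hS]
    rw [Finset.range_eq_Ico, Finset.sum_eq_sum_Ico_succ_bot (Nat.succ_pos n), add_sub_cancel_left]
    rfl
  rw [e]
  exact (norm_sub_le _ _).trans (add_le_add (hSb _) (DirichletCharacter.norm_le_one χ _))

theorem pi_sq_div_six_lt_two : Real.pi ^ 2 / 6 < 2 := by
  have h1 := Real.pi_lt_d2
  have h2 := Real.pi_pos
  nlinarith

theorem norm_LSeries_ge {f : ℕ → ℂ} (h1 : f 1 = 1) (hf : ∀ n, ‖f n‖ ≤ 1) {s : ℂ} (hs : s.re = 2) :
    2 - Real.pi ^ 2 / 6 ≤ ‖LSeries f s‖ := by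
  have hsum : Summable (LSeries.term f s) :=
    LSeriesSummable_of_bounded_of_one_lt_re (m := 1) (fun n _ => hf n) (by rw [hs]; norm_num)
  have hone : HasSum (fun n : ℕ => if n = 1 then (1 : ℂ) else 0) 1 := hasSum_ite_eq 1 1
  have honeR : HasSum (fun n : ℕ => if n = 1 then (1 : ℝ) else 0) 1 := hasSum_ite_eq 1 1
  have hb : ‖∑' n, (LSeries.term f s n - if n = 1 then (1 : ℂ) else 0)‖ ≤ Real.pi ^ 2 / 6 - 1 := by
    refine tsum_of_norm_bounded (hasSum_zeta_two.sub honeR) fun n => ?_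
    rcases eq_or_ne n 1 with rfl | hn
    · rw [LSeries.term_of_ne_zero one_ne_zero, h1]
      simp
    · simp only [hn, if_false, sub_zero]
      rw [LSeries.norm_term_eq, hs]
      rcases eq_or_ne n 0 with rfl | hn0
      · simp
      · rw [if_neg hn0]
        have : (n : ℝ) ^ (2 : ℝ) = (n : ℝ) ^ 2 := Real.rpow_natCast _ 2
        rw [this]
        exact div_le_div_of_nonneg_right (hf n) (by positivity)
  rw [hsum.tsum_sub hone.summable, hone.tsum_eq] at hb
  have h3 : ‖(1 : ℂ)‖ ≤ ‖LSeries f s‖ + ‖LSeries f s - 1‖ := by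
    have := norm_sub_le (LSeries f s) (LSeries f s - 1)
    simpa using this
  rw [norm_one] at h3
  have h4 : ‖LSeries f s - 1‖ ≤ Real.pi ^ 2 / 6 - 1 := hb
  linarith

theorem norm_le_of_re_le_four {s : ℂ} (h0 : 0 ≤ s.re) (h : s.re ≤ 4) : ‖s‖ ≤ 4 * (1 + |s.im|) := by
  have := Complex.norm_le_abs_re_add_abs_im s
  rw [abs_of_nonneg h0] at this
  linarith [abs_nonneg s.im]

/-- The Riemann hypothesis for all primitive Dirichlet characters. -/
def PrimitiveRH : Prop :=
  ∀ (N : ℕ) [NeZero N] (χ : DirichletCharacter ℂ N), χ.IsPrimitive →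
    ∀ s : ℂ, 0 < s.re → s.re < 1 → DirichletCharacter.LFunction χ s = 0 → s.re = 1 / 2

theorem PrimitiveRH.re_eq_half (hG : PrimitiveRH) {N : ℕ} [NeZero N] {χ : DirichletCharacter ℂ N} {s : ℂ}
    (h1 : χ ≠ 1 ∨ s ≠ 1) (hs : 0 < s.re) (h0 : DirichletCharacter.LFunction χ s = 0) : s.re = 1 / 2 := by
  rcases le_or_gt 1 s.re with h | h
  · exact absurd h0 (DirichletCharacter.LFunction_ne_zero_of_one_le_re χ h1 h)
  have hs1 : s ≠ 1 := by
    rintro rfl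
    simp at h
  have : NeZero χ.conductor := ⟨χ.conductor_ne_zero⟩
  rw [← χ.changeLevel_primitiveCharacter, DirichletCharacter.LFunction_changeLevel _ _ (Or.inr hs1), mul_eq_zero] at h0
  rcases h0 with h0 | h0
  · exact hG _ _ χ.primitiveCharacter_isPrimitive s hs h h0
  · exfalso
    obtain ⟨p, hp, hp0⟩ := Finset.prod_eq_zero_iff.1 h0
    have hpp := Nat.prime_of_mem_primeFactors hp
    rw [sub_eq_zero] at hp0
    have h2 := congrArg norm hp0
    rw [norm_one, norm_mul, Complex.norm_natCast_cpow_of_pos hpp.pos] at h2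
    have h3 : (p : ℝ) ^ (-s).re < 1 := Real.rpow_lt_one_of_one_lt_of_neg (by exact_mod_cast hpp.one_lt) (by simpa using hs)
    have h4 := DirichletCharacter.norm_le_one χ.primitiveCharacter (p : ZMod χ.conductor)
    have h5 : (0 : ℝ) ≤ (p : ℝ) ^ (-s).re := by positivity
    nlinarith

theorem goodL_LFunction (hG : PrimitiveRH) {N : ℕ} [NeZero N] {χ : DirichletCharacter ℂ N} (hχ : χ ≠ 1) :
    GoodL (DirichletCharacter.LFunction χ) where
  analytic := fun s _ => (DirichletCharacter.differentiable_LFunction hχ).analyticAt s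
  growth := by
    obtain ⟨C, hC⟩ := sum_Icc_character_bounded hχ
    have hC' : ∀ t : ℝ, 1 ≤ t → ‖summatoryRem (fun n => χ (n : ZMod N)) 0 t‖ ≤ C := by
      intro t _
      rw [summatoryRem, zero_mul, sub_zero]
      exact hC _
    have heq : Set.EqOn (DirichletCharacter.LFunction χ) (fun s => s * remTransform (fun n => χ (n : ZMod N)) 0 s)
        {s : ℂ | 0 < s.re} := by
      refine AnalyticOnNhd.eqOn_of_preconnected_of_eventuallyEq
        (fun s _ => (DirichletCharacter.differentiable_LFunction hχ).analyticAt s) ?_ isPreconnected_re_pos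
        (z₀ := 2) (by simp) ?_
      · refine DifferentiableOn.analyticOnNhd (fun s hs => ?_) isOpen_re_pos
        exact (differentiableAt_id.mul (differentiableAt_remTransform hC' hs)).differentiableWithinAt
      · have : ∀ᶠ s : ℂ in 𝓝 2, 1 < s.re :=
          Complex.continuous_re.continuousAt.eventually (lt_mem_nhds (by norm_num))
        filter_upwards [this] with s hs
        rw [DirichletCharacter.LFunction_eq_LSeries χ hs,
          LSeries_eq_remTransform hC' hs (χ.LSeriesSummable_of_one_lt_re hs), zero_div, zero_add]
    have hC0 : 0 ≤ C := (norm_nonneg _).trans (hC 0)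
    refine ⟨40 * C, 1, fun s h1 h2 => ?_⟩
    have hs0 : 0 < s.re := by linarith
    rw [heq hs0, norm_mul, pow_one]
    have h3 : ‖remTransform (fun n => χ (n : ZMod N)) 0 s‖ ≤ 10 * C := by
      refine (norm_remTransform_le hC' hs0).trans ?_
      rw [div_le_iff₀ hs0]
      nlinarith
    calc _ ≤ (4 * (1 + |s.im|)) * (10 * C) :=
          mul_le_mul (norm_le_of_re_le_four hs0.le h2) h3 (norm_nonneg _) (by positivity)
      _ = _ := by ring
  lower := by
    refine ⟨2 - Real.pi ^ 2 / 6, by linarith [pi_sq_div_six_lt_two], fun s hs => ?_⟩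
    rw [DirichletCharacter.LFunction_eq_LSeries χ (by rw [hs]; norm_num)]
    exact norm_LSeries_ge (by simp) (fun n => DirichletCharacter.norm_le_one χ _) hs
  zeros := fun s hs h0 => hG.re_eq_half (Or.inl hχ) hs h0

theorem norm_floor_rem_le {t : ℝ} (ht : 1 ≤ t) : ‖summatoryRem 1 1 t‖ ≤ 1 := by
  rw [summatoryRem]
  simp only [Pi.one_apply, Finset.sum_const, Nat.card_Icc, nsmul_eq_mul, mul_one, one_mul, Nat.add_sub_cancel]
  rw [← Complex.ofReal_natCast, ← Complex.ofReal_sub, Complex.norm_real, Real.norm_eq_abs, abs_le]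
  have h1 := Nat.floor_le (by linarith : 0 ≤ t)
  have h2 := Nat.lt_floor_add_one t
  constructor <;> linarith

theorem LFunctionTrivChar₁_one_of_ne {s : ℂ} (hs : s ≠ 1) :
    DirichletCharacter.LFunctionTrivChar₁ 1 s = (s - 1) * riemannZeta s := by
  rw [DirichletCharacter.LFunctionTrivChar₁, Function.update_of_ne hs, DirichletCharacter.LFunctionTrivChar,
    DirichletCharacter.LFunction_modOne_eq]

theorem goodL_zeta (hG : PrimitiveRH) : GoodL (DirichletCharacter.LFunctionTrivChar₁ 1) where
  analytic := fun s _ => (DirichletCharacter.differentiable_LFunctionTrivChar₁ 1).analyticAt s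
  growth := by
    have hC' : ∀ t : ℝ, 1 ≤ t → ‖summatoryRem 1 1 t‖ ≤ 1 := fun t => norm_floor_rem_le
    have heq : Set.EqOn (DirichletCharacter.LFunctionTrivChar₁ 1) (fun s => s * (1 + (s - 1) * remTransform 1 1 s))
        {s : ℂ | 0 < s.re} := by
      refine AnalyticOnNhd.eqOn_of_preconnected_of_eventuallyEq
        (fun s _ => (DirichletCharacter.differentiable_LFunctionTrivChar₁ 1).analyticAt s) ?_ isPreconnected_re_pos
        (z₀ := 2) (by simp) ?_
      · refine DifferentiableOn.analyticOnNhd (fun s hs => ?_) isOpen_re_pos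
        have := differentiableAt_remTransform hC' hs
        exact DifferentiableAt.differentiableWithinAt (by fun_prop)
      · have : ∀ᶠ s : ℂ in 𝓝 2, 1 < s.re :=
          Complex.continuous_re.continuousAt.eventually (lt_mem_nhds (by norm_num))
        filter_upwards [this] with s hs
        have hs1 : s ≠ 1 := by
          rintro rfl
          simp at hs
        have hs1' : s - 1 ≠ 0 := sub_ne_zero.2 hs1
        rw [LFunctionTrivChar₁_one_of_ne hs1, ← LSeries_one_eq_riemannZeta hs,
          LSeries_eq_remTransform hC' hs (LSeriesSummable_of_bounded_of_one_lt_re (m := 1) (by simp) hs)]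
        field_simp
    refine ⟨4 * 51, 2, fun s h1 h2 => ?_⟩
    have hs0 : 0 < s.re := by linarith
    rw [heq hs0, norm_mul]
    have h3 : ‖remTransform 1 1 s‖ ≤ 10 := by
      refine (norm_remTransform_le hC' hs0).trans ?_
      rw [div_le_iff₀ hs0]
      linarith
    have h4 := norm_le_of_re_le_four hs0.le h2
    have him := abs_nonneg s.im
    have h5 : ‖1 + (s - 1) * remTransform 1 1 s‖ ≤ 51 * (1 + |s.im|) := by
      calc ‖1 + (s - 1) * remTransform 1 1 s‖ ≤ 1 + (‖s‖ + 1) * 10 := by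
            refine (norm_add_le _ _).trans ?_
            rw [norm_one, norm_mul]
            gcongr
            exact (norm_sub_le _ _).trans (by rw [norm_one])
        _ ≤ _ := by linarith
    calc _ ≤ (4 * (1 + |s.im|)) * (51 * (1 + |s.im|)) := mul_le_mul h4 h5 (norm_nonneg _) (by positivity)
      _ = _ := by ring
  lower := by
    refine ⟨2 - Real.pi ^ 2 / 6, by linarith [pi_sq_div_six_lt_two], fun s hs => ?_⟩
    have hs1 : s ≠ 1 := by
      rintro rfl
      norm_num at hs
    rw [LFunctionTrivChar₁_one_of_ne hs1, ← LSeries_one_eq_riemannZeta (by rw [hs]; norm_num), norm_mul]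
    have h1 : 1 ≤ ‖s - 1‖ := by
      have := (le_abs_self _).trans (Complex.abs_re_le_norm (s - 1))
      rw [Complex.sub_re, hs, Complex.one_re] at this
      linarith
    have h2 := norm_LSeries_ge (f := 1) rfl (by simp) hs
    exact h2.trans (le_mul_of_one_le_left (norm_nonneg _) h1)
  zeros := fun s hs h0 => by
    rcases eq_or_ne s 1 with rfl | hs1
    · exact absurd h0 (DirichletCharacter.LFunctionTrivChar₁_apply_one_ne_zero 1)
    · rw [LFunctionTrivChar₁_one_of_ne hs1, mul_eq_zero] at h0
      refine hG.re_eq_half (χ := (1 : DirichletCharacter ℂ 1)) (Or.inr hs1) hs ?_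
      rw [DirichletCharacter.LFunction_modOne_eq]
      exact h0.resolve_left (sub_ne_zero.2 hs1)

/-! ### Mean squares of Chebyshev functions -/

theorem laplace_summatory {f : ℕ → ℂ} {C : ℝ} (hC : ∀ n : ℕ, ‖∑ k ∈ Finset.Icc 1 n, f k‖ ≤ C * n) {s : ℂ}
    (hs : 1 < s.re) (hsum : LSeriesSummable f s) :
    ∫ u in Set.Ioi (0 : ℝ), (∑ k ∈ Finset.Icc 1 ⌊Real.exp u⌋₊, f k) * Complex.exp (-(s * u)) = LSeries f s / s := by
  have hO : (fun n : ℕ => ∑ k ∈ Finset.Icc 1 n, f k) =O[atTop] fun n : ℕ => (n : ℝ) ^ (1 : ℝ) := by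
    refine IsBigO.of_bound C (Eventually.of_forall fun n => ?_)
    rw [Real.rpow_one, Real.norm_of_nonneg (by positivity)]
    exact hC n
  have hs0 : s ≠ 0 := by
    rintro rfl
    simp at hs
    linarith
  rw [LSeries_eq_mul_integral f zero_le_one hs hsum hO, mul_div_cancel_left₀ _ hs0]
  have himg : Real.exp '' Set.Ioi 0 = Set.Ioi 1 := by
    ext t
    simp only [Set.mem_image, Set.mem_Ioi]
    constructor
    · rintro ⟨u, hu, rfl⟩
      exact Real.one_lt_exp_iff.2 hu
    · intro ht
      exact ⟨Real.log t, Real.log_pos ht, Real.exp_log (by linarith)⟩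
  rw [← himg, integral_image_eq_integral_abs_deriv_smul measurableSet_Ioi
    (fun x _ => (Real.hasDerivAt_exp x).hasDerivWithinAt) Real.exp_injective.injOn]
  refine setIntegral_congr_fun measurableSet_Ioi fun u _ => ?_
  simp only [abs_of_pos (Real.exp_pos u), Complex.real_smul]
  rw [mul_left_comm]
  congr 1
  rw [Complex.cpow_def_of_ne_zero (by simp [Complex.exp_ne_zero]), ← Complex.ofReal_log (Real.exp_pos u).le,
    Real.log_exp, Complex.ofReal_exp, ← Complex.exp_add]
  congr 1
  ring

theorem integrableOn_mul_exp {A : ℝ → ℂ} (hAm : Measurable A) {C : ℝ}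
    (hC : ∀ u, 0 < u → ‖A u‖ ≤ C * Real.exp u) {s : ℂ} (hs : s.re = 3 / 2) :
    IntegrableOn (fun u : ℝ => A u * Complex.exp (-(s * u))) (Set.Ioi 0) := by
  refine Integrable.mono' ((integrableOn_exp_mul_Ioi (a := -(1 / 2)) (by norm_num) 0).const_mul C)
    (hAm.mul (by fun_prop)).aestronglyMeasurable ((ae_restrict_mem measurableSet_Ioi).mono fun u hu => ?_)
  rw [norm_mul, Complex.norm_exp]
  have : (-(s * (u : ℂ))).re = -(3 / 2) * u := by simp [hs]
  rw [this]
  refine (mul_le_mul_of_nonneg_right (hC u hu) (Real.exp_pos _).le).trans (le_of_eq ?_)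
  rw [mul_assoc, ← Real.exp_add]
  congr 2
  ring

noncomputable def chebyshevTwist {N : ℕ} (χ : DirichletCharacter ℂ N) (t : ℝ) : ℂ :=
  ∑ k ∈ Finset.Icc 1 ⌊t⌋₊, χ (k : ZMod N) * (ArithmeticFunction.vonMangoldt k : ℂ)

theorem measurable_chebyshevTwist {N : ℕ} (χ : DirichletCharacter ℂ N) : Measurable (chebyshevTwist χ) :=
  measurable_summatory fun k => χ (k : ZMod N) * (ArithmeticFunction.vonMangoldt k : ℂ)

theorem norm_sum_twist_vonMangoldt_le {N : ℕ} (χ : DirichletCharacter ℂ N) (n : ℕ) :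
    ‖∑ k ∈ Finset.Icc 1 n, χ (k : ZMod N) * (ArithmeticFunction.vonMangoldt k : ℂ)‖ ≤ (Real.log 4 + 4) * n := by
  have h := Chebyshev.psi_le_const_mul_self (x := n) (by positivity)
  rw [Chebyshev.psi, Nat.floor_natCast] at h
  refine (norm_sum_le _ _).trans (le_trans (le_of_eq_of_le rfl (Finset.sum_le_sum fun k _ => ?_)) h)
  rw [norm_mul, Complex.norm_real, Real.norm_of_nonneg ArithmeticFunction.vonMangoldt_nonneg]
  exact mul_le_of_le_one_left ArithmeticFunction.vonMangoldt_nonneg (χ.norm_le_one _)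

theorem norm_chebyshevTwist_le {N : ℕ} (χ : DirichletCharacter ℂ N) {t : ℝ} (ht : 0 ≤ t) :
    ‖chebyshevTwist χ t‖ ≤ (Real.log 4 + 4) * t := by
  have : 0 ≤ Real.log 4 := Real.log_nonneg (by norm_num)
  exact (norm_sum_twist_vonMangoldt_le χ _).trans
    (mul_le_mul_of_nonneg_left (Nat.floor_le ht) (by positivity))

theorem laplace_chebyshevTwist {N : ℕ} [NeZero N] (χ : DirichletCharacter ℂ N) {s : ℂ} (hs : 1 < s.re) :
    ∫ u in Set.Ioi (0 : ℝ), chebyshevTwist χ (Real.exp u) * Complex.exp (-(s * u)) =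
      -logDeriv (DirichletCharacter.LFunction χ) s / s := by
  have h := laplace_summatory (norm_sum_twist_vonMangoldt_le χ) hs (χ.LSeriesSummable_twist_vonMangoldt hs)
  have h2 := χ.LSeries_twist_vonMangoldt_eq hs
  simp only [chebyshevTwist]
  rw [h, logDeriv_apply, χ.deriv_LFunction_eq_deriv_LSeries hs, χ.LFunction_eq_LSeries hs]
  congr 1
  rw [← neg_div]
  exact h2

theorem mean_square_chebyshevTwist (hG : PrimitiveRH) {N : ℕ} [NeZero N] {χ : DirichletCharacter ℂ N} (hχ : χ ≠ 1)
    {ε : ℝ} (hε : 0 < ε) : ∃ P ∈ trigPoly, ∀ᶠ Y : ℝ in atTop,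
      ∫ u in (0 : ℝ)..Y, ‖chebyshevTwist χ (Real.exp u) * (Real.exp (-(u / 2)) : ℝ) - P u‖ ^ 2 ≤ ε * Y :=
  (goodL_LFunction hG hχ).mean_square_approx ((measurable_chebyshevTwist χ).comp Real.measurable_exp)
    ⟨Real.log 4 + 4, fun u _ => norm_chebyshevTwist_le χ (Real.exp_pos u).le⟩
    (fun s hs => laplace_chebyshevTwist χ (by rw [hs]; norm_num)) hε

theorem chebyshevTwist_one (t : ℝ) : chebyshevTwist (1 : DirichletCharacter ℂ 1) t = (Chebyshev.psi t : ℂ) := by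
  rw [chebyshevTwist, Chebyshev.psi, Complex.ofReal_sum]
  refine Finset.sum_congr rfl fun k _ => ?_
  rw [MulChar.one_apply (isUnit_of_subsingleton _), one_mul]

theorem mean_square_psi (hG : PrimitiveRH) {ε : ℝ} (hε : 0 < ε) : ∃ P ∈ trigPoly, ∀ᶠ Y : ℝ in atTop,
      ∫ u in (0 : ℝ)..Y,
        ‖((Chebyshev.psi (Real.exp u) - Real.exp u + 1 : ℝ) : ℂ) * (Real.exp (-(u / 2)) : ℝ) - P u‖ ^ 2 ≤ ε * Y := by
  have hm : Measurable fun u : ℝ => (Chebyshev.psi (Real.exp u) : ℂ) := by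
    have := (measurable_chebyshevTwist (1 : DirichletCharacter ℂ 1)).comp Real.measurable_exp
    simpa only [Function.comp_def, chebyshevTwist_one] using this
  have hl : 0 ≤ Real.log 4 := Real.log_nonneg (by norm_num)
  have hb : ∀ u : ℝ, ‖(Chebyshev.psi (Real.exp u) : ℂ)‖ ≤ (Real.log 4 + 4) * Real.exp u := by
    intro u
    rw [← chebyshevTwist_one]
    exact norm_chebyshevTwist_le _ (Real.exp_pos u).le
  have hb2 : ∀ u : ℝ, 0 < u → ‖((Real.exp u - 1 : ℝ) : ℂ)‖ ≤ 1 * Real.exp u := by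
    intro u hu
    rw [Complex.norm_real, Real.norm_of_nonneg (by linarith [Real.one_lt_exp_iff.2 hu])]
    linarith
  have e : ∀ u : ℝ, ((Chebyshev.psi (Real.exp u) - Real.exp u + 1 : ℝ) : ℂ) =
      (Chebyshev.psi (Real.exp u) : ℂ) - ((Real.exp u - 1 : ℝ) : ℂ) := by
    intro u
    push_cast
    ring
  have hm2 : Measurable fun u : ℝ => ((Real.exp u - 1 : ℝ) : ℂ) := by fun_prop
  refine (goodL_zeta hG).mean_square_approx (A := fun u => ((Chebyshev.psi (Real.exp u) - Real.exp u + 1 : ℝ) : ℂ))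
    ?_ ⟨Real.log 4 + 4 + 1, fun u hu => ?_⟩ (fun s hs => ?_) hε
  · simp_rw [e]
    exact hm.sub hm2
  · rw [e]
    refine (norm_sub_le _ _).trans ?_
    rw [add_mul]
    exact add_le_add (hb u) (hb2 u hu)
  · have hs1 : 1 < s.re := by rw [hs]; norm_num
    have hne1 : s ≠ 1 := by
      rintro rfl
      simp at hs1
    have hne0 : s ≠ 0 := by
      rintro rfl
      norm_num at hs
    have hsub : s - 1 ≠ 0 := sub_ne_zero.2 hne1
    have hz : riemannZeta s ≠ 0 := riemannZeta_ne_zero_of_one_lt_re hs1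
    simp_rw [e, sub_mul]
    rw [integral_sub (integrableOn_mul_exp hm (fun u _ => hb u) hs) (integrableOn_mul_exp hm2 hb2 hs)]
    have h1 := laplace_chebyshevTwist (1 : DirichletCharacter ℂ 1) hs1
    simp only [chebyshevTwist_one] at h1
    have h2 : ∫ u in Set.Ioi (0 : ℝ), ((Real.exp u - 1 : ℝ) : ℂ) * Complex.exp (-(s * u)) = 1 / (s - 1) - 1 / s := by
      have e2 : ∀ u : ℝ, ((Real.exp u - 1 : ℝ) : ℂ) * Complex.exp (-(s * u)) =
          Complex.exp (-(s - 1) * u) - Complex.exp (-s * u) := by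
        intro u
        push_cast
        rw [sub_mul, one_mul, ← Complex.exp_add]
        congr 2 <;> ring
      have hr1 : (-(s - 1)).re < 0 := by simp; linarith
      have hr2 : (-s).re < 0 := by simp; linarith
      simp_rw [e2]
      rw [integral_sub (integrableOn_exp_mul_complex_Ioi hr1 0) (integrableOn_exp_mul_complex_Ioi hr2 0),
        integral_exp_mul_complex_Ioi hr1, integral_exp_mul_complex_Ioi hr2]
      simp only [Complex.ofReal_zero, mul_zero, Complex.exp_zero]
      rw [neg_div_neg_eq, neg_div_neg_eq]
    rw [h1, h2]
    have hL : DirichletCharacter.LFunction (1 : DirichletCharacter ℂ 1) = riemannZeta :=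
      DirichletCharacter.LFunction_modOne_eq
    rw [hL]
    have h3 : logDeriv (DirichletCharacter.LFunctionTrivChar₁ 1) s = 1 / (s - 1) + logDeriv riemannZeta s := by
      have hev : DirichletCharacter.LFunctionTrivChar₁ 1 =ᶠ[𝓝 s] fun z => (z - 1) * riemannZeta z := by
        filter_upwards [isOpen_ne.mem_nhds hne1] with z hz
        exact LFunctionTrivChar₁_one_of_ne hz
      rw [logDeriv_apply, hev.deriv_eq, hev.eq_of_nhds, ← logDeriv_apply,
        logDeriv_mul s hsub hz (by fun_prop) (differentiableAt_riemannZeta hne1)]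
      congr 1
      rw [logDeriv_apply]
      simp
    rw [h3]
    field_simp
    ring

/-! ### Functions of bounded or vanishing mean -/

def MeanBdd (F : ℝ → ℂ) : Prop :=
  (∀ a b, IntervalIntegrable F volume a b) ∧ ∃ C : ℝ, ∀ᶠ Y : ℝ in atTop, ∫ u in (2 : ℝ)..Y, ‖F u‖ ≤ C * Y

def MeanNull (F : ℝ → ℂ) : Prop :=
  (∀ a b, IntervalIntegrable F volume a b) ∧
    ∀ ε > 0, ∀ᶠ Y : ℝ in atTop, ∫ u in (2 : ℝ)..Y, ‖F u‖ ≤ ε * Y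

theorem MeanAP.meanBdd {F : ℝ → ℂ} (hF : MeanAP F) : MeanBdd F := by
  obtain ⟨C, _, h⟩ := hF.mean_norm_bounded
  exact ⟨hF.1, C, h⟩

theorem MeanNull.meanBdd {F : ℝ → ℂ} (hF : MeanNull F) : MeanBdd F :=
  ⟨hF.1, 1, hF.2 1 one_pos⟩

theorem integral_norm_add_le {F G : ℝ → ℂ} (hF : ∀ a b, IntervalIntegrable F volume a b)
    (hG : ∀ a b, IntervalIntegrable G volume a b) {a Y : ℝ} (hY : a ≤ Y) :
    ∫ u in a..Y, ‖F u + G u‖ ≤ (∫ u in a..Y, ‖F u‖) + ∫ u in a..Y, ‖G u‖ := by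
  rw [← intervalIntegral.integral_add (hF _ _).norm (hG _ _).norm]
  exact intervalIntegral.integral_mono_on hY ((hF _ _).add (hG _ _)).norm ((hF _ _).norm.add (hG _ _).norm)
    fun u _ => norm_add_le _ _

theorem MeanBdd.add {F G : ℝ → ℂ} (hF : MeanBdd F) (hG : MeanBdd G) : MeanBdd fun u => F u + G u := by
  obtain ⟨C, hC⟩ := hF.2
  obtain ⟨D, hD⟩ := hG.2
  refine ⟨fun a b => (hF.1 a b).add (hG.1 a b), C + D, ?_⟩
  filter_upwards [hC, hD, eventually_ge_atTop 2] with Y h1 h2 hY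
  have := integral_norm_add_le hF.1 hG.1 hY
  linarith

theorem MeanNull.add {F G : ℝ → ℂ} (hF : MeanNull F) (hG : MeanNull G) : MeanNull fun u => F u + G u := by
  refine ⟨fun a b => (hF.1 a b).add (hG.1 a b), fun ε hε => ?_⟩
  filter_upwards [hF.2 (ε / 2) (half_pos hε), hG.2 (ε / 2) (half_pos hε), eventually_ge_atTop 2] with Y h1 h2 hY
  have := integral_norm_add_le hF.1 hG.1 hY
  linarith

theorem MeanNull.neg {F : ℝ → ℂ} (hF : MeanNull F) : MeanNull fun u => -F u := by
  refine ⟨fun a b => (hF.1 a b).neg, fun ε hε => ?_⟩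
  simpa only [norm_neg] using hF.2 ε hε

theorem MeanBdd.meanNull_of_isLittleO {F G : ℝ → ℂ} (hG : MeanBdd G) (hF : ∀ a b, IntervalIntegrable F volume a b)
    (h : F =o[atTop] G) : MeanNull F := by
  refine ⟨hF, fun ε hε => ?_⟩
  obtain ⟨C, hC⟩ := hG.2
  have hδ : 0 < ε / 2 / (|C| + 1) := by positivity
  obtain ⟨T, hT⟩ := eventually_atTop.1 (h.def hδ)
  set T' := max T 2
  have h2 : ∀ᶠ Y : ℝ in atTop, ∫ u in (2 : ℝ)..T', ‖F u‖ ≤ ε / 2 * Y :=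
    (tendsto_id.const_mul_atTop (half_pos hε)).eventually_ge_atTop _
  filter_upwards [hC, h2, eventually_ge_atTop T'] with Y h1 h2 hY
  have hY0 : (0 : ℝ) < Y := lt_of_lt_of_le (by norm_num) ((le_max_right T 2).trans hY)
  rw [← intervalIntegral.integral_add_adjacent_intervals (hF 2 T').norm (hF T' Y).norm]
  have h3 : ∫ u in T'..Y, ‖F u‖ ≤ ∫ u in T'..Y, ε / 2 / (|C| + 1) * ‖G u‖ :=
    intervalIntegral.integral_mono_on hY (hF _ _).norm ((hG.1 _ _).norm.const_mul _)
      fun u hu => hT u ((le_max_left T 2).trans hu.1)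
  rw [intervalIntegral.integral_const_mul] at h3
  have h4 : ∫ u in T'..Y, ‖G u‖ ≤ ∫ u in (2 : ℝ)..Y, ‖G u‖ := by
    rw [← intervalIntegral.integral_add_adjacent_intervals (hG.1 2 T').norm (hG.1 T' Y).norm]
    have : 0 ≤ ∫ u in (2 : ℝ)..T', ‖G u‖ :=
      intervalIntegral.integral_nonneg (le_max_right _ _) fun u _ => norm_nonneg _
    linarith
  have h5 : ε / 2 / (|C| + 1) * ∫ u in T'..Y, ‖G u‖ ≤ ε / 2 / (|C| + 1) * ((|C| + 1) * Y) := by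
    refine mul_le_mul_of_nonneg_left (h4.trans (h1.trans ?_)) hδ.le
    exact mul_le_mul_of_nonneg_right ((le_abs_self C).trans (by linarith)) hY0.le
  have h6 : ε / 2 / (|C| + 1) * ((|C| + 1) * Y) = ε / 2 * Y := by
    field_simp
  linarith

theorem meanBdd_const (c : ℂ) : MeanBdd fun _ => c := by
  refine ⟨fun a b => intervalIntegrable_const, ‖c‖, ?_⟩
  filter_upwards with Y
  rw [intervalIntegral.integral_const, smul_eq_mul]
  nlinarith [norm_nonneg c]

theorem MeanNull.of_tendsto_zero {F : ℝ → ℂ} (hF : ∀ a b, IntervalIntegrable F volume a b)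
    (h : Tendsto F atTop (𝓝 0)) : MeanNull F :=
  (meanBdd_const 1).meanNull_of_isLittleO hF ((isLittleO_const_iff one_ne_zero).2 h)

theorem MeanNull.comp_half {F : ℝ → ℂ} (hF : MeanNull F) : MeanNull fun u => F (u / 2) := by
  refine ⟨fun a b => ?_, fun ε hε => ?_⟩
  · have := (hF.1 (a / 2) (b / 2)).comp_mul_left (c := 1 / 2)
    convert this using 1
    · ext u
      congr 1
      ring
    · ring
    · ring
  · have h2 : ∀ᶠ Y : ℝ in atTop, 2 * ∫ u in (1 : ℝ)..2, ‖F u‖ ≤ ε / 2 * Y :=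
      (tendsto_id.const_mul_atTop (half_pos hε)).eventually_ge_atTop _
    filter_upwards [h2, (tendsto_id.atTop_div_const (zero_lt_two' ℝ)).eventually (hF.2 (ε / 2) (half_pos hε))] with Y h1 h2
    rw [intervalIntegral.integral_comp_div (fun u => ‖F u‖) two_ne_zero, smul_eq_mul]
    have e : (2 : ℝ) / 2 = 1 := by norm_num
    rw [e, ← intervalIntegral.integral_add_adjacent_intervals (hF.1 1 2).norm (hF.1 2 (Y / 2)).norm]
    simp only [id] at h2
    linarith

theorem MeanAP.add {F G : ℝ → ℂ} (hF : MeanAP F) (hG : MeanAP G) : MeanAP fun u => F u + G u := by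
  refine ⟨fun a b => (hF.1 a b).add (hG.1 a b), fun ε hε => ?_⟩
  obtain ⟨P, hP, h1⟩ := hF.2 (ε / 2) (half_pos hε)
  obtain ⟨Q, hQ, h2⟩ := hG.2 (ε / 2) (half_pos hε)
  refine ⟨P + Q, trigPoly.add_mem hP hQ, ?_⟩
  filter_upwards [h1, h2, eventually_ge_atTop 2] with Y h1 h2 hY
  have := integral_norm_add_le (F := fun u => F u - P u) (G := fun u => G u - Q u)
    (fun a b => (hF.1 a b).sub ((trigPoly_continuous hP).intervalIntegrable a b))
    (fun a b => (hG.1 a b).sub ((trigPoly_continuous hQ).intervalIntegrable a b)) hY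
  have e : ∀ u, F u - P u + (G u - Q u) = F u + G u - (P + Q) u := by
    intro u
    simp only [Pi.add_apply]
    ring
  simp_rw [e] at this
  linarith

theorem MeanNull.meanAP {F : ℝ → ℂ} (hF : MeanNull F) : MeanAP F := by
  refine ⟨hF.1, fun ε hε => ⟨0, trigPoly.zero_mem, ?_⟩⟩
  simpa using hF.2 ε hε

theorem meanAP_const (c : ℂ) : MeanAP fun _ => c := by
  refine ⟨fun a b => intervalIntegrable_const, fun ε hε => ⟨fun _ => c, const_mem_trigPoly c, ?_⟩⟩
  filter_upwards [eventually_ge_atTop 0] with Y hY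
  simp only [sub_self, norm_zero, intervalIntegral.integral_zero]
  positivity

theorem MeanAP.const_mul {F : ℝ → ℂ} (hF : MeanAP F) (c : ℂ) : MeanAP fun u => c * F u := by
  refine ⟨fun a b => (hF.1 a b).const_mul c, fun ε hε => ?_⟩
  obtain ⟨P, hP, h1⟩ := hF.2 (ε / (‖c‖ + 1)) (by positivity)
  refine ⟨c • P, trigPoly.smul_mem c hP, ?_⟩
  filter_upwards [h1, eventually_ge_atTop 2] with Y h1 hY
  have e : ∀ u, ‖c * F u - (c • P) u‖ = ‖c‖ * ‖F u - P u‖ := by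
    intro u
    rw [← norm_mul, mul_sub]
    rfl
  simp_rw [e]
  rw [intervalIntegral.integral_const_mul]
  have h0 : 0 ≤ ∫ u in (2 : ℝ)..Y, ‖F u - P u‖ := intervalIntegral.integral_nonneg hY fun u _ => norm_nonneg _
  calc ‖c‖ * ∫ u in (2 : ℝ)..Y, ‖F u - P u‖ ≤ (‖c‖ + 1) * (ε / (‖c‖ + 1) * Y) := by
        refine mul_le_mul (by linarith) h1 h0 (by positivity)
    _ = ε * Y := by field_simp

theorem meanAP_sum {ι : Type*} {F : ι → ℝ → ℂ} (s : Finset ι) (h : ∀ i ∈ s, MeanAP (F i)) :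
    MeanAP fun u => ∑ i ∈ s, F i u := by
  induction s using Finset.induction_on with
  | empty => simpa using meanAP_const 0
  | insert i s hi ih =>
    simp_rw [Finset.sum_insert hi]
    exact (h i (Finset.mem_insert_self i s)).add (ih fun j hj => h j (Finset.mem_insert_of_mem hj))

theorem meanAP_of_mean_square {F : ℝ → ℂ} (hF : ∀ a b, IntervalIntegrable F volume a b)
    (hF2 : ∀ P ∈ trigPoly, ∀ a b, IntervalIntegrable (fun u => ‖F u - P u‖ ^ 2) volume a b)
    (h : ∀ ε > 0, ∃ P ∈ trigPoly, ∀ᶠ Y : ℝ in atTop, ∫ u in (0 : ℝ)..Y, ‖F u - P u‖ ^ 2 ≤ ε * Y) : MeanAP F := by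
  refine ⟨hF, fun ε hε => ?_⟩
  obtain ⟨P, hP, h1⟩ := h (ε ^ 2) (by positivity)
  refine ⟨P, hP, ?_⟩
  filter_upwards [h1, eventually_ge_atTop 2] with Y h1 hY
  have hi : ∀ a b, IntervalIntegrable (fun u => F u - P u) volume a b :=
    fun a b => (hF a b).sub ((trigPoly_continuous hP).intervalIntegrable a b)
  have h2 : ∫ u in (2 : ℝ)..Y, ‖F u - P u‖ ≤ ∫ u in (2 : ℝ)..Y, (ε / 2 + 1 / (2 * ε) * ‖F u - P u‖ ^ 2) := by
    refine intervalIntegral.integral_mono_on hY (hi _ _).norm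
      (intervalIntegrable_const.add ((hF2 P hP _ _).const_mul _)) fun u _ => ?_
    have e : ε / 2 + 1 / (2 * ε) * ‖F u - P u‖ ^ 2 - ‖F u - P u‖ = (ε - ‖F u - P u‖) ^ 2 / (2 * ε) := by
      field_simp
      ring
    have : 0 ≤ (ε - ‖F u - P u‖) ^ 2 / (2 * ε) := by positivity
    linarith
  rw [intervalIntegral.integral_add intervalIntegrable_const ((hF2 P hP _ _).const_mul _),
    intervalIntegral.integral_const_mul, intervalIntegral.integral_const, smul_eq_mul] at h2
  have h3 : ∫ u in (2 : ℝ)..Y, ‖F u - P u‖ ^ 2 ≤ ε ^ 2 * Y := by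
    rw [← intervalIntegral.integral_add_adjacent_intervals (hF2 P hP 0 2) (hF2 P hP 2 Y)] at h1
    have : 0 ≤ ∫ u in (0 : ℝ)..2, ‖F u - P u‖ ^ 2 :=
      intervalIntegral.integral_nonneg (by norm_num) fun u _ => by positivity
    linarith
  have h4 : 1 / (2 * ε) * ∫ u in (2 : ℝ)..Y, ‖F u - P u‖ ^ 2 ≤ 1 / (2 * ε) * (ε ^ 2 * Y) :=
    mul_le_mul_of_nonneg_left h3 (by positivity)
  have h5 : 1 / (2 * ε) * (ε ^ 2 * Y) = ε / 2 * Y := by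
    field_simp
  nlinarith

/-! ### Partial summation -/

theorem integral_exp_mul_primitive_le {g : ℝ → ℝ} (hg0 : ∀ v, 0 ≤ g v) {Y : ℝ} (hY : 0 ≤ Y)
    (hg : IntervalIntegrable g volume 0 Y) :
    ∫ y in (0 : ℝ)..Y, Real.exp (-(y / 2)) * ∫ v in (0 : ℝ)..y, g v ≤
      2 * ∫ v in (0 : ℝ)..Y, Real.exp (-(v / 2)) * g v := by
  have hgi : IntegrableOn g (Set.Ioc 0 Y) := (intervalIntegrable_iff_integrableOn_Ioc_of_le hY).1 hg
  have hei : IntegrableOn (fun y : ℝ => Real.exp (-(y / 2))) (Set.Ioc 0 Y) :=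
    (intervalIntegrable_iff_integrableOn_Ioc_of_le hY).1 (Continuous.intervalIntegrable (by fun_prop) _ _)
  set k : ℝ → ℝ → ℝ := fun y v => {z : ℝ × ℝ | z.2 ≤ z.1}.indicator (fun z => Real.exp (-(z.1 / 2)) * g z.2) (y, v)
    with hk
  have hms : MeasurableSet {z : ℝ × ℝ | z.2 ≤ z.1} := measurableSet_le measurable_snd measurable_fst
  have hki : Integrable (Function.uncurry k) ((volume.restrict (Set.Ioc 0 Y)).prod (volume.restrict (Set.Ioc 0 Y))) :=
    (hei.mul_prod hgi).indicator hms
  have h1 : ∫ y in (0 : ℝ)..Y, Real.exp (-(y / 2)) * ∫ v in (0 : ℝ)..y, g v =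
      ∫ y in Set.Ioc 0 Y, ∫ v in Set.Ioc 0 Y, k y v := by
    rw [intervalIntegral.integral_of_le hY]
    refine setIntegral_congr_fun measurableSet_Ioc fun y hy => ?_
    rw [intervalIntegral.integral_of_le hy.1.le, ← integral_const_mul]
    have e : ∀ v, k y v = (Set.Iic y).indicator (fun v => Real.exp (-(y / 2)) * g v) v := by
      intro v
      simp only [hk, Set.indicator_apply, Set.mem_ofPred_eq, Set.mem_Iic]
    simp_rw [e]
    rw [setIntegral_indicator measurableSet_Iic]
    congr 2
    ext v
    simp only [Set.mem_Ioc, Set.mem_inter_iff, Set.mem_Iic]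
    constructor
    · exact fun h => ⟨⟨h.1, h.2.trans hy.2⟩, h.2⟩
    · exact fun h => ⟨h.1.1, h.2⟩
  rw [h1, integral_integral_swap hki, intervalIntegral.integral_of_le hY, ← integral_const_mul]
  have hswap : Integrable (fun v => ∫ y in Set.Ioc 0 Y, k y v) (volume.restrict (Set.Ioc 0 Y)) :=
    hki.integral_prod_right
  have hr : IntegrableOn (fun v => 2 * (Real.exp (-(v / 2)) * g v)) (Set.Ioc 0 Y) := by
    refine ((intervalIntegrable_iff_integrableOn_Ioc_of_le hY).1 ?_)
    exact (hg.continuousOn_mul (f := g) (g := fun v : ℝ => Real.exp (-(v / 2))) (by fun_prop)).const_mul 2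
  refine setIntegral_mono_on hswap hr measurableSet_Ioc fun v hv => ?_
  have e : ∀ y, k y v = g v * (Set.Ici v).indicator (fun y => Real.exp (-(1 / 2) * y)) y := by
    intro y
    simp only [hk, Set.indicator_apply, Set.mem_ofPred_eq, Set.mem_Ici]
    split_ifs
    · rw [mul_comm]
      congr 2
      ring
    · rw [mul_zero]
  simp_rw [e]
  rw [integral_const_mul]
  have hint : IntegrableOn (fun y : ℝ => Real.exp (-(1 / 2) * y)) (Set.Ici v) :=
    (integrableOn_Ici_iff_integrableOn_Ioi).2 (integrableOn_exp_mul_Ioi (by norm_num) v)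
  have h2 : ∫ y in Set.Ioc 0 Y, (Set.Ici v).indicator (fun y => Real.exp (-(1 / 2) * y)) y ≤ 2 * Real.exp (-(v / 2)) := by
    calc ∫ y in Set.Ioc 0 Y, (Set.Ici v).indicator (fun y => Real.exp (-(1 / 2) * y)) y
        ≤ ∫ y, (Set.Ici v).indicator (fun y => Real.exp (-(1 / 2) * y)) y :=
          setIntegral_le_integral ((integrable_indicator_iff measurableSet_Ici).2 hint)
            (Eventually.of_forall fun y => Set.indicator_nonneg (fun _ _ => (Real.exp_pos _).le) y)
      _ = 2 * Real.exp (-(v / 2)) := by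
          rw [integral_indicator measurableSet_Ici, integral_Ici_eq_integral_Ioi, integral_exp_mul_Ioi (by norm_num)]
          have : -(1 / 2) * v = -(v / 2) := by ring
          rw [this]
          ring
  nlinarith [hg0 v]

theorem meanNull_primitive {g Θ : ℝ → ℂ} (hg : ∀ a b, IntervalIntegrable g volume a b) (hΘ : MeanBdd Θ)
    (h : ∀ y : ℝ, 0 ≤ y → (y * Real.exp (-(y / 2)) : ℝ) * g y =
      Θ y + (Real.exp (-(y / 2)) : ℝ) * ∫ v in (0 : ℝ)..y, g v) :
    MeanNull fun y => (Real.exp (-(y / 2)) : ℝ) * ∫ v in (0 : ℝ)..y, g v := by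
  set H : ℝ → ℝ := fun v => Real.exp (-(v / 2)) * ‖g v‖ with hH
  have hHi : ∀ a b, IntervalIntegrable H volume a b := fun a b =>
    (hg a b).norm.continuousOn_mul (g := fun v : ℝ => Real.exp (-(v / 2))) (by fun_prop)
  have hH0 : ∀ v, 0 ≤ H v := fun v => mul_nonneg (Real.exp_pos _).le (norm_nonneg _)
  set W : ℝ → ℝ := fun y => Real.exp (-(y / 2)) * ∫ v in (0 : ℝ)..y, ‖g v‖ with hW
  have hWc : Continuous W := (by fun_prop : Continuous fun y : ℝ => Real.exp (-(y / 2))).mul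
    (intervalIntegral.continuous_primitive (fun a b => (hg a b).norm) 0)
  have hVc : Continuous fun y : ℝ => ((Real.exp (-(y / 2)) : ℝ) : ℂ) * ∫ v in (0 : ℝ)..y, g v :=
    (by fun_prop : Continuous fun y : ℝ => ((Real.exp (-(y / 2)) : ℝ) : ℂ)).mul
      (intervalIntegral.continuous_primitive hg 0)
  have hVW : ∀ y : ℝ, 0 ≤ y → ‖((Real.exp (-(y / 2)) : ℝ) : ℂ) * ∫ v in (0 : ℝ)..y, g v‖ ≤ W y := by
    intro y hy
    rw [norm_mul, Complex.norm_real, Real.norm_of_nonneg (Real.exp_pos _).le]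
    exact mul_le_mul_of_nonneg_left (intervalIntegral.norm_integral_le_integral_norm hy) (Real.exp_pos _).le
  have hWint : ∀ Y : ℝ, 2 ≤ Y → ∫ y in (2 : ℝ)..Y, W y ≤ 2 * ∫ v in (0 : ℝ)..Y, H v := by
    intro Y hY
    have h1 := integral_exp_mul_primitive_le (fun v => norm_nonneg (g v)) (by linarith : 0 ≤ Y) (hg 0 Y).norm
    rw [← intervalIntegral.integral_add_adjacent_intervals (hWc.intervalIntegrable 0 2)
      (hWc.intervalIntegrable 2 Y)] at h1
    have h2 : 0 ≤ ∫ y in (0 : ℝ)..2, W y := intervalIntegral.integral_nonneg (by norm_num) fun y hy =>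
      mul_nonneg (Real.exp_pos _).le (intervalIntegral.integral_nonneg hy.1 fun _ _ => norm_nonneg _)
    linarith
  obtain ⟨C, hC⟩ := hΘ.2
  have key : ∀ ε : ℝ, 0 < ε → ∀ᶠ Y : ℝ in atTop, ∫ v in (0 : ℝ)..Y, H v ≤ ε * Y := by
    intro ε hε
    set T : ℝ := max 4 (4 * |C| / ε) with hT
    have hT4 : 4 ≤ T := le_max_left _ _
    have hTC : 4 * |C| ≤ ε * T := by
      have := le_max_right 4 (4 * |C| / ε)
      rw [div_le_iff₀ hε] at this
      linarith
    have h2 : ∀ᶠ Y : ℝ in atTop, 2 * ∫ v in (0 : ℝ)..T, H v ≤ ε / 2 * Y :=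
      (tendsto_id.const_mul_atTop (half_pos hε)).eventually_ge_atTop _
    filter_upwards [hC, h2, eventually_ge_atTop T] with Y h1 h2 hY
    have hY2 : 2 ≤ Y := by linarith
    have h3 : ∫ y in (2 : ℝ)..Y, y * H y ≤ (∫ y in (2 : ℝ)..Y, ‖Θ y‖) + ∫ y in (2 : ℝ)..Y, W y := by
      rw [← intervalIntegral.integral_add (hΘ.1 _ _).norm (hWc.intervalIntegrable _ _)]
      refine intervalIntegral.integral_mono_on hY2 ((hHi _ _).continuousOn_mul (by fun_prop))
        ((hΘ.1 _ _).norm.add (hWc.intervalIntegrable _ _)) fun y hy => ?_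
      have hy0 : 0 ≤ y := by linarith [hy.1]
      have e : y * H y = ‖((y * Real.exp (-(y / 2)) : ℝ) : ℂ) * g y‖ := by
        rw [norm_mul, Complex.norm_real, Real.norm_of_nonneg (mul_nonneg hy0 (Real.exp_pos _).le), hH, mul_assoc]
      rw [e, h y hy0]
      exact (norm_add_le _ _).trans (by linarith [hVW y hy0])
    have h4 : T * ∫ y in T..Y, H y ≤ ∫ y in (2 : ℝ)..Y, y * H y := by
      have hi : ∀ a b, IntervalIntegrable (fun y => y * H y) volume a b := fun a b =>
        (hHi a b).continuousOn_mul (by fun_prop)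
      rw [← intervalIntegral.integral_add_adjacent_intervals (hi 2 T) (hi T Y), ← intervalIntegral.integral_const_mul]
      have h5 : 0 ≤ ∫ y in (2 : ℝ)..T, y * H y := intervalIntegral.integral_nonneg (by linarith) fun y hy =>
        mul_nonneg (by linarith [hy.1]) (hH0 y)
      have h6 : ∫ y in T..Y, T * H y ≤ ∫ y in T..Y, y * H y :=
        intervalIntegral.integral_mono_on hY ((hHi _ _).const_mul _) (hi _ _) fun y hy =>
          mul_le_mul_of_nonneg_right hy.1 (hH0 y)
      linarith
    have h7 := hWint Y hY2
    have h8 := intervalIntegral.integral_add_adjacent_intervals (hHi 0 T) (hHi T Y)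
    have h9 : 0 ≤ ∫ v in T..Y, H v := intervalIntegral.integral_nonneg hY fun y _ => hH0 y
    have h10 : C * Y ≤ |C| * Y := mul_le_mul_of_nonneg_right (le_abs_self C) (by linarith)
    have h11 : 4 * |C| * Y ≤ ε * T * Y := mul_le_mul_of_nonneg_right hTC (by linarith)
    have h12 : 0 ≤ ∫ v in (0 : ℝ)..T, H v := intervalIntegral.integral_nonneg (by linarith) fun y _ => hH0 y
    set a := ∫ v in (0 : ℝ)..T, H v
    set b := ∫ v in T..Y, H v
    rw [← h8] at h7 ⊢
    have h13 : T * b ≤ |C| * Y + 2 * (a + b) := by linarith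
    have h14 : T * (a + b) ≤ T * (2 * a) + 2 * (|C| * Y) := by nlinarith
    have h15 : T * (a + b) ≤ T * (ε * Y) := by nlinarith
    exact le_of_mul_le_mul_left h15 (by linarith)
  refine ⟨fun a b => hVc.intervalIntegrable a b, fun ε hε => ?_⟩
  filter_upwards [key (ε / 2) (half_pos hε), eventually_ge_atTop 2] with Y h1 hY
  have h2 : ∫ y in (2 : ℝ)..Y, ‖((Real.exp (-(y / 2)) : ℝ) : ℂ) * ∫ v in (0 : ℝ)..y, g v‖ ≤ ∫ y in (2 : ℝ)..Y, W y :=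
    intervalIntegral.integral_mono_on hY (hVc.norm.intervalIntegrable _ _) (hWc.intervalIntegrable _ _)
      fun y hy => hVW y (by linarith [hy.1])
  linarith [hWint Y hY]

theorem integral_summatory_exp (f : ℕ → ℂ) {y : ℝ} (hy : 0 ≤ y) :
    ∫ v in (0 : ℝ)..y, ∑ k ∈ Finset.Icc 1 ⌊Real.exp v⌋₊, f k =
      ∑ k ∈ Finset.Icc 1 ⌊Real.exp y⌋₊, f k * ((y - Real.log k : ℝ) : ℂ) := by
  have h1 : ∀ v ∈ Set.uIcc 0 y, ∑ k ∈ Finset.Icc 1 ⌊Real.exp v⌋₊, f k =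
      ∑ k ∈ Finset.Icc 1 ⌊Real.exp y⌋₊, (Set.Ici (Real.log k)).indicator (fun _ => f k) v := by
    intro v hv
    rw [Set.uIcc_of_le hy] at hv
    simp only [Set.indicator_apply]
    rw [← Finset.sum_filter]
    refine Finset.sum_congr ?_ fun _ _ => rfl
    ext k
    simp only [Finset.mem_Icc, Finset.mem_filter, Set.mem_Ici]
    constructor
    · rintro ⟨hk1, hk2⟩
      have hk0 : (0 : ℝ) < k := by exact_mod_cast hk1
      refine ⟨⟨hk1, hk2.trans (Nat.floor_mono (Real.exp_le_exp.2 hv.2))⟩, ?_⟩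
      rw [Real.log_le_iff_le_exp hk0]
      exact (Nat.le_floor_iff (Real.exp_pos v).le).1 hk2
    · rintro ⟨⟨hk1, _⟩, hk2⟩
      have hk0 : (0 : ℝ) < k := by exact_mod_cast hk1
      rw [Real.log_le_iff_le_exp hk0] at hk2
      exact ⟨hk1, Nat.le_floor hk2⟩
  rw [intervalIntegral.integral_congr h1, intervalIntegral.integral_finsetSum]
  · refine Finset.sum_congr rfl fun k hk => ?_
    rw [Finset.mem_Icc] at hk
    have hk0 : (0 : ℝ) < k := by exact_mod_cast hk.1
    have hl : Real.log k ≤ y := by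
      rw [Real.log_le_iff_le_exp hk0]
      exact (Nat.le_floor_iff (Real.exp_pos y).le).1 hk.2
    have hl0 : 0 ≤ Real.log k := Real.log_natCast_nonneg k
    have hvol : volume.real (Set.Ioc 0 y ∩ Set.Ici (Real.log k)) = y - Real.log k := by
      rcases hl0.eq_or_lt with h0 | h0
      · rw [← h0]
        have : Set.Ioc 0 y ∩ Set.Ici (0 : ℝ) = Set.Ioc 0 y := by
          ext v
          simp only [Set.mem_inter_iff, Set.mem_Ioc, Set.mem_Ici, and_iff_left_iff_imp]
          exact fun h => h.1.le
        rw [this, Real.volume_real_Ioc_of_le hy]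
      · have : Set.Ioc 0 y ∩ Set.Ici (Real.log k) = Set.Icc (Real.log k) y := by
          ext v
          simp only [Set.mem_inter_iff, Set.mem_Ioc, Set.mem_Ici, Set.mem_Icc]
          exact ⟨fun h => ⟨h.2, h.1.2⟩, fun h => ⟨⟨h0.trans_le h.1, h.2⟩, h.1⟩⟩
        rw [this, Real.volume_real_Icc_of_le hl]
    rw [intervalIntegral.integral_of_le hy, setIntegral_indicator measurableSet_Ici, setIntegral_const, hvol,
      Complex.real_smul, mul_comm]
  · intro k _
    rw [intervalIntegrable_iff_integrableOn_Ioc_of_le hy]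
    exact (integrable_const (f k)).indicator measurableSet_Ici

/-! ### Prime sums twisted by quadratic characters -/

theorem intervalIntegrable_of_norm_le_exp {E : Type*} [NormedAddCommGroup E] {F : ℝ → E}
    (hF : AEStronglyMeasurable F volume) {C K : ℝ}
    (h : ∀ u, ‖F u‖ ≤ C * Real.exp (K * |u|)) (a b : ℝ) : IntervalIntegrable F volume a b :=
  IntervalIntegrable.mono_fun' (g := fun u : ℝ => C * Real.exp (K * |u|)) (Continuous.intervalIntegrable (by fun_prop) _ _)
    hF.restrict (Eventually.of_forall h)

theorem meanAP_of_mean_square_of_measurable {F : ℝ → ℂ} (hF : Measurable F) {C : ℝ}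
    (hC : ∀ u, ‖F u‖ ≤ C * Real.exp |u|)
    (h : ∀ ε > 0, ∃ P ∈ trigPoly, ∀ᶠ Y : ℝ in atTop, ∫ u in (0 : ℝ)..Y, ‖F u - P u‖ ^ 2 ≤ ε * Y) : MeanAP F := by
  refine meanAP_of_mean_square (fun a b => ?_) (fun P hP a b => ?_) h
  · exact intervalIntegrable_of_norm_le_exp (C := C) (K := 1) hF.aestronglyMeasurable (fun u => by simpa using hC u) a b
  · obtain ⟨D, hD0, hD⟩ := trigPoly_bounded hP
    refine intervalIntegrable_of_norm_le_exp (C := (C + D) ^ 2) (K := 2)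
      ((hF.sub (trigPoly_continuous hP).measurable).norm.pow_const 2).aestronglyMeasurable (fun u => ?_) a b
    have h1 : 1 ≤ Real.exp |u| := Real.one_le_exp (abs_nonneg u)
    have h2 : ‖F u - P u‖ ≤ (C + D) * Real.exp |u| := by
      refine (norm_sub_le _ _).trans ?_
      nlinarith [hC u, hD u]
    have h3 : Real.exp (2 * |u|) = Real.exp |u| ^ 2 := by
      rw [← Real.exp_nat_mul]
      norm_num
    rw [Real.norm_of_nonneg (by positivity), h3, ← mul_pow]
    exact pow_le_pow_left₀ (norm_nonneg _) h2 2

theorem intervalIntegrable_summatory_exp (f : ℕ → ℂ) (a b : ℝ) :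
    IntervalIntegrable (fun u : ℝ => ∑ k ∈ Finset.Icc 1 ⌊Real.exp u⌋₊, f k) volume a b := by
  refine IntervalIntegrable.mono_fun' (g := fun _ => ∑ k ∈ Finset.Icc 1 ⌊Real.exp (max a b)⌋₊, ‖f k‖)
    intervalIntegrable_const ((measurable_summatory f).comp Real.measurable_exp).aestronglyMeasurable ?_
  refine (ae_restrict_mem measurableSet_uIoc).mono fun u hu => ?_
  refine (norm_sum_le _ _).trans (Finset.sum_le_sum_of_subset_of_nonneg ?_ fun _ _ _ => norm_nonneg _)
  exact Finset.Icc_subset_Icc le_rfl (Nat.floor_mono (Real.exp_le_exp.2 hu.2))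

noncomputable def thetaTwist {N : ℕ} (χ : DirichletCharacter ℂ N) (t : ℝ) : ℂ :=
  ∑ k ∈ Finset.Icc 1 ⌊t⌋₊, if k.Prime then χ (k : ZMod N) * (Real.log k : ℂ) else 0

noncomputable def primeTwist {N : ℕ} (χ : DirichletCharacter ℂ N) (t : ℝ) : ℂ :=
  ∑ k ∈ Finset.Icc 1 ⌊t⌋₊, if k.Prime then χ (k : ZMod N) else 0

theorem primeTwist_eq_thetaTwist_add {N : ℕ} (χ : DirichletCharacter ℂ N) {y : ℝ} (hy : 0 ≤ y) :
    (y * Real.exp (-(y / 2)) : ℝ) * primeTwist χ (Real.exp y) =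
      (Real.exp (-(y / 2)) : ℝ) * thetaTwist χ (Real.exp y) +
        (Real.exp (-(y / 2)) : ℝ) * ∫ v in (0 : ℝ)..y, primeTwist χ (Real.exp v) := by
  simp only [primeTwist]
  rw [integral_summatory_exp _ hy, ← mul_add, thetaTwist, ← Finset.sum_add_distrib, mul_comm y, Complex.ofReal_mul,
    mul_assoc, Finset.mul_sum]
  congr 1
  refine Finset.sum_congr rfl fun k _ => ?_
  split_ifs
  · push_cast
    ring
  · simp

theorem sum_Icc_one_eq {M : Type*} [AddCommMonoid M] (f : ℕ → M) {N : ℕ} (hN : 2 ≤ N) :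
    ∑ k ∈ Finset.Icc 1 N, f k = f 1 + (f 2 + ∑ k ∈ Finset.Icc 3 N, f k) := by
  have e : ∀ a, Finset.Ioc a N = Finset.Icc (a + 1) N := fun a => by
    ext k
    simp only [Finset.mem_Ioc, Finset.mem_Icc]
    omega
  rw [← Finset.add_sum_Ioc_eq_sum_Icc (by omega : 1 ≤ N), e, ← Finset.add_sum_Ioc_eq_sum_Icc hN, e]

theorem norm_chebyshevTwist_sub_le {N : ℕ} [NeZero N] {χ : DirichletCharacter ℂ N} (hχ : χ ^ 2 = 1) {t : ℝ} (ht : 0 ≤ t) :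
    ‖chebyshevTwist χ t - thetaTwist χ t - (Chebyshev.theta (√t) : ℂ)‖ ≤
      Chebyshev.psi t - Chebyshev.theta t - Chebyshev.theta (√t) + ∑ p ∈ N.primeFactors, Real.log p := by
  set M := ⌊Real.log t / Real.log 2⌋₊ + 2 with hM
  have hM2 : 2 ≤ M := by omega
  set A : ℕ → ℂ := fun k => ∑ p ∈ Finset.Ioc 0 ⌊t ^ ((1 : ℝ) / k)⌋₊ with p.Prime,
    χ (p : ZMod N) ^ k * (Real.log p : ℂ) with hA
  set B : ℕ → ℝ := fun k => Chebyshev.theta (t ^ ((1 : ℝ) / k)) with hB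
  have hpsi : Chebyshev.psi t = ∑ k ∈ Finset.Icc 1 M, B k := Chebyshev.psi_eq_sum_theta' ht (by omega)
  have htw : chebyshevTwist χ t = ∑ k ∈ Finset.Icc 1 M, A k := by
    have h1 := Chebyshev.sum_PrimePow_eq_sum_sum' (fun n : ℕ => χ (n : ZMod N) * (ArithmeticFunction.vonMangoldt n : ℂ))
      ht (by omega : ⌊Real.log t / Real.log 2⌋₊ ≤ M)
    have h2 : chebyshevTwist χ t = ∑ n ∈ Finset.Ioc 0 ⌊t⌋₊ with IsPrimePow n,
        χ (n : ZMod N) * (ArithmeticFunction.vonMangoldt n : ℂ) := by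
      rw [Finset.sum_filter]
      refine Finset.sum_congr rfl fun n _ => ?_
      split_ifs with h
      · rfl
      · rw [ArithmeticFunction.vonMangoldt_eq_zero_iff.2 h, Complex.ofReal_zero, mul_zero]
    rw [h2, h1]
    refine Finset.sum_congr rfl fun k hk => ?_
    refine Finset.sum_congr rfl fun p hp => ?_
    rw [Finset.mem_Icc] at hk
    have hp' : p.Prime := (Finset.mem_filter.1 hp).2
    rw [ArithmeticFunction.vonMangoldt_apply_pow (by omega), ArithmeticFunction.vonMangoldt_apply_prime hp', Nat.cast_pow,
      map_pow]
  have hAB : ∀ k, ‖A k‖ ≤ B k := by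
    intro k
    refine (norm_sum_le _ _).trans (Finset.sum_le_sum fun p _ => ?_)
    rw [norm_mul, norm_pow, Complex.norm_real, Real.norm_of_nonneg (Real.log_natCast_nonneg p)]
    exact mul_le_of_le_one_left (Real.log_natCast_nonneg p) (pow_le_one₀ (norm_nonneg _) (χ.norm_le_one _))
  have hA1 : A 1 = thetaTwist χ t := by
    simp only [hA, Nat.cast_one, div_one, Real.rpow_one, pow_one]
    rw [Finset.sum_filter]
    rfl
  have hB1 : B 1 = Chebyshev.theta t := by
    simp only [hB, Nat.cast_one, div_one, Real.rpow_one]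
  have hB2 : B 2 = Chebyshev.theta (√t) := by
    simp only [hB, Nat.cast_ofNat, Real.sqrt_eq_rpow]
  have hA2 : ‖A 2 - (B 2 : ℂ)‖ ≤ ∑ p ∈ N.primeFactors, Real.log p := by
    have e : A 2 - (B 2 : ℂ) = ∑ p ∈ Finset.Ioc 0 ⌊t ^ ((1 : ℝ) / (2 : ℕ))⌋₊ with p.Prime,
        if p ∈ N.primeFactors then -(Real.log p : ℂ) else 0 := by
      simp only [hA, hB, Chebyshev.theta]
      rw [Complex.ofReal_sum, ← Finset.sum_sub_distrib]
      refine Finset.sum_congr rfl fun p hp => ?_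
      have hp' : p.Prime := (Finset.mem_filter.1 hp).2
      rw [← MulChar.pow_apply' χ two_ne_zero, hχ]
      split_ifs with h
      · rw [MulChar.map_nonunit]
        · ring
        · rw [ZMod.isUnit_iff_coprime, hp'.coprime_iff_not_dvd]
          exact not_not.2 (Nat.dvd_of_mem_primeFactors h)
      · rw [MulChar.one_apply]
        · ring
        · rw [ZMod.isUnit_iff_coprime, hp'.coprime_iff_not_dvd]
          exact fun hd => h (Nat.mem_primeFactors.2 ⟨hp', hd, NeZero.ne N⟩)
    rw [e, ← Finset.sum_filter]
    refine (norm_sum_le _ _).trans ?_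
    simp_rw [norm_neg, Complex.norm_real]
    refine (Finset.sum_le_sum_of_subset_of_nonneg (t := N.primeFactors) (fun p hp => (Finset.mem_filter.1 hp).2)
      fun _ _ _ => norm_nonneg _).trans (le_of_eq ?_)
    exact Finset.sum_congr rfl fun p _ => Real.norm_of_nonneg (Real.log_natCast_nonneg p)
  rw [hpsi, htw, sum_Icc_one_eq A hM2, sum_Icc_one_eq B hM2, hA1, hB1, ← hB2]
  have h3 : ‖∑ k ∈ Finset.Icc 3 M, A k‖ ≤ ∑ k ∈ Finset.Icc 3 M, B k :=
    (norm_sum_le _ _).trans (Finset.sum_le_sum fun k _ => hAB k)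
  have e : thetaTwist χ t + (A 2 + ∑ k ∈ Finset.Icc 3 M, A k) - thetaTwist χ t - (B 2 : ℂ) =
      (A 2 - (B 2 : ℂ)) + ∑ k ∈ Finset.Icc 3 M, A k := by ring
  rw [e]
  exact (norm_add_le _ _).trans (by linarith)

theorem psi_sub_theta_sub_theta_sqrt_le : ∃ C : ℝ, ∀ u : ℝ, 0 ≤ u →
    Chebyshev.psi (Real.exp u) - Chebyshev.theta (Real.exp u) - Chebyshev.theta (√(Real.exp u)) ≤
      C * Real.exp (u / 3) := by
  obtain ⟨D, hD⟩ := Chebyshev.psi_sub_theta_le_mul_sqrt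
  refine ⟨|D| + 2 * (Real.log 4 + 4), fun u hu => ?_⟩
  have hl : 0 ≤ Real.log 4 := Real.log_nonneg (by norm_num)
  have h1 := Chebyshev.psi_sub_theta_le_psi_add_psi_add_psi (Real.exp u)
  have h2 := hD (√(Real.exp u))
  simp_rw [Real.sqrt_eq_rpow, ← Real.exp_mul] at h1 h2 ⊢
  rw [show (1 / 2 : ℝ) = 2⁻¹ by norm_num] at h2 ⊢
  have h3 := Chebyshev.psi_le_const_mul_self (Real.exp_pos (u * 3⁻¹)).le
  have h5 := Chebyshev.psi_le_const_mul_self (Real.exp_pos (u * 5⁻¹)).le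
  have e3 : Real.exp (u * 3⁻¹) = Real.exp (u / 3) := by rw [div_eq_mul_inv]
  have e5 : Real.exp (u * 5⁻¹) ≤ Real.exp (u / 3) := Real.exp_le_exp.2 (by linarith)
  have e4 : Real.exp (u * 2⁻¹ * 2⁻¹) ≤ Real.exp (u / 3) := Real.exp_le_exp.2 (by linarith)
  rw [e3] at h1 h3
  have h6 : D * Real.exp (u * 2⁻¹ * 2⁻¹) ≤ |D| * Real.exp (u / 3) :=
    mul_le_mul (le_abs_self D) e4 (Real.exp_pos _).le (abs_nonneg D)
  have h7 : (Real.log 4 + 4) * Real.exp (u * 5⁻¹) ≤ (Real.log 4 + 4) * Real.exp (u / 3) :=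
    mul_le_mul_of_nonneg_left e5 (by positivity)
  linarith

theorem meanAP_psi (hG : PrimitiveRH) : MeanAP fun u : ℝ =>
    ((Chebyshev.psi (Real.exp u) - Real.exp u + 1 : ℝ) : ℂ) * (Real.exp (-(u / 2)) : ℝ) := by
  have hl : 0 ≤ Real.log 4 := Real.log_nonneg (by norm_num)
  refine meanAP_of_mean_square_of_measurable (C := Real.log 4 + 6) ?_ (fun u => ?_) fun ε hε => mean_square_psi hG hε
  · have : Measurable fun u : ℝ => Chebyshev.psi (Real.exp u) :=
      (Chebyshev.psi_mono.comp Real.exp_monotone).measurable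
    fun_prop
  · rw [← Complex.ofReal_mul, Complex.norm_real, Real.norm_eq_abs, abs_mul, abs_of_pos (Real.exp_pos (-(u / 2)))]
    have h1 := Chebyshev.psi_le_const_mul_self (Real.exp_pos u).le
    have h2 : |Chebyshev.psi (Real.exp u) - Real.exp u + 1| ≤ (Real.log 4 + 5) * Real.exp u + 1 := by
      rw [abs_le]
      constructor
      · nlinarith [Chebyshev.psi_nonneg (Real.exp u), Real.exp_pos u]
      · nlinarith [Real.exp_pos u]
    refine (mul_le_mul_of_nonneg_right h2 (Real.exp_pos _).le).trans ?_
    have e1 : Real.exp u * Real.exp (-(u / 2)) ≤ Real.exp |u| := by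
      rw [← Real.exp_add, Real.exp_le_exp]
      linarith [le_abs_self u, abs_nonneg u]
    have e2 : Real.exp (-(u / 2)) ≤ Real.exp |u| := by
      rw [Real.exp_le_exp]
      linarith [neg_le_abs u, abs_nonneg u]
    nlinarith

theorem intervalIntegrable_theta_exp (a b : ℝ) :
    IntervalIntegrable (fun u : ℝ => (Chebyshev.theta (Real.exp u) : ℂ)) volume a b :=
  have h : IntervalIntegrable (fun u : ℝ => Chebyshev.theta (Real.exp u)) volume a b :=
    (Chebyshev.theta_mono.comp Real.exp_monotone).intervalIntegrable
  ⟨h.1.ofReal, h.2.ofReal⟩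

theorem tendsto_exp_neg_mul_atTop {c : ℝ} (hc : 0 < c) : Tendsto (fun u : ℝ => Real.exp (-(c * u))) atTop (𝓝 0) :=
  Real.tendsto_exp_neg_atTop_nhds_zero.comp (tendsto_id.const_mul_atTop hc)

theorem meanNull_theta (hG : PrimitiveRH) :
    MeanNull fun u : ℝ => (Chebyshev.theta (Real.exp u) : ℂ) * (Real.exp (-u) : ℝ) - 1 := by
  set G : ℝ → ℂ := fun u : ℝ => ((Chebyshev.psi (Real.exp u) - Real.exp u + 1 : ℝ) : ℂ) * (Real.exp (-(u / 2)) : ℝ)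
    with hGdef
  have hGm := (meanAP_psi hG).meanBdd
  have hF : ∀ a b, IntervalIntegrable
      (fun u : ℝ => (Chebyshev.theta (Real.exp u) : ℂ) * (Real.exp (-u) : ℝ) - 1) volume a b := fun a b =>
    ((intervalIntegrable_theta_exp a b).mul_continuousOn (by fun_prop)).sub intervalIntegrable_const
  have hM : MeanNull fun u => ((Real.exp (-(u / 2)) : ℝ) : ℂ) * G u := by
    refine hGm.meanNull_of_isLittleO (fun a b => (hGm.1 a b).continuousOn_mul (by fun_prop)) ?_
    have hw : Tendsto (fun u : ℝ => ((Real.exp (-(u / 2)) : ℝ) : ℂ)) atTop (𝓝 0) := by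
      rw [← Complex.ofReal_zero]
      refine (Complex.continuous_ofReal.tendsto 0).comp ?_
      simpa only [div_eq_inv_mul] using tendsto_exp_neg_mul_atTop (c := 2⁻¹) (by norm_num)
    have := ((isLittleO_const_iff (one_ne_zero (α := ℂ))).2 hw).mul_isBigO (isBigO_refl G atTop)
    simpa only [one_mul] using this
  set R : ℝ → ℂ := fun u => (Chebyshev.theta (Real.exp u) : ℂ) * (Real.exp (-u) : ℝ) - 1 -
    ((Real.exp (-(u / 2)) : ℝ) : ℂ) * G u with hR
  have hRn : MeanNull R := by
    refine MeanNull.of_tendsto_zero (fun a b => (hF a b).sub (hM.1 a b)) ?_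
    obtain ⟨C, hC⟩ := Chebyshev.psi_sub_theta_le_mul_sqrt
    have hlim : Tendsto (fun u : ℝ => C * Real.exp (-(1 / 2 * u)) + Real.exp (-(1 * u))) atTop (𝓝 0) := by
      simpa using ((tendsto_exp_neg_mul_atTop (c := 1 / 2) (by norm_num)).const_mul C).add
        (tendsto_exp_neg_mul_atTop one_pos)
    refine squeeze_zero_norm (fun u => ?_) hlim
    have e : R u = ((-((Chebyshev.psi (Real.exp u) - Chebyshev.theta (Real.exp u)) * Real.exp (-u) + Real.exp (-u)) : ℝ) : ℂ) := by
      have e1 : ((Real.exp (-(u / 2)) : ℝ) : ℂ) * G u =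
          ((Chebyshev.psi (Real.exp u) * Real.exp (-u) - Real.exp u * Real.exp (-u) + Real.exp (-u) : ℝ) : ℂ) := by
        have e2 : Real.exp (-u) = Real.exp (-(u / 2)) * Real.exp (-(u / 2)) := by
          rw [← Real.exp_add]
          congr 1
          ring
        rw [hGdef, e2]
        push_cast
        ring
      rw [hR]
      simp only
      rw [e1, ← Real.exp_add, add_neg_cancel, Real.exp_zero]
      push_cast
      ring
    have h0 : 0 ≤ Chebyshev.psi (Real.exp u) - Chebyshev.theta (Real.exp u) := by
      linarith [Chebyshev.theta_le_psi (Real.exp u)]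
    rw [e, Complex.norm_real, norm_neg, Real.norm_of_nonneg (by positivity), one_mul]
    have h1 := mul_le_mul_of_nonneg_right (hC (Real.exp u)) (Real.exp_pos (-u)).le
    have e3 : C * √(Real.exp u) * Real.exp (-u) = C * Real.exp (-(1 / 2 * u)) := by
      rw [Real.sqrt_eq_rpow, ← Real.exp_mul, mul_assoc, ← Real.exp_add]
      congr 2
      ring
    linarith
  have := hRn.add hM
  simpa only [hR, sub_add_cancel] using this

theorem meanAP_primeTwist (hG : PrimitiveRH) {N : ℕ} [NeZero N] {χ : DirichletCharacter ℂ N} (hχ1 : χ ≠ 1)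
    (hχ2 : χ ^ 2 = 1) : MeanAP fun y : ℝ => (y * Real.exp (-(y / 2)) : ℝ) * primeTwist χ (Real.exp y) := by
  have hl : 0 ≤ Real.log 4 := Real.log_nonneg (by norm_num)
  have hX : MeanAP fun u : ℝ => chebyshevTwist χ (Real.exp u) * (Real.exp (-(u / 2)) : ℝ) := by
    refine meanAP_of_mean_square_of_measurable (C := Real.log 4 + 4) ?_ (fun u => ?_)
      fun ε hε => mean_square_chebyshevTwist hG hχ1 hε
    · exact ((measurable_chebyshevTwist χ).comp Real.measurable_exp).mul (by fun_prop)
    · rw [norm_mul, Complex.norm_real, Real.norm_of_nonneg (Real.exp_pos _).le]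
      refine (mul_le_mul_of_nonneg_right (norm_chebyshevTwist_le χ (Real.exp_pos u).le) (Real.exp_pos _).le).trans ?_
      rw [mul_assoc, ← Real.exp_add]
      refine mul_le_mul_of_nonneg_left (Real.exp_le_exp.2 ?_) (by positivity)
      linarith [le_abs_self u, abs_nonneg u]
  have hθi : ∀ a b, IntervalIntegrable (fun u : ℝ => ((Real.exp (-(u / 2)) : ℝ) : ℂ) * thetaTwist χ (Real.exp u)) volume a b :=
    fun a b => (intervalIntegrable_summatory_exp _ a b).continuousOn_mul (by fun_prop)
  have hF1 := (meanNull_theta hG).comp_half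
  have hD : MeanNull fun u : ℝ => ((Real.exp (-(u / 2)) : ℝ) : ℂ) * thetaTwist χ (Real.exp u) -
      chebyshevTwist χ (Real.exp u) * (Real.exp (-(u / 2)) : ℝ) +
        ((Chebyshev.theta (Real.exp (u / 2)) : ℂ) * (Real.exp (-(u / 2)) : ℝ) - 1) + 1 := by
    refine MeanNull.of_tendsto_zero
      (fun a b => (((hθi a b).sub (hX.1 a b)).add (hF1.1 a b)).add intervalIntegrable_const) ?_
    obtain ⟨C, hC⟩ := psi_sub_theta_sub_theta_sqrt_le
    set Q := ∑ p ∈ N.primeFactors, Real.log p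
    have hlim : Tendsto (fun u : ℝ => C * Real.exp (-(1 / 6 * u)) + Q * Real.exp (-(1 / 2 * u))) atTop (𝓝 0) := by
      simpa using ((tendsto_exp_neg_mul_atTop (c := 1 / 6) (by norm_num)).const_mul C).add
        ((tendsto_exp_neg_mul_atTop (c := 1 / 2) (by norm_num)).const_mul Q)
    refine squeeze_zero_norm' ?_ hlim
    filter_upwards [eventually_ge_atTop 0] with u hu
    have h1 := norm_chebyshevTwist_sub_le hχ2 (Real.exp_pos u).le
    have h2 := hC u hu
    have hs : √(Real.exp u) = Real.exp (u / 2) := by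
      rw [Real.sqrt_eq_rpow, ← Real.exp_mul]
      congr 1
      ring
    rw [hs] at h1 h2
    have e : ((Real.exp (-(u / 2)) : ℝ) : ℂ) * thetaTwist χ (Real.exp u) -
      chebyshevTwist χ (Real.exp u) * (Real.exp (-(u / 2)) : ℝ) +
        ((Chebyshev.theta (Real.exp (u / 2)) : ℂ) * (Real.exp (-(u / 2)) : ℝ) - 1) + 1 =
        -((chebyshevTwist χ (Real.exp u) - thetaTwist χ (Real.exp u) - (Chebyshev.theta (Real.exp (u / 2)) : ℂ)) *
          (Real.exp (-(u / 2)) : ℝ)) := by ring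
    rw [e, norm_neg, norm_mul, Complex.norm_real, Real.norm_of_nonneg (Real.exp_pos _).le]
    refine (mul_le_mul_of_nonneg_right (h1.trans (add_le_add_left h2 Q)) (Real.exp_pos _).le).trans (le_of_eq ?_)
    rw [add_mul, mul_assoc, ← Real.exp_add]
    congr 3 <;> ring
  have hΘ : MeanAP fun u : ℝ => ((Real.exp (-(u / 2)) : ℝ) : ℂ) * thetaTwist χ (Real.exp u) := by
    have := ((hX.add hD.meanAP).add hF1.neg.meanAP).add (meanAP_const (-1))
    convert this using 1
    ext u
    ring
  have hV := meanNull_primitive (g := fun v => primeTwist χ (Real.exp v))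
    (fun a b => intervalIntegrable_summatory_exp _ a b) hΘ.meanBdd fun y hy => primeTwist_eq_thetaTwist_add χ hy
  have hsum := hΘ.add hV.meanAP
  refine ⟨fun a b => (intervalIntegrable_summatory_exp _ a b).continuousOn_mul (by fun_prop), fun ε hε => ?_⟩
  obtain ⟨P, hP, h⟩ := hsum.2 ε hε
  refine ⟨P, hP, ?_⟩
  filter_upwards [h, eventually_ge_atTop 2] with Y h1 hY
  refine le_of_eq_of_le (intervalIntegral.integral_congr fun y hy => ?_) h1
  rw [Set.uIcc_of_le hY] at hy
  rw [primeTwist_eq_thetaTwist_add χ (by linarith [hy.1])]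

/-! ### Expansion of the race between residues and non-residues -/

/-- The weight of a residue class in the race. -/
noncomputable def raceWeight (q : ℕ) (b : ZMod q) : ℂ :=
  if IsUnit b then (if ∃ u : (ZMod q)ˣ, (u : ZMod q) ^ 2 = b then 1 - (rho q : ℂ) else 1) else 0

theorem raceWeight_unit {q : ℕ} (a : (ZMod q)ˣ) :
    raceWeight q a =
      1 - if a ∈ MonoidHom.range (powMonoidHom 2 : (ZMod q)ˣ →* (ZMod q)ˣ) then (rho q : ℂ) else 0 := by
  have e : (∃ u : (ZMod q)ˣ, (u : ZMod q) ^ 2 = (a : ZMod q)) ↔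
      a ∈ MonoidHom.range (powMonoidHom 2 : (ZMod q)ˣ →* (ZMod q)ˣ) := by
    simp only [MonoidHom.mem_range, powMonoidHom_apply, Units.ext_iff, Units.val_pow_eq_pow_val]
  rw [raceWeight, if_pos a.isUnit]
  simp only [e]
  split_ifs <;> simp

theorem raceWeight_sq_mul {q : ℕ} (b a : (ZMod q)ˣ) :
    raceWeight q ((b ^ 2 * a : (ZMod q)ˣ) : ZMod q) = raceWeight q a := by
  rw [raceWeight_unit, raceWeight_unit, Subgroup.mul_mem_cancel_left]
  exact ⟨b, rfl⟩

theorem sum_raceWeight (q : ℕ) [NeZero q] : ∑ a : (ZMod q)ˣ, raceWeight q a = 0 := by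
  have h := Subgroup.index_mul_card (MonoidHom.range (powMonoidHom 2 : (ZMod q)ˣ →* (ZMod q)ˣ))
  rw [Nat.card_eq_fintype_card (α := (ZMod q)ˣ), ← Finset.card_univ, Nat.card_eq_fintype_card,
    Fintype.card_subtype] at h
  have h1 : ∑ a : (ZMod q)ˣ,
      (if a ∈ MonoidHom.range (powMonoidHom 2 : (ZMod q)ˣ →* (ZMod q)ˣ) then (rho q : ℂ) else 0) =
        ∑ a : (ZMod q)ˣ, 1 := by
    rw [Finset.sum_ite, Finset.sum_const_zero, add_zero, Finset.sum_const,
      Finset.sum_const, nsmul_eq_mul, nsmul_eq_mul, mul_one, ← h, rho]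
    push_cast
    ring
  simp_rw [raceWeight_unit]
  rw [Finset.sum_sub_distrib, sub_eq_zero]
  convert h1.symm

theorem exists_raceWeight_eq_sum (q : ℕ) [NeZero q] :
    ∃ c : DirichletCharacter ℂ q → ℂ, (∀ χ, c χ ≠ 0 → χ ≠ 1 ∧ χ ^ 2 = 1) ∧
      ∀ b : ZMod q, raceWeight q b = ∑ χ, c χ * χ b := by
  have hφ : (q.totient : ℂ) ≠ 0 := by
    exact_mod_cast (Nat.totient_pos.2 (Nat.pos_of_ne_zero (NeZero.ne q))).ne'
  refine ⟨fun χ => (q.totient : ℂ)⁻¹ * ∑ a : (ZMod q)ˣ, raceWeight q a * χ ((a⁻¹ : (ZMod q)ˣ) : ZMod q),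
    fun χ hc => ⟨?_, ?_⟩, fun b => ?_⟩
  · rintro rfl
    refine hc ?_
    simp only [MulChar.one_apply_coe, mul_one]
    rw [sum_raceWeight, mul_zero]
  · by_contra h2
    obtain ⟨b, hb⟩ := MulChar.ne_one_iff.1 h2
    refine hc ?_
    set S := ∑ a : (ZMod q)ˣ, raceWeight q a * χ ((a⁻¹ : (ZMod q)ˣ) : ZMod q) with hS
    have h3 : S = (χ ^ 2) b * S := by
      rw [hS, Finset.mul_sum]
      refine Fintype.sum_equiv (Equiv.mulLeft (b ^ 2)) _ _ fun a => ?_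
      rw [Equiv.coe_mulLeft, raceWeight_sq_mul, mul_inv, Units.val_mul, map_mul, mul_left_comm]
      congr 1
      rw [← mul_assoc, MulChar.pow_apply_coe, ← map_pow, ← map_mul, ← Units.val_pow_eq_pow_val, ← Units.val_mul,
        mul_inv_cancel, Units.val_one, map_one, one_mul]
    have h4 : (1 - (χ ^ 2) b) * S = 0 := by
      rw [sub_mul, one_mul, ← h3, sub_self]
    rcases mul_eq_zero.1 h4 with h5 | h5
    · exact absurd (sub_eq_zero.1 h5).symm hb
    · beta_reduce
      rw [← hS, h5, mul_zero]
  · simp_rw [mul_assoc, Finset.sum_mul]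
    rw [← Finset.mul_sum, Finset.sum_comm]
    have h1 : ∀ a : (ZMod q)ˣ, ∑ χ : DirichletCharacter ℂ q,
        raceWeight q a * χ ((a⁻¹ : (ZMod q)ˣ) : ZMod q) * χ b =
          if (a : ZMod q) = b then raceWeight q b * q.totient else 0 := by
      intro a
      simp_rw [mul_assoc]
      rw [← Finset.mul_sum, ← ZMod.inv_coe_unit, DirichletCharacter.sum_char_inv_mul_char_eq ℂ a.isUnit b]
      split_ifs with h
      · rw [h]
      · rw [mul_zero]
    simp_rw [h1]
    by_cases hb : IsUnit b
    · obtain ⟨u, rfl⟩ := hb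
      simp only [Units.val_inj, Finset.sum_ite_eq', Finset.mem_univ, if_true]
      field_simp
    · rw [Finset.sum_eq_zero, mul_zero, raceWeight, if_neg hb]
      intro a _
      rw [if_neg]
      rintro rfl
      exact hb a.isUnit

theorem card_prime_le_eq_sum {x : ℝ} (hx : 0 ≤ x) (Q : ℕ → Prop) :
    (Nat.card {p : ℕ | p.Prime ∧ (p : ℝ) ≤ x ∧ Q p} : ℂ) =
      ∑ k ∈ Finset.Icc 1 ⌊x⌋₊, if k.Prime then (if Q k then 1 else 0) else 0 := by
  have e : {p : ℕ | p.Prime ∧ (p : ℝ) ≤ x ∧ Q p} =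
      ((Finset.Icc 1 ⌊x⌋₊).filter fun k => k.Prime ∧ Q k : Finset ℕ) := by
    ext p
    simp only [Set.mem_ofPred_eq, Finset.coe_filter, Finset.mem_Icc, Nat.le_floor_iff hx]
    constructor
    · exact fun h => ⟨⟨h.1.one_lt.le, h.2.1⟩, h.1, h.2.2⟩
    · exact fun h => ⟨h.2.1, h.1.2, h.2.2⟩
  rw [e, Nat.card_coe_set_eq, Set.ncard_coe_finset, Finset.card_filter, Nat.cast_sum]
  refine Finset.sum_congr rfl fun k _ => ?_
  by_cases h1 : k.Prime <;> by_cases h2 : Q k <;> simp [h1, h2]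

theorem race_eq_sum (q : ℕ) {x : ℝ} (hx : 0 ≤ x) :
    (primePiNR q x : ℂ) - ((rho q : ℂ) - 1) * primePiR q x =
      ∑ k ∈ Finset.Icc 1 ⌊x⌋₊, if k.Prime then raceWeight q k else 0 := by
  rw [primePiNR, primePiR, card_prime_le_eq_sum hx, card_prime_le_eq_sum hx, Finset.mul_sum, ← Finset.sum_sub_distrib]
  refine Finset.sum_congr rfl fun k _ => ?_
  by_cases hk : k.Prime
  · simp only [if_pos hk, raceWeight]
    by_cases h2 : ∃ u : (ZMod q)ˣ, (u : ZMod q) ^ 2 = (k : ZMod q)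
    · have h1 : IsUnit (k : ZMod q) := by
        obtain ⟨u, hu⟩ := h2
        rw [← hu]
        exact u.isUnit.pow 2
      simp [h1, h2]
    · simp [h2]
  · simp [hk]

theorem exists_Efun_eq_sum (q : ℕ) [NeZero q] :
    ∃ c : DirichletCharacter ℂ q → ℂ, (∀ χ, c χ ≠ 0 → χ ≠ 1 ∧ χ ^ 2 = 1) ∧
      ∀ y : ℝ, (Efun q (Real.exp y) : ℂ) =
        ∑ χ, c χ * ((y * Real.exp (-(y / 2)) : ℝ) * primeTwist χ (Real.exp y)) := by
  obtain ⟨c, hc, h⟩ := exists_raceWeight_eq_sum q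
  refine ⟨c, hc, fun y => ?_⟩
  have hs : Real.log (Real.exp y) / √(Real.exp y) = y * Real.exp (-(y / 2)) := by
    rw [Real.log_exp, Real.sqrt_eq_rpow, ← Real.exp_mul, div_eq_mul_inv, ← Real.exp_neg]
    congr 3
    ring
  have h1 : ∑ χ, c χ * primeTwist χ (Real.exp y) = (primePiNR q (Real.exp y) : ℂ) -
      ((rho q : ℂ) - 1) * primePiR q (Real.exp y) := by
    rw [race_eq_sum q (Real.exp_pos y).le]
    simp only [primeTwist, Finset.mul_sum]
    rw [Finset.sum_comm]
    refine Finset.sum_congr rfl fun k _ => ?_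
    split_ifs
    · rw [h]
    · simp
  rw [Efun, mul_div_assoc, hs, Complex.ofReal_mul, Complex.ofReal_sub, Complex.ofReal_mul, Complex.ofReal_sub]
  simp only [Complex.ofReal_natCast, Complex.ofReal_one]
  rw [← h1, Finset.sum_mul]
  refine Finset.sum_congr rfl fun χ _ => ?_
  ring

theorem GRH.primitiveRH (h : GRH) : PrimitiveRH := by
  intro N hN χ hχ s h0 h1 hs
  refine h N χ (NeZero.ne N) hχ s h0 h1 ?_
  rw [LFun, dif_pos (NeZero.ne N)]
  exact hs

theorem limiting_distribution_exists (hGRH : GRH) (q : ℕ) (hq : 3 ≤ q) :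
    ∃ μ : MeasureTheory.Measure ℝ, IsLimitingDistribution q μ := by
  have : NeZero q := ⟨by omega⟩
  obtain ⟨c, hc, hE⟩ := exists_Efun_eq_sum q
  have hAP : MeanAP fun y => (Efun q (Real.exp y) : ℂ) := by
    simp_rw [hE]
    refine meanAP_sum _ fun χ _ => ?_
    by_cases h0 : c χ = 0
    · simpa [h0] using meanAP_const 0
    · exact (meanAP_primeTwist hGRH.primitiveRH (hc χ h0).1 (hc χ h0).2).const_mul (c χ)
  have hm : Measurable fun y => Efun q (Real.exp y) := by
    have h1 : Measurable fun y => (Efun q (Real.exp y) : ℂ) := by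
      simp_rw [hE]
      refine Finset.measurable_sum _ fun χ _ => measurable_const.mul (Measurable.mul (by fun_prop) ?_)
      exact (measurable_summatory _).comp Real.measurable_exp
    simpa only [Function.comp_def, Complex.ofReal_re] using Complex.measurable_re.comp h1
  exact hAP.exists_limiting_measure hm
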